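/- arXiv:2303.00504 — 3 statements merged into one kernel-verified Lean document; each statement's English description precedes it below -/
import Mathlib

section
/- Let d ≥ 1. Suppose ξ and η are equivariant random measures over the stationary ergodic flow system (Ω, 𝔉, ℙ, θ) with the same finite intensity, and suppose that ℙ-a.s. the measure ξ(ω, ·) does not charge small sets. Then there exists a factor allocation balancing ξ and η. -/
open MeasureTheory Filter Set

noncomputable section

/-- Euclidean space `ℝ^d`. -/
abbrev Eucl (d : ℕ) := EuclideanSpace ℝ (Fin d)

/-- The half-open unit cube `[0,1)^d`. -/
def unitCube (d : ℕ) : Set (Eucl d) := {x | ∀ i, x i ∈ Set.Ico (0 : ℝ) 1}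

/-- `μ` does not charge small sets: it gives no mass to `(d-1)`-rectifiable sets,
i.e. `μ (f '' ℝ^(d-1)) = 0` for every Lipschitz map `f : ℝ^(d-1) → ℝ^d`. -/
def DoesNotChargeSmallSets (d : ℕ) (μ : Measure (Eucl d)) : Prop :=
  ∀ (f : Eucl (d - 1) → Eucl d) (K : NNReal), LipschitzWith K f → μ (Set.range f) = 0

variable {Ω : Type*} [MeasurableSpace Ω]

/-- The σ-algebra `σ(ξ, η)` generated by the measure-valued maps `ξ` and `η`. -/
def sigmaGen {d : ℕ} (ξ η : Ω → Measure (Eucl d)) : MeasurableSpace Ω :=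
  MeasurableSpace.comap ξ inferInstance ⊔ MeasurableSpace.comap η inferInstance

/-- `T` is a factor allocation for `(ξ, η)` over the flow `θ`: it is jointly measurable,
equivariant, and measurable with respect to `σ(ξ, η)` (times the Borel σ-algebra). -/
def IsFactorAllocation {d : ℕ} (θ : Eucl d → Ω → Ω) (ξ η : Ω → Measure (Eucl d))
    (T : Ω → Eucl d → Eucl d) : Prop :=
  Measurable (Function.uncurry T) ∧
  (∀ (ω : Ω) (x y : Eucl d), T (θ x ω) y = T ω (y + x) - x) ∧
  Measurable[(sigmaGen ξ η).prod (inferInstance : MeasurableSpace (Eucl d))]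
    (Function.uncurry T)

/-- In a preorder whose increasing sequences are bounded above, a monotone bounded functional
attains a value that cannot be increased further. -/
theorem exists_forall_ge_le {α : Type*} [Preorder α] [Nonempty α] (f : α → ENNReal)
    (hf : Monotone f) {C : ENNReal} (hC : C ≠ ⊤) (hfC : ∀ a, f a ≤ C)
    (hseq : ∀ u : ℕ → α, Monotone u → ∃ b, ∀ n, u n ≤ b) :
    ∃ a, ∀ b, a ≤ b → f b ≤ f a := by
  have hnext : ∀ (n : ℕ) (a : α), ∃ b, a ≤ b ∧
      (⨆ c : {c // a ≤ c}, f c) ≤ f b + ((n : ENNReal) + 1)⁻¹ := by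
    intro n a
    have hne : (⨆ c : {c // a ≤ c}, f c) ≠ ⊤ :=
      ne_top_of_le_ne_top hC (iSup_le fun c => hfC _)
    have hpos : ((n : ENNReal) + 1)⁻¹ ≠ 0 := by
      simp
    by_cases h0 : (⨆ c : {c // a ≤ c}, f c) = 0
    · exact ⟨a, le_rfl, by rw [h0]; exact zero_le⟩
    · have := ENNReal.sub_lt_self hne h0 hpos
      obtain ⟨⟨b, hab⟩, hb⟩ := lt_iSup_iff.1 this
      exact ⟨b, hab, tsub_le_iff_right.1 hb.le⟩
  choose g hg1 hg2 using hnext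
  let u : ℕ → α := fun n => Nat.rec (Classical.arbitrary α) (fun n a => g n a) n
  have hu : Monotone u := monotone_nat_of_le_succ fun n => hg1 n (u n)
  obtain ⟨b, hb⟩ := hseq u hu
  refine ⟨b, fun c hbc => ?_⟩
  have key : ∀ n : ℕ, f c ≤ f b + ((n : ENNReal) + 1)⁻¹ := by
    intro n
    calc f c ≤ ⨆ c : {c // u n ≤ c}, f c :=
          le_iSup (fun c : {c // u n ≤ c} => f c) ⟨c, (hb n).trans hbc⟩
      _ ≤ f (u (n + 1)) + ((n : ENNReal) + 1)⁻¹ := hg2 n (u n)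
      _ ≤ _ := by gcongr; exact hf (hb (n + 1))
  have lim : Tendsto (fun n : ℕ => f b + ((n : ENNReal) + 1)⁻¹) atTop (nhds (f b + 0)) := by
    refine Tendsto.const_add _ ?_
    have := (tendsto_add_atTop_iff_nat 1).2 ENNReal.tendsto_inv_nat_nhds_zero
    simpa using this
  rw [add_zero] at lim
  exact ge_of_tendsto' lim key

section Exhaustion

variable {X E : Type*} [MeasurableSpace X] [MeasurableSpace E]

/-- A partial transport of `P` into `Q`: a measurable domain together with a measurable
choice of group elements moving `P` restricted to the domain to a measure below `Q`. -/
structure PartialTransport (θ : E → X → X) (P Q : Measure X) where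
  dom : Set X
  shift : X → E
  dom_meas : MeasurableSet dom
  shift_meas : Measurable shift
  map_le : (P.restrict dom).map (fun x => θ (shift x) x) ≤ Q

instance (θ : E → X → X) (P Q : Measure X) : Preorder (PartialTransport θ P Q) where
  le s t := s.dom ⊆ t.dom ∧ EqOn s.shift t.shift s.dom
  le_refl s := ⟨Subset.rfl, fun _ _ => rfl⟩
  le_trans s t r h1 h2 := ⟨h1.1.trans h2.1, fun _ hx => (h1.2 hx).trans (h2.2 (h1.1 hx))⟩

theorem PartialTransport.exists_upper_bound {θ : E → X → X}
    (hθ : Measurable fun p : E × X => θ p.1 p.2) {P Q : Measure X} [Nonempty E]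
    (u : ℕ → PartialTransport θ P Q) (hu : Monotone u) : ∃ b, ∀ n, u n ≤ b := by
  obtain ⟨σ, hσ, hσu⟩ := exists_measurable_piecewise (fun n => (u n).dom)
    (fun n => (u n).dom_meas) (fun n => (u n).shift) (fun n => (u n).shift_meas) (by
      intro i j _ x hx
      rcases le_total i j with h | h
      · exact (hu h).2 hx.1
      · exact ((hu h).2 hx.2).symm)
  have hS : ∀ τ : X → E, Measurable τ → Measurable (fun x => θ (τ x) x) := fun τ h =>
    hθ.comp (h.prodMk measurable_id)
  refine ⟨⟨⋃ n, (u n).dom, σ, .iUnion fun n => (u n).dom_meas, hσ, ?_⟩, fun n =>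
    ⟨subset_iUnion (fun n => (u n).dom) n, (hσu n).symm⟩⟩
  refine Measure.le_iff.2 fun B hB => ?_
  rw [Measure.map_apply (hS _ hσ) hB, Measure.restrict_apply (hS _ hσ hB), inter_iUnion,
    Directed.measure_iUnion]
  · refine iSup_le fun n => ?_
    have h1 := Measure.le_iff.1 (u n).map_le B hB
    rw [Measure.map_apply (hS _ (u n).shift_meas) hB,
      Measure.restrict_apply (hS _ (u n).shift_meas hB)] at h1
    refine le_trans (le_of_eq ?_) h1
    congr 1
    ext x
    simp only [mem_inter_iff, mem_preimage, and_congr_left_iff]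
    intro hx
    rw [hσu n hx]
  · refine Monotone.directed_le fun m n h => ?_
    exact inter_subset_inter_right _ (hu h).1

/-- Exhaustion: if pieces of the remaining source can always be moved into the remaining
target, then the whole source can be moved onto the target. -/
theorem exists_map_eq_of_local {θ : E → X → X} [Nonempty E]
    (hθ : Measurable fun p : E × X => θ p.1 p.2) (P Q : Measure X) [IsFiniteMeasure P]
    [IsFiniteMeasure Q] (hPQ : P univ = Q univ)
    (hloc : ∀ B, MeasurableSet B → P B ≠ 0 → ∀ Q' : Measure X, Q' ≤ Q → Q' ≠ 0 →
      ∃ A ⊆ B, MeasurableSet A ∧ P A ≠ 0 ∧ ∃ τ : X → E, Measurable τ ∧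
        (P.restrict A).map (fun x => θ (τ x) x) ≤ Q') :
    ∃ τ : X → E, Measurable τ ∧ P.map (fun x => θ (τ x) x) = Q := by
  classical
  have hS : ∀ τ : X → E, Measurable τ → Measurable (fun x => θ (τ x) x) := fun τ h =>
    hθ.comp (h.prodMk measurable_id)
  have : Nonempty (PartialTransport θ P Q) :=
    ⟨⟨∅, fun _ => Classical.arbitrary E, .empty, measurable_const, by
      simpa using Measure.zero_le Q⟩⟩
  obtain ⟨s, hs⟩ := exists_forall_ge_le (fun s : PartialTransport θ P Q => P s.dom)
    (fun s t h => measure_mono (show s.dom ⊆ t.dom from And.left h)) (measure_ne_top P univ)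
    (fun s => measure_mono (subset_univ _))
    (fun u hu => PartialTransport.exists_upper_bound hθ u hu)
  set ν := (P.restrict s.dom).map (fun x => θ (s.shift x) x) with hν
  have hνle : ν ≤ Q := s.map_le
  have hνuniv : ν univ = P s.dom := by
    rw [hν, Measure.map_apply (hS _ s.shift_meas) .univ]; simp
  have hfull : P s.domᶜ = 0 := by
    by_contra hne
    have hQ' : Q - ν ≠ 0 := by
      intro h0
      have h1 : (Q - ν) univ = 0 := by rw [h0]; rfl
      rw [Measure.sub_apply .univ hνle, ← hPQ, hνuniv,
        ← measure_compl s.dom_meas (measure_ne_top _ _)] at h1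
      exact hne h1
    obtain ⟨A, hAs, hA, hPA, τ, hτ, hle⟩ :=
      hloc _ s.dom_meas.compl hne (Q - ν) Measure.sub_le hQ'
    have hdisj : Disjoint s.dom A := disjoint_left.2 fun x hx hxA => hAs hxA hx
    let σ := s.dom.piecewise s.shift τ
    have hσ : Measurable σ := s.shift_meas.piecewise s.dom_meas hτ
    have e1 : (P.restrict s.dom).map (fun x => θ (σ x) x) = ν := by
      refine Measure.map_congr ?_
      filter_upwards [ae_restrict_mem s.dom_meas] with x hx
      simp [σ, hx]
    have e2 : (P.restrict A).map (fun x => θ (σ x) x)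
        = (P.restrict A).map (fun x => θ (τ x) x) := by
      refine Measure.map_congr ?_
      filter_upwards [ae_restrict_mem hA] with x hx
      have : x ∉ s.dom := hAs hx
      simp [σ, this]
    let t : PartialTransport θ P Q := ⟨s.dom ∪ A, σ, s.dom_meas.union hA, hσ, by
      rw [Measure.restrict_union hdisj hA, Measure.map_add _ _ (hS _ hσ), e1, e2]
      calc _ ≤ ν + (Q - ν) := by gcongr
        _ = Q := by rw [add_comm, Measure.sub_add_cancel_of_le hνle]⟩
    have := hs t ⟨subset_union_left, fun x hx => by simp [t, σ, hx]⟩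
    simp only [t] at this
    rw [measure_union hdisj hA] at this
    have h2 : P s.dom < P s.dom + P A := ENNReal.lt_add_right (measure_ne_top _ _) hPA
    exact absurd this (not_le.2 h2)
  refine ⟨s.shift, s.shift_meas, ?_⟩
  have hres : P.restrict s.dom = P :=
    Measure.restrict_eq_self_of_ae_mem (by rw [ae_iff]; exact hfull)
  rw [hres] at hν
  rw [← hν]
  refine Measure.eq_of_le_of_measure_univ_eq hνle ?_
  rw [hνuniv, ← hPQ]
  rw [← measure_add_measure_compl s.dom_meas, hfull, add_zero]

end Exhaustion

open ProbabilityTheory unitInterval in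
/-- The distribution function of an atomless probability measure on `ℝ` is uniformly
distributed. -/
theorem measure_setOf_measureReal_Iic_le (ν : Measure ℝ) [IsProbabilityMeasure ν]
    (hν : ∀ t, ν {t} = 0) (s : I) : ν {t | ν.real (Iic t) ≤ s} = ENNReal.ofReal s := by
  have : NullSingletonClass ν := ⟨hν⟩
  have hmono : Monotone fun t => ν.real (Iic t) := fun a b h =>
    measureReal_mono (Iic_subset_Iic.2 h)
  have h1 : ∀ t, cdf ν t = ν.real (Iic t) := fun t => ProbabilityTheory.cdf_eq_real ν t
  have hcont : Continuous fun t => ν.real (Iic t) := by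
    simp_rw [← h1]
    refine continuous_iff_continuousAt.2 fun t => ?_
    rw [Monotone.continuousAt_iff_leftLim_eq_rightLim (monotone_cdf ν)]
    have h2 := (cdf ν).measure_singleton t
    rw [measure_cdf, hν, eq_comm, ENNReal.ofReal_eq_zero] at h2
    rw [StieltjesFunction.rightLim_eq]
    exact le_antisymm ((monotone_cdf ν).leftLim_le le_rfl) (by linarith)
  have htop : Tendsto (fun t => ν.real (Iic t)) atTop (nhds 1) := by
    simpa only [h1] using (tendsto_cdf_atTop ν).congr h1
  have hbot : Tendsto (fun t => ν.real (Iic t)) atBot (nhds 0) := by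
    simpa only [h1] using (tendsto_cdf_atBot ν).congr h1
  by_cases hs : (s : ℝ) = 1
  · have : {t | ν.real (Iic t) ≤ s} = univ := by
      ext t; simp [hs, measureReal_le_one]
    rw [this, hs]; simp
  have hs1 : (s : ℝ) < 1 := lt_of_le_of_ne s.2.2 hs
  set S := {t | ν.real (Iic t) ≤ s} with hS
  rcases S.eq_empty_or_nonempty with hemp | hne
  · have : (s : ℝ) ≤ 0 := by
      refine ge_of_tendsto' hbot fun t => ?_
      by_contra hlt
      exact (hemp ▸ (show t ∈ S from (not_le.1 hlt).le) : t ∈ (∅ : Set ℝ))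
    rw [hemp]; simp [ENNReal.ofReal_of_nonpos this]
  · obtain ⟨b, hb⟩ := (htop.eventually (lt_mem_nhds hs1)).exists
    have hbdd : BddAbove S := ⟨b, fun t ht => by
      by_contra hlt
      exact absurd (hmono (not_le.1 hlt).le) (not_le.2 (lt_of_le_of_lt ht hb))⟩
    have hcl : IsClosed S := isClosed_le hcont continuous_const
    have hmem : sSup S ∈ S := hcl.csSup_mem hne hbdd
    have hSeq : S = Iic (sSup S) := by
      ext t
      exact ⟨fun ht => le_csSup hbdd ht, fun ht => le_trans (hmono ht) hmem⟩
    have hge : (s : ℝ) ≤ ν.real (Iic (sSup S)) := by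
      have : Tendsto (fun t => ν.real (Iic t)) (nhdsWithin (sSup S) (Ioi (sSup S)))
          (nhds (ν.real (Iic (sSup S)))) := hcont.continuousWithinAt
      refine ge_of_tendsto this ?_
      filter_upwards [self_mem_nhdsWithin] with t ht
      by_contra hlt
      exact absurd (le_csSup hbdd (show t ∈ S from (not_le.1 hlt).le)) (not_le.2 ht)
    rw [hSeq, ← le_antisymm (show ν.real (Iic (sSup S)) ≤ s from hmem) hge]
    exact (ENNReal.ofReal_toReal (measure_ne_top _ _)).symm

section Fiber

open ProbabilityTheory unitInterval

variable {Y E : Type*} [MeasurableSpace Y] [MeasurableSpace E] [StandardBorelSpace E]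

/-- The distribution function of a Markov kernel along a Borel embedding of the target
into `ℝ`, as a map into the unit interval. -/
def fiberCdf (K : Kernel Y E) [IsMarkovKernel K] (q : Y × E) : I :=
  ⟨(K q.1).real {v | embeddingReal E v ≤ embeddingReal E q.2},
    measureReal_nonneg, measureReal_le_one⟩

theorem measurable_fiberCdf (K : Kernel Y E) [IsMarkovKernel K] : Measurable (fiberCdf K) := by
  refine Measurable.subtype_mk ?_
  have hemb := (measurableEmbedding_embeddingReal E).measurable
  have ht : MeasurableSet {p : (Y × E) × E | embeddingReal E p.2 ≤ embeddingReal E p.1.2} :=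
    measurableSet_le (hemb.comp measurable_snd) (hemb.comp measurable_fst.snd)
  have := Kernel.measurable_kernel_prodMk_left (κ := Kernel.prodMkRight E K) ht
  exact this.ennreal_toReal

theorem map_fiberCdf (K : Kernel Y E) [IsMarkovKernel K] (c : Y) (hc : ∀ u, K c {u} = 0) :
    (K c).map (fun u => fiberCdf K (c, u)) = volume := by
  have hemb := measurableEmbedding_embeddingReal E
  have hm : Measurable fun u => fiberCdf K (c, u) :=
    (measurable_fiberCdf K).comp measurable_prodMk_left
  have := Measure.isProbabilityMeasure_map (μ := K c) hm.aemeasurable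
  refine Measure.ext_of_Iic _ _ fun s => ?_
  rw [Measure.map_apply hm measurableSet_Iic, unitInterval.volume_Iic]
  set ν := (K c).map (embeddingReal E) with hν
  have : IsProbabilityMeasure ν := Measure.isProbabilityMeasure_map hemb.measurable.aemeasurable
  have hat : ∀ t, ν {t} = 0 := by
    intro t
    rw [hν, hemb.map_apply]
    by_cases ht : t ∈ range (embeddingReal E)
    · obtain ⟨u, rfl⟩ := ht
      rw [← image_singleton, hemb.injective.preimage_image]; exact hc u
    · rw [preimage_singleton_eq_empty.2 ht]; simp
  rw [← measure_setOf_measureReal_Iic_le ν hat s, hν, hemb.map_apply]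
  congr 1
  ext u
  simp only [mem_preimage, mem_Iic, mem_ofPred_eq]
  rw [measureReal_def (μ := Measure.map _ _), hemb.map_apply]
  rfl

/-- Rescaling of the initial segment `[0,k]` to the whole unit interval. -/
theorem exists_rescale (k : I) (hk : 0 < k) : ∃ φ : I → I, Measurable φ ∧
    (volume.restrict (Iic k)).map φ = ENNReal.ofReal k • volume := by
  have hkpos : (0 : ℝ) < k := hk
  refine ⟨fun t => projIcc 0 1 zero_le_one ((t : ℝ) / k),
    (continuous_projIcc.comp (continuous_subtype_val.div_const _)).measurable, ?_⟩
  have hm : Measurable fun t : I => projIcc (0 : ℝ) 1 zero_le_one ((t : ℝ) / k) :=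
    (continuous_projIcc.comp (continuous_subtype_val.div_const _)).measurable
  have : IsFiniteMeasure ((volume.restrict (Iic k)).map
    fun t : I => projIcc (0 : ℝ) 1 zero_le_one ((t : ℝ) / k)) := inferInstance
  refine Measure.ext_of_Iic _ _ fun s => ?_
  rw [Measure.map_apply hm measurableSet_Iic, Measure.restrict_apply (hm measurableSet_Iic)]
  have : (fun t : I => projIcc (0 : ℝ) 1 zero_le_one ((t : ℝ) / k)) ⁻¹' Iic s ∩ Iic k
      = Iic (k * s) := by
    ext t
    simp only [mem_inter_iff, mem_preimage, mem_Iic]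
    rw [← Subtype.coe_le_coe, ← Subtype.coe_le_coe, ← Subtype.coe_le_coe, coe_projIcc]
    have h0 : 0 ≤ (t : ℝ) / k := div_nonneg t.2.1 hkpos.le
    constructor
    · rintro ⟨h1, h2⟩
      have h3 : (t : ℝ) / k ≤ 1 := (div_le_one hkpos).2 h2
      rw [min_eq_right h3, max_eq_right h0, div_le_iff₀ hkpos] at h1
      rw [Set.Icc.coe_mul]; linarith
    · intro h
      rw [Set.Icc.coe_mul] at h
      have h2 : (t : ℝ) ≤ k := h.trans (mul_le_of_le_one_right hkpos.le s.2.2)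
      have h3 : (t : ℝ) / k ≤ 1 := (div_le_one hkpos).2 h2
      refine ⟨?_, h2⟩
      rw [min_eq_right h3, max_eq_right h0, div_le_iff₀ hkpos]
      linarith
  rw [this, unitInterval.volume_Iic]
  simp only [Measure.smul_apply, unitInterval.volume_Iic, smul_eq_mul, Set.Icc.coe_mul]
  exact ENNReal.ofReal_mul hkpos.le

/-- If the fibres of `ρ₁` are atomless and the base measures are not mutually singular,
then a part of `ρ₁` can be moved below `ρ₂` within the fibres. -/
theorem exists_fiber_transport [Nonempty E] (ρ₁ ρ₂ : Measure (Y × E)) [IsFiniteMeasure ρ₁]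
    [IsFiniteMeasure ρ₂] (hsing : ¬ ρ₂.fst ⟂ₘ ρ₁.fst)
    (hat : ∀ᵐ c ∂ρ₁.fst, ∀ u, ρ₁.condKernel c {u} = 0) :
    ∃ A : Set (Y × E), MeasurableSet A ∧ ρ₁ A ≠ 0 ∧ ∃ g : Y × E → E, Measurable g ∧
      (ρ₁.restrict A).map (fun q => (q.1, g q)) ≤ ρ₂ := by
  obtain ⟨e, he, Y₀, hY₀, hpos, hle⟩ 
      := Measure.exists_positive_of_not_mutuallySingular _ _ hsing
  set K₁ := ρ₁.condKernel
  set K₂ := ρ₂.condKernel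
  have hρ₁ : ρ₁.fst ⊗ₘ K₁ = ρ₁ := ρ₁.disintegrate K₁
  have hρ₂ : ρ₂.fst ⊗ₘ K₂ = ρ₂ := ρ₂.disintegrate K₂
  let k : I := ⟨min e 1, le_min e.2 zero_le_one, min_le_right _ _⟩
  have hk : 0 < k := by
    rw [← Subtype.coe_lt_coe]; exact lt_min he one_pos
  have hke : ENNReal.ofReal k ≤ e := by
    rw [← ENNReal.ofReal_coe_nnreal]; exact ENNReal.ofReal_le_ofReal (min_le_left _ _)
  have hdom : ENNReal.ofReal k • ρ₁.fst.restrict Y₀ ≤ ρ₂.fst := by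
    refine Measure.le_iff.2 fun B hB => ?_
    rw [Measure.smul_apply, Measure.restrict_apply hB, smul_eq_mul]
    calc _ ≤ e * ρ₁.fst (B ∩ Y₀) := by gcongr
      _ ≤ ρ₂.fst (B ∩ Y₀) := hle B hB
      _ ≤ _ := measure_mono inter_subset_left
  obtain ⟨φ, hφ, hφk⟩ := exists_rescale k hk
  obtain ⟨G, hG, hGK⟩ := Kernel.exists_measurable_map_eq_unitInterval K₂
  have hF := measurable_fiberCdf K₁
  let A : Set (Y × E) := {q | q.1 ∈ Y₀ ∧ fiberCdf K₁ q ≤ k}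
  let g : Y × E → E := fun q => G q.1 (φ (fiberCdf K₁ q))
  have hA : MeasurableSet A :=
    (measurable_fst hY₀).inter (hF measurableSet_Iic)
  have hg : Measurable g := hG.comp (measurable_fst.prodMk (hφ.comp hF))
  have key : ∀ B : Set (Y × E), MeasurableSet B →
      (ρ₁.restrict A).map (fun q => (q.1, g q)) B
        = ∫⁻ c, K₂ c (Prod.mk c ⁻¹' B) ∂(ENNReal.ofReal k • ρ₁.fst.restrict Y₀) := by
    intro B hB
    have hgB : MeasurableSet ((fun q : Y × E => (q.1, g q)) ⁻¹' B) :=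
      (measurable_fst.prodMk hg) hB
    rw [Measure.map_apply (measurable_fst.prodMk hg) hB, Measure.restrict_apply hgB]
    nth_rewrite 1 [← hρ₁]
    rw [Measure.compProd_apply (hgB.inter hA), lintegral_smul_measure, smul_eq_mul,
      ← lintegral_const_mul' _ _ ENNReal.ofReal_ne_top, ← lintegral_indicator hY₀]
    refine lintegral_congr_ae ?_
    filter_upwards [hat] with c hc
    by_cases hcY : c ∈ Y₀
    · rw [indicator_of_mem hcY]
      have hGc : Measurable (G c) := hG.comp measurable_prodMk_left
      have hBc : MeasurableSet (Prod.mk c ⁻¹' B) := measurable_prodMk_left hB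
      have hFc : Measurable fun u => fiberCdf K₁ (c, u) := hF.comp measurable_prodMk_left
      have hW : MeasurableSet (φ ⁻¹' (G c ⁻¹' (Prod.mk c ⁻¹' B)) ∩ Iic k) :=
        (hφ (hGc hBc)).inter measurableSet_Iic
      have e1 : Prod.mk c ⁻¹' ((fun q : Y × E => (q.1, g q)) ⁻¹' B ∩ A)
          = (fun u => fiberCdf K₁ (c, u)) ⁻¹' (φ ⁻¹' (G c ⁻¹' (Prod.mk c ⁻¹' B)) ∩ Iic k) := by
        ext u
        simp [A, g, hcY]
      rw [e1, ← Measure.map_apply hFc hW, map_fiberCdf K₁ c hc,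
        ← Measure.restrict_apply (hφ (hGc hBc)), ← Measure.map_apply hφ (hGc hBc), hφk,
        ← hGK c, Measure.map_apply hGc hBc]
      rfl
    · rw [indicator_of_notMem hcY]
      have e1 : Prod.mk c ⁻¹' ((fun q : Y × E => (q.1, g q)) ⁻¹' B ∩ A) = ∅ := by
        ext u
        simp [A, hcY]
      rw [e1, measure_empty]
  refine ⟨A, hA, ?_, g, hg, ?_⟩
  · have h1 := key univ .univ
    rw [Measure.map_apply (measurable_fst.prodMk hg) .univ] at h1
    simp only [preimage_univ, Measure.restrict_apply_univ, measure_univ, lintegral_one] at h1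
    rw [h1]
    simp only [Measure.smul_apply, Measure.restrict_apply_univ, smul_eq_mul]
    have : ENNReal.ofReal k ≠ 0 := by
      rw [Ne, ENNReal.ofReal_eq_zero, not_le]; exact hk
    exact mul_ne_zero this hpos.ne'
  · refine Measure.le_iff.2 fun B hB => ?_
    rw [key B hB]
    conv_rhs => rw [← hρ₂]
    rw [Measure.compProd_apply hB]
    exact lintegral_mono' hdom le_rfl

end Fiber

section Palm

open ProbabilityTheory
open scoped ENNReal

variable {d : ℕ} {X : Type*} [MeasurableSpace X]

/-- A measurable flow of `ℝ^d` preserving the measure `μ`. -/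
structure IsStationaryFlow (θ : Eucl d → X → X) (μ : Measure X) : Prop where
  measurable : Measurable fun p : Eucl d × X => θ p.1 p.2
  zero : ∀ ω, θ 0 ω = ω
  add : ∀ x y ω, θ y (θ x ω) = θ (x + y) ω
  preserving : ∀ x, MeasurePreserving (θ x) μ μ

/-- Equivariance of a random measure under a flow. -/
def IsEquivariant (θ : Eucl d → X → X) (ξ : Kernel X (Eucl d)) : Prop :=
  ∀ ω x, ξ (θ x ω) = (ξ ω).map fun y => y - x

/-- The Palm measure of a random measure. -/
def palm (θ : Eucl d → X → X) (μ : Measure X) (ξ : Kernel X (Eucl d)) : Measure X :=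
  ((μ ⊗ₘ ξ).restrict (univ ×ˢ unitCube d)).map fun p => θ p.2 p.1

theorem measurableSet_unitCube : MeasurableSet (unitCube d) := by
  have : unitCube d = ⋂ i, {x | x i ∈ Ico (0 : ℝ) 1} := by ext; simp [unitCube]
  rw [this]
  exact MeasurableSet.iInter fun i =>
    measurableSet_Ico.preimage (by fun_prop : Measurable fun x : Eucl d => x i)

theorem volume_unitCube : volume (unitCube d) = 1 := by
  have h : unitCube d = (@WithLp.ofLp 2 (Fin d → ℝ)) ⁻¹' (univ.pi fun _ => Ico (0 : ℝ) 1) := by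
    ext x; simp only [unitCube, mem_preimage, mem_univ_pi]; rfl
  rw [h, (PiLp.volume_preserving_ofLp (Fin d)).measure_preimage
    (MeasurableSet.univ_pi fun _ => measurableSet_Ico).nullMeasurableSet, Real.volume_pi_Ico]
  simp

variable {θ : Eucl d → X → X} {μ : Measure X} {ξ : Kernel X (Eucl d)}

theorem IsStationaryFlow.measurable_swap (hθ : IsStationaryFlow θ μ) :
    Measurable fun p : X × Eucl d => θ p.2 p.1 :=
  hθ.measurable.comp _root_.measurable_swap

theorem IsStationaryFlow.measurable_right (hθ : IsStationaryFlow θ μ) (x : Eucl d) :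
    Measurable (θ x) := (hθ.preserving x).measurable

theorem IsStationaryFlow.measurable_left (hθ : IsStationaryFlow θ μ) (ω : X) :
    Measurable fun x => θ x ω := hθ.measurable.comp measurable_prodMk_right

theorem IsStationaryFlow.neg_apply (hθ : IsStationaryFlow θ μ) (x : Eucl d) (ω : X) :
    θ (-x) (θ x ω) = ω := by rw [hθ.add, add_neg_cancel, hθ.zero]

theorem lintegral_palm (hθ : IsStationaryFlow θ μ) {f : X → ℝ≥0∞} (hf : Measurable f) :
    ∫⁻ x, f x ∂(palm θ μ ξ) = ∫⁻ p, (unitCube d).indicator 1 p.2 * f (θ p.2 p.1) ∂(μ ⊗ₘ ξ) := by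
  have hm := hθ.measurable_swap
  have hU : MeasurableSet ((univ : Set X) ×ˢ unitCube d) := .prod .univ measurableSet_unitCube
  rw [palm, lintegral_map hf hm, ← lintegral_indicator hU]
  refine lintegral_congr fun p => ?_
  by_cases hp : p.2 ∈ unitCube d
  · rw [indicator_of_mem (by simpa using hp), indicator_of_mem hp]; simp
  · rw [indicator_of_notMem (by simpa using hp), indicator_of_notMem hp]; simp

variable [SFinite μ] [IsSFiniteKernel ξ]

theorem lintegral_shift (hθ : IsStationaryFlow θ μ) (hξ : IsEquivariant θ ξ)
    {f : X × Eucl d → ℝ≥0∞} (hf : Measurable f) (s : Eucl d) :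
    ∫⁻ p, f (θ p.2 p.1, p.2 - s) ∂(μ ⊗ₘ ξ) = ∫⁻ p, f (θ p.2 p.1, p.2) ∂(μ ⊗ₘ ξ) := by
  have hm := hθ.measurable_swap
  have h0 : Measurable fun p : X × Eucl d => f (θ p.2 p.1, p.2) :=
    hf.comp (hm.prodMk measurable_snd)
  have h1 : Measurable fun p : X × Eucl d => f (θ p.2 p.1, p.2 - s) :=
    hf.comp (hm.prodMk (measurable_snd.sub_const s))
  rw [Measure.lintegral_compProd h1, Measure.lintegral_compProd h0,
    ← (hθ.preserving s).lintegral_comp (f := fun a => ∫⁻ b, f (θ b a, b) ∂ξ a)]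
  · refine lintegral_congr fun ω => ?_
    have h2 : Measurable fun x => f (θ x (θ s ω), x) := h0.comp measurable_prodMk_left
    rw [hξ ω s, lintegral_map h2 (by fun_prop)]
    refine lintegral_congr fun y => ?_
    rw [hθ.add, add_sub_cancel]
  · exact h0.lintegral_kernel_prod_right'

instance : SFinite (palm θ μ ξ) := by unfold palm; infer_instance

/-- The refined Campbell formula. -/
theorem lintegral_campbell (hθ : IsStationaryFlow θ μ) (hξ : IsEquivariant θ ξ)
    {f : X × Eucl d → ℝ≥0∞} (hf : Measurable f) :
    ∫⁻ p, f (θ p.2 p.1, p.2) ∂(μ ⊗ₘ ξ) = ∫⁻ x, ∫⁻ ω, f (ω, x) ∂(palm θ μ ξ) := by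
  have hm := hθ.measurable_swap
  have hw : Measurable ((unitCube d).indicator (1 : Eucl d → ℝ≥0∞)) :=
    measurable_one.indicator measurableSet_unitCube
  set w := (unitCube d).indicator (1 : Eucl d → ℝ≥0∞)
  have hf1 : Measurable fun p : (X × Eucl d) × Eucl d =>
      w (p.1.2 + p.2) * f (θ p.1.2 p.1.1, p.1.2) :=
    (hw.comp (by fun_prop)).mul
      (hf.comp ((hm.comp measurable_fst).prodMk measurable_fst.snd))
  have hf2 : Measurable fun p : (X × Eucl d) × Eucl d =>
      w p.1.2 * f (θ p.1.2 p.1.1, p.1.2 - p.2) :=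
    (hw.comp (by fun_prop)).mul
      (hf.comp ((hm.comp measurable_fst).prodMk (measurable_fst.snd.sub measurable_snd)))
  have hf3 : Measurable fun p : (X × Eucl d) × Eucl d =>
      w p.1.2 * f (θ p.1.2 p.1.1, p.2) :=
    (hw.comp (by fun_prop)).mul
      (hf.comp ((hm.comp measurable_fst).prodMk measurable_snd))
  have hw1 : ∀ x, ∫⁻ s, w (x + s) = 1 := fun x => by
    rw [lintegral_add_left_eq_self w x, lintegral_indicator measurableSet_unitCube]
    simp [volume_unitCube]
  calc ∫⁻ p : X × Eucl d, f (θ p.2 p.1, p.2) ∂(μ ⊗ₘ ξ)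
      = ∫⁻ p : X × Eucl d, (∫⁻ s : Eucl d, w (p.2 + s) * f (θ p.2 p.1, p.2)) ∂(μ ⊗ₘ ξ) := by
        refine lintegral_congr fun p => ?_
        rw [lintegral_mul_const _ (by fun_prop), hw1, one_mul]
    _ = ∫⁻ s : Eucl d, ∫⁻ p : X × Eucl d, w (p.2 + s) * f (θ p.2 p.1, p.2) ∂(μ ⊗ₘ ξ) :=
        lintegral_lintegral_swap hf1.aemeasurable
    _ = ∫⁻ s : Eucl d, ∫⁻ p : X × Eucl d, w p.2 * f (θ p.2 p.1, p.2 - s) ∂(μ ⊗ₘ ξ) := by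
        refine lintegral_congr fun s => ?_
        rw [← lintegral_shift hθ hξ (f := fun p => w (p.2 + s) * f p) (by fun_prop) s]
        simp
    _ = ∫⁻ p : X × Eucl d, (∫⁻ s : Eucl d, w p.2 * f (θ p.2 p.1, p.2 - s)) ∂(μ ⊗ₘ ξ) :=
        (lintegral_lintegral_swap hf2.aemeasurable).symm
    _ = ∫⁻ p : X × Eucl d, (∫⁻ x : Eucl d, w p.2 * f (θ p.2 p.1, x)) ∂(μ ⊗ₘ ξ) := by
        refine lintegral_congr fun p => ?_
        exact lintegral_sub_left_eq_self (fun x => w p.2 * f (θ p.2 p.1, x)) p.2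
    _ = ∫⁻ x : Eucl d, ∫⁻ p : X × Eucl d, w p.2 * f (θ p.2 p.1, x) ∂(μ ⊗ₘ ξ) :=
        lintegral_lintegral_swap hf3.aemeasurable
    _ = _ := by
        refine lintegral_congr fun x => ?_
        rw [lintegral_palm hθ (by fun_prop)]

theorem palm_univ (hθ : IsStationaryFlow θ μ) :
    palm θ μ ξ univ = ∫⁻ ω, ξ ω (unitCube d) ∂μ := by
  rw [palm, Measure.map_apply hθ.measurable_swap .univ, preimage_univ,
    Measure.restrict_apply_univ,
    Measure.compProd_apply (.prod .univ measurableSet_unitCube)]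
  simp

/-- A set is Palm-null iff almost surely the points moved into it are not charged. -/
theorem palm_eq_zero_iff (hθ : IsStationaryFlow θ μ) (hξ : IsEquivariant θ ξ) {C : Set X}
    (hC : MeasurableSet C) :
    palm θ μ ξ C = 0 ↔ ∀ᵐ ω ∂μ, ξ ω {x | θ x ω ∈ C} = 0 := by
  have hm := hθ.measurable_swap
  have hS : MeasurableSet {p : X × Eucl d | θ p.2 p.1 ∈ C} := hm hC
  have h1 : (μ ⊗ₘ ξ) {p : X × Eucl d | θ p.2 p.1 ∈ C} = volume (univ : Set (Eucl d))
      * palm θ μ ξ C := by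
    have := lintegral_campbell hθ hξ (f := fun p => C.indicator 1 p.1)
      ((measurable_one.indicator hC).comp measurable_fst)
    simp only [lintegral_indicator_one hC, lintegral_const] at this
    rw [mul_comm, ← this, ← lintegral_indicator_one hS]
    rfl
  have h2 : (μ ⊗ₘ ξ) {p : X × Eucl d | θ p.2 p.1 ∈ C} = 0 ↔
      ∀ᵐ ω ∂μ, ξ ω {x | θ x ω ∈ C} = 0 := by
    rw [Measure.compProd_apply hS, lintegral_eq_zero_iff (ξ.measurable_kernel_prodMk_left hS)]
    rfl
  have h3 : volume (univ : Set (Eucl d)) ≠ 0 := NeZero.ne _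
  rw [← h2, h1, mul_eq_zero, or_iff_right h3]

end Palm

section Allocation

open ProbabilityTheory
open scoped ENNReal

variable {d : ℕ} {X : Type*} [MeasurableSpace X] {θ : Eucl d → X → X} {μ : Measure X}
  {ξ η : Kernel X (Eucl d)}

/-- Kernels agreeing under the integral with respect to `μ` agree almost everywhere. -/
theorem ae_eq_of_lintegral_eq [SigmaFinite μ] {ζ : X → Measure (Eucl d)}
    (hζ : ∀ B, MeasurableSet B → Measurable fun ω => ζ ω B)
    (hη : ∀ᵐ ω ∂μ, ∀ n : ℕ, η ω (Metric.closedBall 0 n) ≠ ∞)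
    (h : ∀ F B, MeasurableSet F → MeasurableSet B →
      ∫⁻ ω in F, ζ ω B ∂μ = ∫⁻ ω in F, η ω B ∂μ) : ∀ᵐ ω ∂μ, ζ ω = η ω := by
  have hB : ∀ B, MeasurableSet B → ∀ᵐ ω ∂μ, ζ ω B = η ω B := fun B hB =>
    ae_eq_of_forall_setLIntegral_eq_of_sigmaFinite (hζ B hB) (η.measurable_coe hB)
      fun F hF _ => h F B hF hB
  set S := generateSetAlgebra (MeasurableSpace.countableGeneratingSet (Eucl d)) with hS
  have hScount : S.Countable :=
    countable_generateSetAlgebra MeasurableSpace.countable_countableGeneratingSet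
  have hgen : (inferInstance : MeasurableSpace (Eucl d)) = MeasurableSpace.generateFrom S := by
    rw [hS, generateFrom_generateSetAlgebra_eq, MeasurableSpace.generateFrom_countableGeneratingSet]
  have hSm : ∀ s ∈ S, MeasurableSet s := fun s hs => by
    change MeasurableSet[(inferInstance : MeasurableSpace (Eucl d))] s
    rw [hgen]; exact MeasurableSpace.measurableSet_generateFrom hs
  have hball : ∀ n : ℕ, MeasurableSet (Metric.closedBall (0 : Eucl d) n) :=
    fun n => measurableSet_closedBall
  have h1 : ∀ᵐ ω ∂μ, ∀ n : ℕ, ζ ω (Metric.closedBall 0 n) = η ω (Metric.closedBall 0 n) :=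
    ae_all_iff.2 fun n => hB _ (hball n)
  have h2 : ∀ᵐ ω ∂μ, ∀ s ∈ S, ∀ n : ℕ,
      ζ ω (s ∩ Metric.closedBall 0 n) = η ω (s ∩ Metric.closedBall 0 n) :=
    (ae_ball_iff hScount).2 fun s hs => ae_all_iff.2 fun n => hB _ ((hSm s hs).inter (hball n))
  filter_upwards [hη, h1, h2] with ω a1 a2 a3
  refine Measure.ext_of_generateFrom_of_cover hgen
    (T := range fun n : ℕ => Metric.closedBall (0 : Eucl d) n) (countable_range _)
    (fun s hs t ht _ => isSetAlgebra_generateSetAlgebra.inter_mem hs ht) ?_ ?_ ?_ ?_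
  · rw [sUnion_range, Metric.iUnion_closedBall_nat]
  · rintro _ ⟨n, rfl⟩; exact (a2 n).trans_ne (a1 n)
  · rintro _ ⟨n, rfl⟩ s hs; exact a3 s hs n
  · rintro _ ⟨n, rfl⟩; exact a2 n

/-- A shift coupling of the Palm measures induces a balancing allocation. -/
theorem map_eq_of_palm_map_eq [SigmaFinite μ] [IsSFiniteKernel ξ] [IsSFiniteKernel η]
    (hθ : IsStationaryFlow θ μ) (hξ : IsEquivariant θ ξ) (hη : IsEquivariant θ η)
    (hloc : ∀ᵐ ω ∂μ, ∀ n : ℕ, η ω (Metric.closedBall 0 n) ≠ ∞)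
    {τ : X → Eucl d} (hτ : Measurable τ)
    (h : (palm θ μ ξ).map (fun x => θ (τ x) x) = palm θ μ η) :
    ∀ᵐ ω ∂μ, (ξ ω).map (fun x => x + τ (θ x ω)) = η ω := by
  have hm := hθ.measurable_swap
  have hτm : Measurable fun x => θ (τ x) x := hθ.measurable.comp (hτ.prodMk measurable_id)
  have hT : Measurable fun p : X × Eucl d => p.2 + τ (θ p.2 p.1) :=
    measurable_snd.add (hτ.comp hm)
  have hTω : ∀ ω, Measurable fun x => x + τ (θ x ω) := fun ω => hT.comp measurable_prodMk_left
  have key : ∀ f : X × Eucl d → ℝ≥0∞, Measurable f →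
      ∫⁻ p, f (p.1, p.2 + τ (θ p.2 p.1)) ∂(μ ⊗ₘ ξ) = ∫⁻ p, f p ∂(μ ⊗ₘ η) := by
    intro f hf
    have hg : Measurable fun p : X × Eucl d => f (θ (-p.2) p.1, p.2) :=
      hf.comp ((hθ.measurable.comp (measurable_snd.neg.prodMk measurable_fst)).prodMk
        measurable_snd)
    set g : X × Eucl d → ℝ≥0∞ := fun p => f (θ (-p.2) p.1, p.2) with hgdef
    have hF : Measurable fun p : X × Eucl d => g (θ (τ p.1) p.1, p.2 + τ p.1) :=
      hg.comp ((hτm.comp measurable_fst).prodMk (measurable_snd.add (hτ.comp measurable_fst)))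
    calc ∫⁻ p, f (p.1, p.2 + τ (θ p.2 p.1)) ∂(μ ⊗ₘ ξ)
        = ∫⁻ p, g (θ (τ (θ p.2 p.1)) (θ p.2 p.1), p.2 + τ (θ p.2 p.1)) ∂(μ ⊗ₘ ξ) := by
          refine lintegral_congr fun p => ?_
          simp only [hgdef]
          rw [hθ.add p.2, hθ.neg_apply]
      _ = ∫⁻ x, ∫⁻ ω, g (θ (τ ω) ω, x + τ ω) ∂(palm θ μ ξ) :=
          lintegral_campbell hθ hξ (f := fun p => g (θ (τ p.1) p.1, p.2 + τ p.1)) hF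
      _ = ∫⁻ ω, (∫⁻ x : Eucl d, g (θ (τ ω) ω, x + τ ω)) ∂(palm θ μ ξ) :=
          lintegral_lintegral_swap (f := fun x ω => g (θ (τ ω) ω, x + τ ω))
            (hF.comp measurable_swap).aemeasurable
      _ = ∫⁻ ω, (∫⁻ x : Eucl d, g (θ (τ ω) ω, x)) ∂(palm θ μ ξ) := by
          refine lintegral_congr fun ω => ?_
          exact lintegral_add_right_eq_self (fun x => g (θ (τ ω) ω, x)) (τ ω)
      _ = ∫⁻ ω, (∫⁻ x : Eucl d, g (ω, x)) ∂(palm θ μ η) := by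
          rw [← h, lintegral_map hg.lintegral_prod_right' hτm]
      _ = ∫⁻ x, ∫⁻ ω, g (ω, x) ∂(palm θ μ η) :=
          lintegral_lintegral_swap (f := fun ω x => g (ω, x)) hg.aemeasurable
      _ = ∫⁻ p, g (θ p.2 p.1, p.2) ∂(μ ⊗ₘ η) := (lintegral_campbell hθ hη hg).symm
      _ = _ := by
          refine lintegral_congr fun p => ?_
          simp only [hgdef]
          rw [hθ.neg_apply]
  refine ae_eq_of_lintegral_eq (fun B hB => ?_) hloc fun F B hF hB => ?_
  · have : (fun ω => (ξ ω).map (fun x => x + τ (θ x ω)) B)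
        = fun ω => ξ ω (Prod.mk ω ⁻¹' ((fun p : X × Eucl d => p.2 + τ (θ p.2 p.1)) ⁻¹' B)) := by
      ext ω; rw [Measure.map_apply (hTω ω) hB]; rfl
    rw [this]
    exact ξ.measurable_kernel_prodMk_left (hT hB)
  · have h1 := key ((F ×ˢ B).indicator 1) (measurable_one.indicator (hF.prod hB))
    have hS : MeasurableSet {p : X × Eucl d | (p.1, p.2 + τ (θ p.2 p.1)) ∈ F ×ˢ B} :=
      (measurable_fst.prodMk hT) (hF.prod hB)
    have h2 : ∫⁻ p, (F ×ˢ B).indicator (1 : X × Eucl d → ℝ≥0∞) (p.1, p.2 + τ (θ p.2 p.1))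
        ∂(μ ⊗ₘ ξ) = (μ ⊗ₘ ξ) {p : X × Eucl d | (p.1, p.2 + τ (θ p.2 p.1)) ∈ F ×ˢ B} := by
      rw [← lintegral_indicator_one hS]; rfl
    rw [h2, lintegral_indicator_one (hF.prod hB), Measure.compProd_apply hS,
      Measure.compProd_apply (hF.prod hB)] at h1
    rw [← lintegral_indicator hF, ← lintegral_indicator hF]
    convert h1 using 2 with ω ω
    · ext ω
      by_cases hω : ω ∈ F
      · rw [indicator_of_mem hω, Measure.map_apply (hTω ω) hB]
        congr 1; ext x; simp [hω]
      · rw [indicator_of_notMem hω, eq_comm]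
        convert! measure_empty (μ := ξ ω)
        ext x; simp [hω]
    · ext ω
      by_cases hω : ω ∈ F
      · rw [indicator_of_mem hω]
        congr 1; ext x; simp [hω]
      · rw [indicator_of_notMem hω, eq_comm]
        convert! measure_empty (μ := η ω)
        ext x; simp [hω]

/-- If the flow acts trivially, the Palm measures are determined by the intensities. -/
theorem palm_apply_of_trivial [SFinite μ] [IsSFiniteKernel ξ] (hθ : IsStationaryFlow θ μ)
    (hfix : ∀ᵐ ω ∂μ, ∀ z, θ z ω = ω) {C : Set X}
    (hC : MeasurableSet C) : palm θ μ ξ C = ∫⁻ ω in C, ξ ω (unitCube d) ∂μ := by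
  rw [palm, Measure.map_apply hθ.measurable_swap hC,
    Measure.restrict_apply (hθ.measurable_swap hC), Measure.compProd_apply
    ((hθ.measurable_swap hC).inter (.prod .univ measurableSet_unitCube)),
    ← lintegral_indicator hC]
  refine lintegral_congr_ae ?_
  filter_upwards [hfix] with ω hω
  by_cases hωC : ω ∈ C
  · rw [indicator_of_mem hωC]; congr 1; ext x; simp [hω, hωC]
  · rw [indicator_of_notMem hωC]
    convert! measure_empty (μ := ξ ω)
    ext x; simp [hω, hωC]

end Allocation

section Stabilizer

open scoped ENNReal

variable {d : ℕ} {X : Type*} [MeasurableSpace X] {θ : Eucl d → X → X} {μ : Measure X}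

/-- The periods of a point under a flow are closed under integer multiples. -/
theorem apply_zsmul_eq (hθ : IsStationaryFlow θ μ) {z : Eucl d} {ω : X} (hz : θ z ω = ω)
    (k : ℤ) : θ (k • z) ω = ω := by
  let S : AddSubgroup (Eucl d) :=
    { carrier := {z | θ z ω = ω}
      zero_mem' := hθ.zero ω
      add_mem' := fun {a b} ha hb => by
        change θ (a + b) ω = ω
        rw [← hθ.add, ha, hb]
      neg_mem' := fun {a} ha => by
        change θ (-a) ω = ω
        conv_lhs => rw [← show θ a ω = ω from ha]
        exact hθ.neg_apply a ω }
  exact S.zsmul_mem (show z ∈ S from hz) k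

/-- Small periods whose directions accumulate at `v` generate all periods in direction `v`. -/
theorem apply_smul_eq_of_periods [TopologicalSpace X] [T2Space X]
    (hθ : IsStationaryFlow θ μ)
    (hcont : ∀ ω, Continuous fun z => θ z ω) {ω : X} {v : Eucl d} {z : ℕ → Eucl d}
    (hz : ∀ m, θ (z m) ω = ω) (hz0 : ∀ m, z m ≠ 0) (hzlim : Tendsto z atTop (nhds 0))
    (hzv : ∀ m : ℕ, ‖z m - ‖z m‖ • v‖ ≤ ‖z m‖ / (m + 1)) (t : ℝ) : θ (t • v) ω = ω := by
  set k : ℕ → ℤ := fun m => ⌊t / ‖z m‖⌋ with hk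
  have hpos : ∀ m, 0 < ‖z m‖ := fun m => norm_pos_iff.2 (hz0 m)
  have hn : Tendsto (fun m => ‖z m‖) atTop (nhds 0) := by simpa using hzlim.norm
  have h1 : ∀ m, |k m * ‖z m‖ - t| ≤ ‖z m‖ := by
    intro m
    have a1 := Int.floor_le (t / ‖z m‖)
    have a2 := Int.lt_floor_add_one (t / ‖z m‖)
    rw [le_div_iff₀ (hpos m)] at a1
    rw [div_lt_iff₀ (hpos m)] at a2
    rw [abs_le]; constructor <;> simp only [hk] <;> nlinarith [hpos m]
  have h2 : Tendsto (fun m => (k m * ‖z m‖ : ℝ)) atTop (nhds t) := by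
    rw [tendsto_iff_dist_tendsto_zero]
    exact squeeze_zero (fun _ => dist_nonneg) (fun m => by rw [Real.dist_eq]; exact h1 m) hn
  have h3 : Tendsto (fun m : ℕ => |k m * ‖z m‖| * (1 / ((m : ℝ) + 1))) atTop (nhds 0) := by
    simpa using h2.abs.mul tendsto_one_div_add_atTop_nhds_zero_nat
  have h4 : Tendsto (fun m => (k m : ℝ) • (z m - ‖z m‖ • v)) atTop (nhds 0) := by
    refine squeeze_zero_norm (fun m => ?_) h3
    rw [norm_smul, abs_mul, abs_of_pos (hpos m), Real.norm_eq_abs, mul_assoc]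
    have := hzv m
    gcongr
    rwa [mul_one_div]
  have h5 : Tendsto (fun m => k m • z m) atTop (nhds (t • v)) := by
    have := h4.add (h2.smul_const v)
    rw [zero_add] at this
    refine this.congr fun m => ?_
    rw [smul_sub, smul_smul, sub_add_cancel, Int.cast_smul_eq_zsmul]
  have h6 : Tendsto (fun m => θ (k m • z m) ω) atTop (nhds (θ (t • v) ω)) :=
    ((hcont ω).tendsto _).comp h5
  simp only [apply_zsmul_eq hθ (hz _)] at h6
  exact (tendsto_nhds_unique h6 tendsto_const_nhds)

variable [MetricSpace X] [SecondCountableTopology X] [OpensMeasurableSpace X]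

theorem measurableSet_exists_dist_le (hθ : IsStationaryFlow θ μ)
    (hcont : ∀ ω, Continuous fun z => θ z ω) {C : Set (Eucl d)} (hC : IsCompact C) (r : ℝ) :
    MeasurableSet {ω | ∃ z ∈ C, dist (θ z ω) ω ≤ r} := by
  obtain ⟨D, hDC, hD, hCD⟩ :=
    (TopologicalSpace.IsSeparable.of_separableSpace C).exists_countable_dense_subset
  have : {ω | ∃ z ∈ C, dist (θ z ω) ω ≤ r}
      = ⋂ n : ℕ, ⋃ z ∈ D, {ω | dist (θ z ω) ω < r + 1 / (n + 1)} := by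
    ext ω
    have hc : Continuous fun z => dist (θ z ω) ω := (hcont ω).dist continuous_const
    simp only [mem_ofPred_eq, mem_iInter, mem_iUnion, exists_prop]
    constructor
    · rintro ⟨z, hz, hzr⟩ n
      have hn : (0 : ℝ) < 1 / (n + 1) := Nat.one_div_pos_of_nat
      have h1 : {z | dist (θ z ω) ω < r + 1 / (n + 1)} ∈ nhds z :=
        (isOpen_lt hc continuous_const).mem_nhds (by simp only [mem_ofPred_eq]; linarith)
      obtain ⟨y, hy, hyD⟩ := mem_closure_iff_nhds.1 (hCD hz) _ h1
      exact ⟨y, hyD, hy⟩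
    · intro h
      obtain ⟨y, hyD, -⟩ := h 0
      obtain ⟨z, hzC, hz⟩ := hC.exists_isMinOn ⟨y, hDC hyD⟩ hc.continuousOn
      refine ⟨z, hzC, le_of_forall_pos_le_add fun δ hδ => ?_⟩
      obtain ⟨n, hn⟩ := exists_nat_one_div_lt hδ
      obtain ⟨y, hyD, hy⟩ := h n
      have := isMinOn_iff.1 hz y (hDC hyD)
      linarith
  rw [this]
  refine MeasurableSet.iInter fun n => MeasurableSet.biUnion hD fun z _ => ?_
  exact measurableSet_lt ((hθ.measurable_right z).dist measurable_id) measurable_const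

/-- Almost surely the stabilizer contains a deterministic subspace `V` and avoids a
spherical shell in the orthogonal complement of `V`. -/
theorem exists_stabilizer_subspace [IsProbabilityMeasure μ] (hθ : IsStationaryFlow θ μ)
    (herg : ∀ A : Set X, MeasurableSet A → (∀ x, θ x ⁻¹' A = A) → μ A = 0 ∨ μ A = 1)
    (hcont : ∀ ω, Continuous fun z => θ z ω) :
    ∃ V : Submodule ℝ (Eucl d), (∀ᵐ ω ∂μ, ∀ v ∈ V, θ v ω = ω) ∧ ∃ ε : ℝ, 0 < ε ∧
      ∀ᵐ ω ∂μ, ∀ z ∈ Vᗮ, ε ≤ ‖z‖ → ‖z‖ ≤ 4 * ε → θ z ω ≠ ω := by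
  obtain ⟨V, hV, hmax⟩ := (wellFounded_gt (α := Submodule ℝ (Eucl d))).has_min
    {V | ∀ᵐ ω ∂μ, ∀ v ∈ V, θ v ω = ω} ⟨⊥, by simp [hθ.zero]⟩
  refine ⟨V, hV, ?_⟩
  set C : Eucl d → ℕ → ℕ → Set (Eucl d) := fun v n m =>
    {z | z ∈ Vᗮ ∧ (1 / ((n : ℝ) + 1) ≤ ‖z‖ ∧ ‖z‖ ≤ 4 * (1 / ((n : ℝ) + 1))) ∧
      ‖z - ‖z‖ • v‖ ≤ ‖z‖ / (m + 1)} with hCdef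
  have hC : ∀ v n m, IsCompact (C v n m) := by
    intro v n m
    refine Metric.isCompact_of_isClosed_isBounded ?_ ?_
    · refine (Vᗮ.closed_of_finiteDimensional).inter (IsClosed.inter (IsClosed.inter ?_ ?_) ?_)
      · exact isClosed_le continuous_const continuous_norm
      · exact isClosed_le continuous_norm continuous_const
      · exact isClosed_le (f := fun z : Eucl d => ‖z - ‖z‖ • v‖) (g := fun z => ‖z‖ / (m + 1))
          (by fun_prop) (by fun_prop)
    · exact Metric.isBounded_closedBall.subset fun z hz => mem_closedBall_zero_iff.2 hz.2.1.2
  have hS : ∀ v n m, MeasurableSet {ω | ∃ z ∈ C v n m, θ z ω = ω} := by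
    intro v n m
    convert measurableSet_exists_dist_le hθ hcont (hC v n m) 0 using 6
    rw [← dist_le_zero]
  have hinv : ∀ v n m, μ {ω | ∃ z ∈ C v n m, θ z ω = ω} ≠ 0 →
      ∀ᵐ ω ∂μ, ∃ z ∈ C v n m, θ z ω = ω := by
    intro v n m h0
    have h1 := (herg _ (hS v n m) fun x => ?_).resolve_left h0
    · rwa [prob_compl_eq_zero_iff (hS v n m) |>.symm] at h1
    · ext ω
      simp only [mem_preimage, mem_ofPred_eq]
      refine exists_congr fun z => and_congr_right fun _ => ?_
      rw [hθ.add, add_comm, ← hθ.add]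
      exact ⟨fun h => by rw [← hθ.neg_apply x (θ z ω), h, hθ.neg_apply], fun h => by rw [h]⟩
  have hloc : ∀ v ∈ Metric.sphere (0 : Eucl d) 1 ∩ Vᗮ, ∃ m N : ℕ, ∀ n ≥ N,
      μ {ω | ∃ z ∈ C v n m, θ z ω = ω} = 0 := by
    rintro v ⟨hv1, hvV⟩
    by_contra! hcon
    choose n hn hne using fun m => hcon m m
    have h1 : ∀ᵐ ω ∂μ, ∀ m, ∃ z ∈ C v (n m) m, θ z ω = ω :=
      ae_all_iff.2 fun m => hinv v (n m) m (hne m)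
    have h2 : ∀ᵐ ω ∂μ, ∀ t : ℝ, θ (t • v) ω = ω := by
      filter_upwards [h1] with ω hω t
      choose z hzC hz using hω
      refine apply_smul_eq_of_periods hθ hcont hz (fun m h0 => ?_) ?_ (fun m => (hzC m).2.2) t
      · have := (hzC m).2.1.1
        rw [h0, norm_zero] at this
        exact absurd this (not_le.2 Nat.one_div_pos_of_nat)
      · have h4 : Tendsto (fun m : ℕ => 4 * (1 / ((m : ℝ) + 1))) atTop (nhds 0) := by
          simpa using (tendsto_one_div_add_atTop_nhds_zero_nat (𝕜 := ℝ)).const_mul 4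
        refine squeeze_zero_norm (fun m => (hzC m).2.1.2.trans ?_) h4
        gcongr
        exact_mod_cast hn m
    refine hmax (V ⊔ Submodule.span ℝ {v}) ?_ ?_
    · filter_upwards [hV, h2] with ω a1 a2 w hw
      obtain ⟨a, ha, b, hb, rfl⟩ := Submodule.mem_sup.1 hw
      obtain ⟨t, rfl⟩ := Submodule.mem_span_singleton.1 hb
      rw [← hθ.add, a1 a ha, a2 t]
    · refine lt_of_le_of_ne le_sup_left fun heq => ?_
      have hvm : v ∈ V := by
        rw [heq]; exact Submodule.mem_sup_right (Submodule.mem_span_singleton_self v)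
      have : v = 0 := by
        have := Submodule.inner_right_of_mem_orthogonal hvm hvV
        exact inner_self_eq_zero.1 this
      rw [this] at hv1
      simp at hv1
  choose! m N hmN using hloc
  have hK : IsCompact (Metric.sphere (0 : Eucl d) 1 ∩ (Vᗮ : Set (Eucl d))) :=
    (isCompact_sphere _ _).inter_right Vᗮ.closed_of_finiteDimensional
  obtain ⟨t, htK, ht⟩ := hK.elim_nhds_subcover (fun v => Metric.ball v (1 / ((m v : ℝ) + 1)))
    fun v _ => Metric.ball_mem_nhds _ Nat.one_div_pos_of_nat
  set n := t.sup N
  refine ⟨1 / ((n : ℝ) + 1), Nat.one_div_pos_of_nat, ?_⟩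
  have hall : ∀ᵐ ω ∂μ, ∀ v ∈ t, ¬ ∃ z ∈ C v n (m v), θ z ω = ω := by
    rw [Filter.eventually_all_finset]
    intro v hv
    have := hmN v (htK v hv) n (Finset.le_sup hv)
    rw [measure_eq_zero_iff_ae_notMem] at this
    exact this
  filter_upwards [hall] with ω hω z hz h1 h2 hzω
  have hpos : 0 < ‖z‖ := lt_of_lt_of_le Nat.one_div_pos_of_nat h1
  have hzK : ‖z‖⁻¹ • z ∈ Metric.sphere (0 : Eucl d) 1 ∩ (Vᗮ : Set (Eucl d)) := by
    refine ⟨?_, Vᗮ.smul_mem _ hz⟩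
    rw [mem_sphere_zero_iff_norm, norm_smul, norm_inv, norm_norm, inv_mul_cancel₀ hpos.ne']
  obtain ⟨v, hv, hzv⟩ := mem_iUnion₂.1 (ht hzK)
  refine hω v hv ⟨z, ⟨hz, ⟨h1, h2⟩, ?_⟩, hzω⟩
  rw [Metric.mem_ball, dist_eq_norm] at hzv
  have : z - ‖z‖ • v = ‖z‖ • (‖z‖⁻¹ • z - v) := by
    rw [smul_sub, smul_smul, mul_inv_cancel₀ hpos.ne', one_smul]
  rw [this, norm_smul, norm_norm, div_eq_mul_one_div]
  gcongr

end Stabilizer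

section Barycenter

variable {d : ℕ} {X : Type*} {θ : Eucl d → X → X} {L : Submodule ℝ (Eucl d)} {ε : ℝ} {O : Set X}

/-- The bounded visits of the orbit of `x` along `L` to the set `O`. -/
def visits (θ : Eucl d → X → X) (L : Submodule ℝ (Eucl d)) (ε : ℝ) (O : Set X) (x : X) : Set L :=
  {z | ‖z‖ ≤ 2 * ε ∧ θ z x ∈ O}

/-- The barycenter of the bounded visits to `O`. -/
def visitCenter (θ : Eucl d → X → X) (L : Submodule ℝ (Eucl d)) (ε : ℝ) (O : Set X) (x : X) : L :=
  ⨍ z in visits θ L ε O x, z ∂Measure.addHaar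

/-- The coordinates of a point with respect to a cross section of the orbits along `L`. -/
def visitCoord (θ : Eucl d → X → X) (L : Submodule ℝ (Eucl d)) (ε : ℝ) (O : Set X) (x : X) :
    X × L :=
  (θ (visitCenter θ L ε O x) x, visitCenter θ L ε O x)

variable [MeasurableSpace X] {μ : Measure X}

theorem measurableSet_visits (hθ : IsStationaryFlow θ μ) (hO : MeasurableSet O) :
    MeasurableSet {p : X × L | p.2 ∈ visits θ L ε O p.1} :=
  (measurableSet_le measurable_snd.norm measurable_const).inter
    ((hθ.measurable.comp (measurable_subtype_coe.comp measurable_snd |>.prodMk measurable_fst)) hO)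

theorem measurable_visitCenter (hθ : IsStationaryFlow θ μ) (hO : MeasurableSet O) :
    Measurable (visitCenter θ L ε O) := by
  have hS := measurableSet_visits (L := L) (ε := ε) hθ hO
  have h1 : Measurable fun x => (Measure.addHaar : Measure L) (visits θ L ε O x) :=
    measurable_measure_prodMk_left hS
  have h2 : StronglyMeasurable fun x => ∫ z, {p : X × L | p.2 ∈ visits θ L ε O p.1}.indicator
      (fun p => p.2) (x, z) ∂(Measure.addHaar : Measure L) :=
    (measurable_snd.indicator hS).stronglyMeasurable.integral_prod_right'
  have h3 : visitCenter θ L ε O = fun x =>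
      ((Measure.addHaar : Measure L) (visits θ L ε O x)).toReal⁻¹ •
        ∫ z, {p : X × L | p.2 ∈ visits θ L ε O p.1}.indicator
          (fun p => p.2) (x, z) ∂(Measure.addHaar : Measure L) := by
    ext1 x
    have hx : MeasurableSet (visits θ L ε O x) := measurable_prodMk_left hS
    rw [visitCenter, setAverage_eq, ← integral_indicator hx]
    rfl
  rw [h3]
  exact h1.ennreal_toReal.inv.smul h2.measurable

theorem measurable_visitCoord (hθ : IsStationaryFlow θ μ) (hO : MeasurableSet O) :
    Measurable (visitCoord θ L ε O) := by
  have := measurable_visitCenter (L := L) (ε := ε) hθ hO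
  exact (hθ.measurable.comp ((measurable_subtype_coe.comp this).prodMk measurable_id)).prodMk this

/-- The point can be recovered from its coordinates. -/
theorem apply_visitCoord (hθ : IsStationaryFlow θ μ) (b : Eucl d) (y : X) :
    θ (b - (visitCoord θ L ε O (θ (-b) y)).2) (visitCoord θ L ε O (θ (-b) y)).1 = y := by
  simp only [visitCoord]
  rw [hθ.add, hθ.add]
  convert hθ.zero y using 2
  abel

theorem visits_apply (hθ : IsStationaryFlow θ μ) {o : X}
    (ho : ∀ y ∈ L, ‖y‖ ≤ 4 * ε → θ y o ∈ O → ‖y‖ < ε) {l : L} (hl : ‖l‖ ≤ ε) :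
    visits θ L ε O (θ l o) = (fun z => z + l) ⁻¹' visits θ L ε O o := by
  ext z
  simp only [visits, mem_ofPred_eq, mem_preimage, hθ.add, Submodule.coe_add]
  rw [add_comm (l : Eucl d)]
  have hε : 0 ≤ ε := (norm_nonneg _).trans hl
  refine ⟨fun ⟨h1, h2⟩ => ⟨?_, h2⟩, fun ⟨h1, h2⟩ => ⟨?_, h2⟩⟩
  · have h3 := ho _ (z + l).2 ((norm_add_le z l).trans (by linarith)) h2
    exact h3.le.trans (by linarith)
  · have h3 : ‖z + l‖ < ε := ho _ (z + l).2 (h1.trans (by linarith)) h2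
    have h4 : z = (z + l) - l := by abel
    rw [h4]
    exact (norm_sub_le _ _).trans (by linarith)

theorem visitCenter_apply [TopologicalSpace X] [OpensMeasurableSpace X]
    (hθ : IsStationaryFlow θ μ) (hcont : ∀ ω, Continuous fun z => θ z ω) (hε : 0 < ε)
    (hO : IsOpen O) {o : X} (hoO : o ∈ O)
    (ho : ∀ y ∈ L, ‖y‖ ≤ 4 * ε → θ y o ∈ O → ‖y‖ < ε) {l : L} (hl : ‖l‖ ≤ ε) :
    visitCenter θ L ε O (θ l o) = visitCenter θ L ε O o - l := by
  set ν : Measure L := Measure.addHaar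
  have hZm : MeasurableSet (visits θ L ε O o) :=
    measurable_prodMk_left (measurableSet_visits hθ hO.measurableSet)
  have hZsub : visits θ L ε O o ⊆ Metric.closedBall 0 (2 * ε) :=
    fun z hz => mem_closedBall_zero_iff.2 hz.1
  have hZfin : ν (visits θ L ε O o) ≠ ⊤ :=
    ((measure_mono hZsub).trans_lt measure_closedBall_lt_top).ne
  have hZpos : ν (visits θ L ε O o) ≠ 0 := by
    refine (ν.measure_pos_of_mem_nhds (x := 0) ?_).ne'
    have hc : Continuous fun z : L => θ z o := (hcont o).comp continuous_subtype_val
    have h1 : ∀ᶠ z : L in nhds 0, θ z o ∈ O := by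
      refine hc.continuousAt.eventually_mem (hO.mem_nhds ?_)
      simpa [hθ.zero] using hoO
    filter_upwards [Metric.closedBall_mem_nhds (0 : L) (by linarith : 0 < 2 * ε), h1] with z a b
    exact ⟨mem_closedBall_zero_iff.1 a, b⟩
  have hint : IntegrableOn (fun z : L => z) (visits θ L ε O o) ν :=
    (continuous_id.continuousOn.integrableOn_compact
      (isCompact_closedBall (0 : L) (2 * ε))).mono_set hZsub
  have hint' : IntegrableOn (fun _ : L => l) (visits θ L ε O o) ν :=
    integrableOn_const hZfin
  have h1 : ν (visits θ L ε O (θ l o)) = ν (visits θ L ε O o) := by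
    rw [visits_apply hθ ho hl, measure_preimage_add_right]
  have h2 : ∫ z in visits θ L ε O (θ l o), z ∂ν = ∫ z in visits θ L ε O o, (z - l) ∂ν := by
    have hmp : MeasurePreserving (fun z : L => z + l) ν ν := measurePreserving_add_right ν l
    rw [visits_apply hθ ho hl,
      ← hmp.setIntegral_preimage_emb (measurableEmbedding_addRight l) (fun z => z - l)]
    simp
  rw [visitCenter, visitCenter, setAverage_eq, setAverage_eq, measureReal_def, h1, h2,
    integral_sub hint hint', smul_sub, setIntegral_const, smul_smul, measureReal_def,
    inv_mul_cancel₀ (ENNReal.toReal_ne_zero.2 ⟨hZpos, hZfin⟩), one_smul]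

theorem visitCoord_apply [TopologicalSpace X] [OpensMeasurableSpace X]
    (hθ : IsStationaryFlow θ μ) (hcont : ∀ ω, Continuous fun z => θ z ω) (hε : 0 < ε)
    (hO : IsOpen O) {o : X} (hoO : o ∈ O)
    (ho : ∀ y ∈ L, ‖y‖ ≤ 4 * ε → θ y o ∈ O → ‖y‖ < ε) {l : L} (hl : ‖l‖ ≤ ε) :
    visitCoord θ L ε O (θ l o)
      = ((visitCoord θ L ε O o).1, (visitCoord θ L ε O o).2 - l) := by
  simp only [visitCoord]
  rw [visitCenter_apply hθ hcont hε hO hoO ho hl, hθ.add, Submodule.coe_sub, add_sub_cancel]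

end Barycenter

section Cosets

variable {d : ℕ}

/-- A measure that does not charge small sets does not charge cosets of proper subspaces. -/
theorem DoesNotChargeSmallSets.measure_coset {ν : Measure (Eucl d)}
    (hν : DoesNotChargeSmallSets d ν) {V : Submodule ℝ (Eucl d)} (hV : V ≠ ⊤) (e : Vᗮ) :
    ν {x | Vᗮ.orthogonalProjectionOnto x = e} = 0 := by
  have hrank : Module.finrank ℝ V ≤ Module.finrank ℝ (Eucl (d - 1)) := by
    have := Submodule.finrank_lt hV
    rw [finrank_euclideanSpace_fin] at this ⊢
    omega
  obtain ⟨g, hg⟩ : ∃ g : Eucl (d - 1) →ₗ[ℝ] V, Function.Surjective g := by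
    obtain ⟨f, hf⟩ := finrank_le_iff_exists_linearMap.1 hrank
    obtain ⟨g, hg⟩ := f.exists_leftInverse_of_injective (LinearMap.ker_eq_bot.2 hf)
    exact ⟨g, fun v => ⟨f v, LinearMap.congr_fun hg v⟩⟩
  let h : Eucl (d - 1) →L[ℝ] Eucl d := (V.subtype ∘ₗ g).toContinuousLinearMap
  have hlip : LipschitzWith ‖h‖₊ fun y => (e : Eucl d) + h y :=
    LipschitzWith.of_dist_le_mul fun a b => by
      rw [dist_add_left]; exact h.lipschitz.dist_le_mul a b
  refine measure_mono_null ?_ (hν _ _ hlip)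
  intro x hx
  obtain ⟨y, hy⟩ := hg (V.orthogonalProjectionOnto x)
  refine ⟨y, ?_⟩
  have h1 : h y = (V.orthogonalProjectionOnto x : Eucl d) := by rw [← hy]; rfl
  have h2 := V.starProjection_add_starProjection_orthogonal x
  simp only [h1]
  rw [← show Vᗮ.orthogonalProjectionOnto x = e from hx, add_comm]
  exact h2

theorem apply_eq_apply_orthogonalProjection {X : Type*} [MeasurableSpace X] {θ : Eucl d → X → X}
    {μ : Measure X} (hθ : IsStationaryFlow θ μ) {V : Submodule ℝ (Eucl d)} {ω : X}
    (hω : ∀ v ∈ V, θ v ω = ω) (z : Eucl d) : θ z ω = θ (Vᗮ.orthogonalProjectionOnto z) ω := by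
  have h2 : (V.orthogonalProjectionOnto z : Eucl d) + Vᗮ.orthogonalProjectionOnto z = z :=
    V.starProjection_add_starProjection_orthogonal z
  conv_lhs => rw [← h2, ← hθ.add, hω _ (V.orthogonalProjectionOnto z).2]

end Cosets

section LocalTransport

open ProbabilityTheory Topology

variable {d : ℕ} {X : Type*} [MeasurableSpace X] {θ : Eucl d → X → X} {μ : Measure X}
  {ξ η : Kernel X (Eucl d)}

theorem ae_exists_ball_ne_zero [IsProbabilityMeasure μ] [IsSFiniteKernel ξ]
    (hθ : IsStationaryFlow θ μ)
    (herg : ∀ A, MeasurableSet A → (∀ x, θ x ⁻¹' A = A) → μ A = 0 ∨ μ A = 1)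
    (hξ : IsEquivariant θ ξ) {B : Set X} (hB : MeasurableSet B) (hPB : palm θ μ ξ B ≠ 0)
    {R : ℝ} (hR : 0 < R) :
    ∀ᵐ ω ∂μ, ∃ n : ℕ,
      ξ ω (Metric.ball (TopologicalSpace.denseSeq (Eucl d) n) R ∩ {x | θ x ω ∈ B}) ≠ 0 := by
  have hS : MeasurableSet {p : X × Eucl d | θ p.2 p.1 ∈ B} := hθ.measurable_swap hB
  have hm : Measurable fun ω => ξ ω {x | θ x ω ∈ B} := ξ.measurable_kernel_prodMk_left hS
  have hinv : ∀ s ω, ξ (θ s ω) {x | θ x (θ s ω) ∈ B} = ξ ω {x | θ x ω ∈ B} := fun s ω => by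
    have h1 : MeasurableSet {x | θ x (θ s ω) ∈ B} := hθ.measurable_left _ hB
    rw [hξ, Measure.map_apply (by fun_prop) h1]
    congr 1
    ext y
    simp only [mem_preimage, mem_ofPred_eq, hθ.add, add_sub_cancel]
  have hZ : μ {ω | ξ ω {x | θ x ω ∈ B} = 0} = 0 := by
    refine (herg _ (hm (measurableSet_singleton 0)) fun s => ?_).resolve_right fun h1 => ?_
    · ext ω; simp only [mem_preimage, hinv]
    · exact hPB ((palm_eq_zero_iff hθ hξ hB).2
        ((mem_ae_iff_prob_eq_one (hm (measurableSet_singleton 0))).2 h1))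
  have hZ' : ∀ᵐ ω ∂μ, ξ ω {x | θ x ω ∈ B} ≠ 0 := by
    rw [ae_iff]; simpa using hZ
  filter_upwards [hZ'] with ω hω
  by_contra! hn
  refine hω (measure_mono_null ?_ (measure_iUnion_null hn))
  intro x hx
  obtain ⟨n, hn⟩ := (TopologicalSpace.denseRange_denseSeq (Eucl d)).exists_dist_lt x hR
  exact mem_iUnion.2 ⟨n, hn, hx⟩

theorem exists_cross_sections [MetricSpace X] [SecondCountableTopology X]
    [OpensMeasurableSpace X] [IsProbabilityMeasure μ] (hθ : IsStationaryFlow θ μ)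
    (hcont : ∀ ω, Continuous fun z => θ z ω) {L : Submodule ℝ (Eucl d)} {ε : ℝ}
    (hsep : ∀ᵐ ω ∂μ, ∀ z ∈ L, ε ≤ ‖z‖ → ‖z‖ ≤ 4 * ε → θ z ω ≠ ω) :
    ∃ O U : ℕ × ℕ → Set X, (∀ n, IsOpen (O n)) ∧ (∀ n, MeasurableSet (U n)) ∧
      (∀ n, U n ⊆ O n) ∧
      (∀ n, ∀ o ∈ U n, ∀ y ∈ L, ‖y‖ ≤ 4 * ε → θ y o ∈ O n → ‖y‖ < ε) ∧
      (∀ n, ∀ o ∈ U n, ∀ᶠ z in 𝓝 0, θ z o ∈ U n) ∧ ∀ᵐ ω ∂μ, ∃ n, ω ∈ U n := by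
  have : Nonempty X := nonempty_of_isProbabilityMeasure μ
  set C : Set (Eucl d) := {z | z ∈ L ∧ ε ≤ ‖z‖ ∧ ‖z‖ ≤ 4 * ε} with hC
  have hCc : IsCompact C := by
    refine (isCompact_closedBall (0 : Eucl d) (4 * ε)).of_isClosed_subset ?_
      fun z hz => mem_closedBall_zero_iff.2 hz.2.2
    exact L.closed_of_finiteDimensional.inter
      ((isClosed_le continuous_const continuous_norm).inter
        (isClosed_le continuous_norm continuous_const))
  set x := TopologicalSpace.denseSeq X
  have hr : ∀ n : ℕ, (0 : ℝ) < 1 / (n + 1) := fun n => Nat.one_div_pos_of_nat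
  have key : ∀ (r : ℝ) (o : X), (¬ ∃ z ∈ C, dist (θ z o) o ≤ 2 * r) →
      ∀ᶠ s in 𝓝 (0 : Eucl d), ¬ ∃ z ∈ C, dist (θ z (θ s o)) (θ s o) ≤ 2 * r := by
    intro r o ho
    push Not at ho ⊢
    refine hCc.eventually_forall_of_forall_eventually fun z hz => ?_
    have hc : Continuous fun p : Eucl d × Eucl d => dist (θ p.2 (θ p.1 o)) (θ p.1 o) := by
      simp only [hθ.add]
      exact ((hcont o).comp (continuous_fst.add continuous_snd)).dist
        ((hcont o).comp continuous_fst)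
    refine (hc.tendsto (0, z)).eventually_const_lt ?_
    simpa [hθ.zero] using ho z hz
  refine ⟨fun n => Metric.ball (x n.1) (1 / (n.2 + 1)),
    fun n => Metric.ball (x n.1) (1 / (n.2 + 1)) ∩
      {ω | ¬ ∃ z ∈ C, dist (θ z ω) ω ≤ 2 * (1 / (n.2 + 1))},
    fun n => Metric.isOpen_ball, fun n => ?_, fun n => inter_subset_left, ?_, ?_, ?_⟩
  · exact Metric.isOpen_ball.measurableSet.inter
      (measurableSet_exists_dist_le hθ hcont hCc _).compl
  · rintro n o ⟨ho1, ho2⟩ y hyL hy hyO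
    by_contra! hy'
    refine ho2 ⟨y, ⟨hyL, hy', hy⟩, ?_⟩
    have h1 : dist (θ y o) (x n.1) < _ := hyO
    have h2 : dist o (x n.1) < _ := ho1
    exact (dist_triangle_right _ _ (x n.1)).trans (by linarith)
  · rintro n o ⟨ho1, ho2⟩
    have h1 : ∀ᶠ s in 𝓝 (0 : Eucl d), θ s o ∈ Metric.ball (x n.1) (1 / (n.2 + 1)) :=
      (hcont o).continuousAt.eventually_mem
        (Metric.isOpen_ball.mem_nhds (by rw [hθ.zero]; exact ho1))
    filter_upwards [h1, key _ o ho2] with s h1 h2 using ⟨h1, h2⟩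
  · filter_upwards [hsep] with ω hω
    have h1 : ∃ m : ℕ, ∀ z ∈ C, 2 * (1 / ((m : ℝ) + 1)) < dist (θ z ω) ω := by
      rcases C.eq_empty_or_nonempty with h | h
      · exact ⟨0, by simp [h]⟩
      obtain ⟨z, hz, hmin⟩ := hCc.exists_isMinOn h
        ((hcont ω).dist continuous_const : Continuous fun z => dist (θ z ω) ω).continuousOn
      have hpos : 0 < dist (θ z ω) ω := dist_pos.2 (hω z hz.1 hz.2.1 hz.2.2)
      obtain ⟨m, hm⟩ := exists_nat_one_div_lt (half_pos hpos)
      exact ⟨m, fun y hy => (by linarith : _ < dist (θ z ω) ω).trans_le (hmin hy)⟩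
    obtain ⟨m, hm⟩ := h1
    obtain ⟨i, hi⟩ := (TopologicalSpace.denseRange_denseSeq X).exists_dist_lt ω (hr m)
    exact ⟨(i, m), hi, by simpa using hm⟩

/-- The points of the orbits close to the set `U`. -/
def nearby (θ : Eucl d → X → X) (L : Submodule ℝ (Eucl d)) (R : ℝ) (U : Set X) : Set X :=
  {x | ∃ n : ℕ, ‖TopologicalSpace.denseSeq L n‖ < R ∧ θ (TopologicalSpace.denseSeq L n) x ∈ U}

variable {L : Submodule ℝ (Eucl d)} {R ε : ℝ} {O U : Set X}

theorem measurableSet_nearby (hθ : IsStationaryFlow θ μ) (hU : MeasurableSet U) :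
    MeasurableSet (nearby θ L R U) := by
  have : nearby θ L R U = ⋃ n : ℕ, {x | ‖TopologicalSpace.denseSeq L n‖ < R ∧
      θ (TopologicalSpace.denseSeq L n) x ∈ U} := by ext; simp [nearby]
  rw [this]
  exact .iUnion fun n => (MeasurableSet.const _).inter (hθ.measurable_right _ hU)

theorem apply_mem_nearby (hθ : IsStationaryFlow θ μ) {o : X}
    (ho : ∀ᶠ z in 𝓝 0, θ z o ∈ U) {l : L} (hl : ‖l‖ < R) : θ l o ∈ nearby θ L R U := by
  have h1 : Tendsto (fun w : L => ((l + w : L) : Eucl d)) (𝓝 (-l)) (𝓝 0) := by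
    have : Continuous fun w : L => ((l + w : L) : Eucl d) := by fun_prop
    simpa using this.tendsto (-l)
  have h2 : ∀ᶠ w : L in 𝓝 (-l), ‖w‖ < R :=
    (continuous_norm.tendsto (-l)).eventually_lt_const (by simpa using hl)
  obtain ⟨t, ht, hto, hlt⟩ := eventually_nhds_iff.1 ((h1.eventually ho).and h2)
  obtain ⟨n, hn⟩ := (TopologicalSpace.denseRange_denseSeq L).exists_mem_open hto ⟨_, hlt⟩
  refine ⟨n, (ht _ hn).2, ?_⟩
  rw [hθ.add]
  exact (ht _ hn).1

end LocalTransport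

section LocalTransport

open ProbabilityTheory Topology

variable {d : ℕ} {X : Type*} [MeasurableSpace X] {θ : Eucl d → X → X} {μ : Measure X}
  {ξ η : Kernel X (Eucl d)} {V : Submodule ℝ (Eucl d)} {R ε : ℝ} {U : Set X} {κ : X → X × Vᗮ}

theorem norm_orthogonalProjectionOnto_le (x : Eucl d) :
    ‖Vᗮ.orthogonalProjectionOnto x‖ ≤ ‖x‖ :=
  Vᗮ.norm_orthogonalProjectionOnto_apply_le x

theorem not_mutuallySingular_of_hits [SFinite μ] [IsSFiniteKernel ξ] [IsSFiniteKernel η]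
    (hθ : IsStationaryFlow θ μ) (hξ : IsEquivariant θ ξ) (hη : IsEquivariant θ η)
    (hκm : Measurable κ) (hRε : R ≤ ε)
    (hκ : ∀ o ∈ U, ∀ l : Vᗮ, ‖l‖ ≤ ε → κ (θ l o) = ((κ o).1, (κ o).2 - l))
    (hU : MeasurableSet U) (hUopen : ∀ o ∈ U, ∀ᶠ z in 𝓝 0, θ z o ∈ U) {B₁ B₂ : Set X}
    (hB₁ : MeasurableSet B₁) (hB₂ : MeasurableSet B₂) {Q : Measure X}
    (hQ : ∀ C, MeasurableSet C → Q C = 0 → palm θ μ η (C ∩ B₂) = 0) {a b : Eucl d}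
    (hfreq : ∃ᶠ ω in ae μ, (∀ v ∈ V, θ v ω = ω) ∧ ω ∈ U ∧
      ξ ω (Metric.ball a R ∩ {x | θ x ω ∈ B₁}) ≠ 0 ∧
      η ω (Metric.ball b R ∩ {x | θ x ω ∈ B₂}) ≠ 0) :
    ¬ (Q.map fun x => κ (θ (-b) x)).fst ⟂ₘ
      (((palm θ μ ξ).restrict (B₁ ∩ θ (-a) ⁻¹' nearby θ Vᗮ R U)).map
        fun x => κ (θ (-a) x)).fst := by
  rintro ⟨N, hN, hN₂, hN₁⟩
  have hm : ∀ s, Measurable fun x => (κ (θ s x)).1 :=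
    fun s => (hκm.comp (hθ.measurable_right s)).fst
  have hA : MeasurableSet (B₁ ∩ θ (-a) ⁻¹' nearby θ Vᗮ R U) :=
    hB₁.inter (hθ.measurable_right _ (measurableSet_nearby hθ hU))
  have hm' : ∀ s, Measurable fun x => κ (θ s x) := fun s => hκm.comp (hθ.measurable_right s)
  rw [Measure.fst_apply hN, Measure.map_apply (hm' _) (measurable_fst hN)] at hN₂
  rw [Measure.fst_apply hN.compl, Measure.map_apply (hm' _) (measurable_fst hN.compl),
    Measure.restrict_apply (hm' _ (measurable_fst hN.compl)),
    palm_eq_zero_iff hθ hξ ((hm' _ (measurable_fst hN.compl)).inter hA)] at hN₁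
  have hN₂ := hQ _ (hm' _ (measurable_fst hN)) hN₂
  rw [palm_eq_zero_iff hθ hη ((hm' _ (measurable_fst hN)).inter hB₂)] at hN₂
  obtain ⟨ω, ⟨hstab, hωU, hξω, hηω⟩, h₁, h₂⟩ := (hfreq.and_eventually (hN₁.and hN₂)).exists
  have hmove : ∀ s x, x ∈ Metric.ball s R → ∃ l : Vᗮ, ‖l‖ < R ∧ θ (-s) (θ x ω) = θ l ω := by
    intro s x hx
    refine ⟨Vᗮ.orthogonalProjectionOnto (x - s),
      (norm_orthogonalProjectionOnto_le _).trans_lt (mem_ball_iff_norm.1 hx), ?_⟩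
    rw [hθ.add, ← sub_eq_add_neg]
    exact apply_eq_apply_orthogonalProjection hθ hstab _
  by_cases hc : (κ ω).1 ∈ N
  · refine hηω (measure_mono_null ?_ h₂)
    rintro y ⟨hy, hyB⟩
    obtain ⟨l, hl, hly⟩ := hmove b y hy
    refine ⟨?_, hyB⟩
    simp only [mem_preimage]
    rwa [hly, hκ ω hωU l (hl.le.trans hRε)]
  · refine hξω (measure_mono_null ?_ h₁)
    rintro y ⟨hy, hyB⟩
    obtain ⟨l, hl, hly⟩ := hmove a y hy
    refine ⟨?_, hyB, ?_⟩
    · simp only [mem_preimage]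
      rwa [hly, hκ ω hωU l (hl.le.trans hRε)]
    · simp only [mem_preimage]
      rw [hly]
      exact apply_mem_nearby hθ (hUopen ω hωU) hl

theorem measurableSet_kernel_singleton_ne_zero {Y E : Type*} [MeasurableSpace Y]
    [MeasurableSpace E] [MeasurableEq E] (K : Kernel Y E) [IsSFiniteKernel K] :
    MeasurableSet {q : Y × E | K q.1 {q.2} ≠ 0} := by
  have h1 : MeasurableSet {p : (Y × E) × E | p.2 = p.1.2} :=
    measurableSet_eq_fun measurable_snd measurable_fst.snd
  have h2 := (K.comap Prod.fst (measurable_fst (β := E))).measurable_kernel_prodMk_left h1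
  exact h2 (measurableSet_singleton 0).compl

theorem palm_atoms_eq_zero [SFinite μ] [IsSFiniteKernel ξ]
    (hθ : IsStationaryFlow θ μ) (hξ : IsEquivariant θ ξ)
    (hstab : ∀ᵐ ω ∂μ, ∀ v ∈ V, θ v ω = ω)
    (hsmall : ∀ᵐ ω ∂μ, ∀ e : Vᗮ, ξ ω {x | Vᗮ.orthogonalProjectionOnto x = e} = 0)
    (hκm : Measurable κ) (hR : 0 < R) (hRε : 2 * R ≤ ε)
    (hκ : ∀ o ∈ U, ∀ l : Vᗮ, ‖l‖ ≤ ε → κ (θ l o) = ((κ o).1, (κ o).2 - l))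
    (hU : MeasurableSet U) (a : Eucl d) (K : Kernel X Vᗮ) [IsFiniteKernel K] :
    palm θ μ ξ {x | θ (-a) x ∈ nearby θ Vᗮ R U ∧
      K (κ (θ (-a) x)).1 {(κ (θ (-a) x)).2} ≠ 0} = 0 := by
  have hmeas : MeasurableSet {x | θ (-a) x ∈ nearby θ Vᗮ R U ∧
      K (κ (θ (-a) x)).1 {(κ (θ (-a) x)).2} ≠ 0} :=
    (hθ.measurable_right _ (measurableSet_nearby hθ hU)).inter
      ((hκm.comp (hθ.measurable_right (-a))) (measurableSet_kernel_singleton_ne_zero K))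
  rw [palm_eq_zero_iff hθ hξ hmeas]
  filter_upwards [hstab, hsmall] with ω hω hξω
  refine measure_null_of_locally_null _ fun x₀ hx₀ => ?_
  obtain ⟨⟨n, hwn, hwU⟩, -⟩ := hx₀
  set w : Vᗮ := TopologicalSpace.denseSeq Vᗮ n
  set o := θ w (θ (-a) (θ x₀ ω)) with ho
  have hoV : ∀ v ∈ V, θ v o = o := fun v hv => by
    have hcomm : ∀ s y, θ v (θ s y) = θ s (θ v y) := fun s y => by
      rw [hθ.add, hθ.add, add_comm]
    rw [ho, hcomm, hcomm, hcomm, hω v hv]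
  refine ⟨_, inter_mem_nhdsWithin _ (Metric.ball_mem_nhds x₀ hR), ?_⟩
  set T : Set Vᗮ := {u | 0 < K (κ o).1 {u}}
  have hT : T.Countable := Measure.countable_meas_level_set_pos measurable_id
  refine measure_mono_null ?_ ((measure_biUnion_null_iff hT).2 fun t _ =>
    hξω ((κ o).2 - t + Vᗮ.orthogonalProjectionOnto (x₀ + w)))
  rintro x ⟨⟨-, hx⟩, hxR⟩
  set l := Vᗮ.orthogonalProjectionOnto (x - (x₀ + w)) with hl
  have hlε : ‖l‖ ≤ ε := by
    refine (norm_orthogonalProjectionOnto_le _).trans ?_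
    rw [← sub_sub]
    refine (norm_sub_le _ _).trans ?_
    have h1 : ‖x - x₀‖ < R := mem_ball_iff_norm.1 hxR
    have h2 : ‖(w : Eucl d)‖ < R := hwn
    linarith
  have hxo : θ (-a) (θ x ω) = θ l o := by
    rw [hl, ← apply_eq_apply_orthogonalProjection hθ hoV, ho, hθ.add, hθ.add, hθ.add, hθ.add]
    congr 1
    abel
  rw [hxo, hκ o hwU l hlε] at hx
  refine mem_iUnion₂.2 ⟨_, pos_iff_ne_zero.2 hx, ?_⟩
  simp only [mem_ofPred_eq]
  rw [hl, map_sub]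
  abel

theorem exists_local_transport_of_hits [SFinite μ] [IsSFiniteKernel ξ] [IsSFiniteKernel η]
    (hθ : IsStationaryFlow θ μ) (hξ : IsEquivariant θ ξ) (hη : IsEquivariant θ η)
    [IsFiniteMeasure (palm θ μ ξ)]
    (hstab : ∀ᵐ ω ∂μ, ∀ v ∈ V, θ v ω = ω)
    (hsmall : ∀ᵐ ω ∂μ, ∀ e : Vᗮ, ξ ω {x | Vᗮ.orthogonalProjectionOnto x = e} = 0)
    {O : Set X} (hO : MeasurableSet O) (hR : 0 < R) (hRε : 2 * R ≤ ε)
    (hκ : ∀ o ∈ U, ∀ l : Vᗮ, ‖l‖ ≤ ε → visitCoord θ Vᗮ ε O (θ l o) =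
      ((visitCoord θ Vᗮ ε O o).1, (visitCoord θ Vᗮ ε O o).2 - l))
    (hU : MeasurableSet U) (hUopen : ∀ o ∈ U, ∀ᶠ z in 𝓝 0, θ z o ∈ U) {B₁ B₂ : Set X}
    (hB₁ : MeasurableSet B₁) (hB₂ : MeasurableSet B₂) {Q : Measure X} [IsFiniteMeasure Q]
    (hQ : ∀ C, MeasurableSet C → Q C = 0 → palm θ μ η (C ∩ B₂) = 0) {a b : Eucl d}
    (hfreq : ∃ᶠ ω in ae μ, (∀ v ∈ V, θ v ω = ω) ∧ ω ∈ U ∧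
      ξ ω (Metric.ball a R ∩ {x | θ x ω ∈ B₁}) ≠ 0 ∧
      η ω (Metric.ball b R ∩ {x | θ x ω ∈ B₂}) ≠ 0) :
    ∃ A ⊆ B₁, MeasurableSet A ∧ palm θ μ ξ A ≠ 0 ∧ ∃ τ : X → Eucl d, Measurable τ ∧
      ((palm θ μ ξ).restrict A).map (fun x => θ (τ x) x) ≤ Q := by
  have hκm : Measurable (visitCoord θ Vᗮ ε O) := measurable_visitCoord hθ hO
  set κ := visitCoord θ Vᗮ ε O with hκdef
  set A₁ := B₁ ∩ θ (-a) ⁻¹' nearby θ Vᗮ R U with hA₁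
  have hA₁m : MeasurableSet A₁ :=
    hB₁.inter (hθ.measurable_right _ (measurableSet_nearby hθ hU))
  have hm : ∀ s, Measurable fun x => κ (θ s x) := fun s => hκm.comp (hθ.measurable_right s)
  have hsing := not_mutuallySingular_of_hits hθ hξ hη hκm (by linarith) hκ hU hUopen hB₁ hB₂ hQ
    hfreq
  have : PolishSpace Vᗮ := Vᗮ.closed_of_finiteDimensional.polishSpace
  set ρ₁ := ((palm θ μ ξ).restrict A₁).map fun x => κ (θ (-a) x) with hρ₁
  set ρ₂ := Q.map fun x => κ (θ (-b) x) with hρ₂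
  have hρ₁_apply : ∀ S, MeasurableSet S →
      ρ₁ S = palm θ μ ξ ((fun x => κ (θ (-a) x)) ⁻¹' S ∩ A₁) := fun S hS => by
    rw [hρ₁, Measure.map_apply (hm _) hS, Measure.restrict_apply (hm _ hS)]
  have hatm := measurableSet_kernel_singleton_ne_zero ρ₁.condKernel
  have hat0 : ρ₁ {q | ρ₁.condKernel q.1 {q.2} ≠ 0} = 0 := by
    rw [hρ₁_apply _ hatm]
    refine measure_mono_null ?_ (palm_atoms_eq_zero hθ hξ hstab hsmall hκm hR hRε hκ hU a
      ρ₁.condKernel)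
    rintro x ⟨h1, -, h2⟩
    exact ⟨h2, h1⟩
  have hat : ∀ᵐ c ∂ρ₁.fst, ∀ u, ρ₁.condKernel c {u} = 0 := by
    have h1 : (ρ₁.fst ⊗ₘ ρ₁.condKernel) {q | ρ₁.condKernel q.1 {q.2} ≠ 0} = 0 := by
      rwa [ρ₁.disintegrate]
    rw [Measure.compProd_apply hatm,
      lintegral_eq_zero_iff (Kernel.measurable_kernel_prodMk_left hatm)] at h1
    filter_upwards [h1] with c hc u
    by_contra hu
    exact hu (measure_mono_null (singleton_subset_iff.2 hu) hc)
  obtain ⟨A', hA', hA'0, g, hg, hle⟩ := exists_fiber_transport ρ₁ ρ₂ hsing hat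
  have hpre : MeasurableSet ((fun x => κ (θ (-a) x)) ⁻¹' A') := hm _ hA'
  let Ψ : X × Vᗮ → X := fun q => θ (b - q.2) q.1
  have hΨ : Measurable Ψ := hθ.measurable.comp
    ((measurable_const.sub (measurable_subtype_coe.comp measurable_snd)).prodMk measurable_fst)
  refine ⟨A₁ ∩ (fun x => κ (θ (-a) x)) ⁻¹' A', fun x hx => hx.1.1, hA₁m.inter hpre, ?_,
    fun x => b - a + (κ (θ (-a) x)).2 - g (κ (θ (-a) x)), ?_, ?_⟩
  · rwa [hρ₁_apply _ hA', inter_comm] at hA'0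
  · exact (measurable_const.add (measurable_subtype_coe.comp (hm _).snd)).sub
      (measurable_subtype_coe.comp (hg.comp (hm _)))
  · have hfac : (fun x => θ (b - a + (κ (θ (-a) x)).2 - g (κ (θ (-a) x))) x)
        = Ψ ∘ (fun q => (q.1, g q)) ∘ fun x => κ (θ (-a) x) := by
      ext1 x
      simp only [Ψ, Function.comp, hκdef, visitCoord]
      rw [hθ.add, hθ.add]
      congr 1
      abel
    have hgm : Measurable fun q : X × Vᗮ => (q.1, g q) := measurable_fst.prodMk hg
    have hfst : ((palm θ μ ξ).restrict (A₁ ∩ (fun x => κ (θ (-a) x)) ⁻¹' A')).map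
        (fun x => κ (θ (-a) x)) = ρ₁.restrict A' := by
      rw [hρ₁, Measure.restrict_map (hm _) hA', Measure.restrict_restrict hpre, inter_comm]
    rw [hfac, ← Measure.map_map hΨ (hgm.comp (hm _)), ← Measure.map_map hgm (hm _), hfst]
    refine (Measure.map_mono hle hΨ).trans_eq ?_
    rw [hρ₂, Measure.map_map hΨ (hm _)]
    convert! Measure.map_id
    ext1 y
    exact apply_visitCoord hθ b y

end LocalTransport

section Existence

open ProbabilityTheory Topology
open scoped ENNReal

variable {d : ℕ} {X : Type*} [MeasurableSpace X] {θ : Eucl d → X → X} {μ : Measure X}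
  {ξ η : Kernel X (Eucl d)} [MetricSpace X] [SecondCountableTopology X] [OpensMeasurableSpace X]

theorem measure_eq_zero_or_one_of_trivial (hθ : IsStationaryFlow θ μ)
    (herg : ∀ A, MeasurableSet A → (∀ x, θ x ⁻¹' A = A) → μ A = 0 ∨ μ A = 1)
    (hcont : ∀ ω, Continuous fun z => θ z ω) (hfix : ∀ᵐ ω ∂μ, ∀ z, θ z ω = ω) {C : Set X}
    (hC : MeasurableSet C) : μ C = 0 ∨ μ C = 1 := by
  have hF : MeasurableSet {ω | ∀ z, θ z ω = ω} := by
    have h1 : {ω | ∀ z, θ z ω = ω}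
        = ⋂ n : ℕ, {ω | dist (θ (TopologicalSpace.denseSeq (Eucl d) n) ω) ω = 0} := by
      ext ω
      simp only [mem_ofPred_eq, mem_iInter, dist_eq_zero]
      refine ⟨fun h n => h _, fun h => congrFun ((TopologicalSpace.denseRange_denseSeq
        (Eucl d)).equalizer (hcont ω) continuous_const (funext h))⟩
    rw [h1]
    exact .iInter fun n =>
      ((hθ.measurable_right _).dist measurable_id) (measurableSet_singleton 0)
  have hCF : μ (C ∩ {ω | ∀ z, θ z ω = ω}) = μ C :=
    measure_congr (inter_ae_eq_left_of_ae_eq_univ (eventuallyEq_univ.2 hfix))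
  rw [← hCF]
  refine herg _ (hC.inter hF) fun x => ?_
  ext ω
  simp only [mem_preimage, mem_inter_iff, mem_ofPred_eq]
  refine ⟨fun ⟨h1, h2⟩ => ?_, fun ⟨h1, h2⟩ => ?_⟩
  · have h3 : θ x ω = ω := by rw [← h2 (-x), hθ.neg_apply]
    rw [h3] at h1 h2
    exact ⟨h1, h2⟩
  · rw [h2 x]
    exact ⟨h1, h2⟩

variable [IsProbabilityMeasure μ] [IsSFiniteKernel ξ] [IsSFiniteKernel η]

theorem exists_local_transport (hθ : IsStationaryFlow θ μ)
    (herg : ∀ A, MeasurableSet A → (∀ x, θ x ⁻¹' A = A) → μ A = 0 ∨ μ A = 1)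
    (hcont : ∀ ω, Continuous fun z => θ z ω) (hξ : IsEquivariant θ ξ) (hη : IsEquivariant θ η)
    {V : Submodule ℝ (Eucl d)} (hstab : ∀ᵐ ω ∂μ, ∀ v ∈ V, θ v ω = ω) {ε : ℝ}
    (hε : 0 < ε) (hsep : ∀ᵐ ω ∂μ, ∀ z ∈ Vᗮ, ε ≤ ‖z‖ → ‖z‖ ≤ 4 * ε → θ z ω ≠ ω)
    [IsFiniteMeasure (palm θ μ ξ)] [IsFiniteMeasure (palm θ μ η)]
    (hsmall : ∀ᵐ ω ∂μ, ∀ e : Vᗮ, ξ ω {x | Vᗮ.orthogonalProjectionOnto x = e} = 0)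
    {B : Set X} (hB : MeasurableSet B)
    (hPB : palm θ μ ξ B ≠ 0) {Q : Measure X} (hQ : Q ≤ palm θ μ η) (hQ0 : Q ≠ 0) :
    ∃ A ⊆ B, MeasurableSet A ∧ palm θ μ ξ A ≠ 0 ∧ ∃ τ : X → Eucl d, Measurable τ ∧
      ((palm θ μ ξ).restrict A).map (fun x => θ (τ x) x) ≤ Q := by
  have hQfin : IsFiniteMeasure Q := isFiniteMeasure_of_le _ hQ
  set g := Q.rnDeriv (palm θ μ η)
  have hg : Measurable g := Measure.measurable_rnDeriv _ _
  have hQg : (palm θ μ η).withDensity g = Q :=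
    Measure.withDensity_rnDeriv_eq _ _ (Measure.absolutelyContinuous_of_le hQ)
  set B₂ : Set X := {x | g x ≠ 0}
  have hB₂ : MeasurableSet B₂ := hg (measurableSet_singleton 0).compl
  have hQB : ∀ C, MeasurableSet C → Q C = 0 → palm θ μ η (C ∩ B₂) = 0 := fun C _ hC => by
    rwa [← hQg, withDensity_apply_eq_zero hg, inter_comm] at hC
  have hPB₂ : palm θ μ η B₂ ≠ 0 := fun h => by
    refine hQ0 (Measure.measure_univ_eq_zero.1 ?_)
    rwa [← hQg, withDensity_apply_eq_zero hg, inter_univ]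
  have hR : 0 < ε / 4 := by linarith
  have hhit₁ := ae_exists_ball_ne_zero hθ herg hξ hB hPB hR
  have hhit₂ := ae_exists_ball_ne_zero hθ herg hη hB₂ hPB₂ hR
  obtain ⟨O, U, hO, hU, hUO, hUsep, hUopen, hcover⟩ := exists_cross_sections hθ hcont hsep
  obtain ⟨i, j, n, hfreq⟩ : ∃ i j n, ∃ᶠ ω in ae μ, (∀ v ∈ V, θ v ω = ω) ∧ ω ∈ U n ∧
      ξ ω (Metric.ball (TopologicalSpace.denseSeq _ i) (ε / 4) ∩ {x | θ x ω ∈ B}) ≠ 0 ∧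
      η ω (Metric.ball (TopologicalSpace.denseSeq _ j) (ε / 4) ∩ {x | θ x ω ∈ B₂}) ≠ 0 := by
    by_contra! hn
    have hall := ae_all_iff.2 fun i => ae_all_iff.2 fun j => ae_all_iff.2 (hn i j)
    have hfalse : ∀ᵐ ω ∂μ, False := by
      filter_upwards [hall, hstab, hhit₁, hhit₂, hcover] with ω h1 h2 ⟨i, hi⟩ ⟨j, hj⟩ ⟨n, hn⟩
      exact hj (h1 i j n h2 hn hi)
    exact hfalse.exists.elim fun _ => id
  exact exists_local_transport_of_hits hθ hξ hη hstab hsmall (hO n).measurableSet hR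
    (by linarith) (fun o ho l hl => visitCoord_apply hθ hcont hε (hO n) (hUO n ho)
      (hUsep n o ho) hl) (hU n) (hUopen n) hB hB₂ hQB hfreq

/-- Existence of balancing allocations for stationary ergodic flows with continuous orbits. -/
theorem exists_shift_map_eq (hθ : IsStationaryFlow θ μ)
    (herg : ∀ A, MeasurableSet A → (∀ x, θ x ⁻¹' A = A) → μ A = 0 ∨ μ A = 1)
    (hcont : ∀ ω, Continuous fun z => θ z ω) (hξ : IsEquivariant θ ξ) (hη : IsEquivariant θ η)
    (hloc : ∀ᵐ ω ∂μ, ∀ n : ℕ, η ω (Metric.closedBall 0 n) ≠ ∞)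
    (hfin : ∫⁻ ω, ξ ω (unitCube d) ∂μ ≠ ∞)
    (hint : ∫⁻ ω, ξ ω (unitCube d) ∂μ = ∫⁻ ω, η ω (unitCube d) ∂μ)
    (hsmall : ∀ V : Submodule ℝ (Eucl d), V ≠ ⊤ →
      ∀ᵐ ω ∂μ, ∀ e : Vᗮ, ξ ω {x | Vᗮ.orthogonalProjectionOnto x = e} = 0) :
    ∃ τ : X → Eucl d, Measurable τ ∧ ∀ᵐ ω ∂μ, (ξ ω).map (fun x => x + τ (θ x ω)) = η ω := by
  suffices h : ∃ τ : X → Eucl d, Measurable τ ∧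
      (palm θ μ ξ).map (fun x => θ (τ x) x) = palm θ μ η by
    obtain ⟨τ, hτ, h⟩ := h
    exact ⟨τ, hτ, map_eq_of_palm_map_eq hθ hξ hη hloc hτ h⟩
  have hPQ : palm θ μ ξ univ = palm θ μ η univ := by rw [palm_univ hθ, palm_univ hθ, hint]
  have hP : IsFiniteMeasure (palm θ μ ξ) := ⟨by rw [palm_univ hθ]; exact hfin.lt_top⟩
  have hQ : IsFiniteMeasure (palm θ μ η) := ⟨by rw [← hPQ]; exact measure_lt_top _ _⟩
  obtain ⟨V, hstab, ε, hε, hsep⟩ := exists_stabilizer_subspace hθ herg hcont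
  by_cases hV : V = ⊤
  · have hfix : ∀ᵐ ω ∂μ, ∀ z, θ z ω = ω := by
      filter_upwards [hstab] with ω h z using h z (hV ▸ Submodule.mem_top)
    refine ⟨0, measurable_zero, ?_⟩
    have hid : (fun x => θ ((0 : X → Eucl d) x) x) = id := by ext1 x; exact hθ.zero x
    rw [hid, Measure.map_id]
    ext C hC
    rw [palm_apply_of_trivial hθ hfix hC, palm_apply_of_trivial hθ hfix hC]
    rcases measure_eq_zero_or_one_of_trivial hθ herg hcont hfix hC with h | h
    · rw [setLIntegral_measure_zero _ _ h, setLIntegral_measure_zero _ _ h]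
    · have hr : μ.restrict C = μ :=
        Measure.restrict_eq_self_of_ae_mem ((mem_ae_iff_prob_eq_one hC).2 h)
      rw [hr, hint]
  · exact exists_map_eq_of_local hθ.measurable _ _ hPQ fun B hB hPB Q' hQ' hQ0 =>
      exists_local_transport hθ herg hcont hξ hη hstab hε hsep (hsmall V hV) hB hPB hQ' hQ0

end Existence

section TestFunctions

open Topology TopologicalSpace
open scoped ENNReal

variable {d : ℕ}

/-- A countable family of bounded open sets, stable under intersections. -/
def testSet (k : Finset (countableBasis (Eucl d)) × ℕ) : Set (Eucl d) :=
  Metric.ball 0 k.2 ∩ ⋂ s ∈ k.1, (s : Set (Eucl d))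

theorem isOpen_testSet (k : Finset (countableBasis (Eucl d)) × ℕ) : IsOpen (testSet k) :=
  Metric.isOpen_ball.inter
    (isOpen_biInter_finset fun s _ => isOpen_of_mem_countableBasis s.2)

theorem measure_testSet_ne_top {ν : Measure (Eucl d)}
    (hν : ∀ n : ℕ, ν (Metric.closedBall 0 n) ≠ ∞) (k : Finset (countableBasis (Eucl d)) × ℕ) :
    ν (testSet k) ≠ ∞ :=
  ((measure_mono (inter_subset_left.trans Metric.ball_subset_closedBall)).trans_lt
    (hν k.2).lt_top).ne

theorem ext_of_testSet {ν ν' : Measure (Eucl d)} (hν : ∀ n : ℕ, ν (Metric.closedBall 0 n) ≠ ∞)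
    (h : ∀ k, ν (testSet k) = ν' (testSet k)) : ν = ν' := by
  have hcover : ⋃ n : ℕ, Metric.ball (0 : Eucl d) n = univ := Metric.iUnion_ball_nat 0
  refine Measure.ext_of_generateFrom_of_iUnion (range testSet) (fun n => testSet (∅, n))
    ?_ ?_ ?_ (fun n => mem_range_self _) (fun n => measure_testSet_ne_top hν _) ?_
  · refine le_antisymm ?_ (MeasurableSpace.generateFrom_le ?_)
    · rw [BorelSpace.measurable_eq (α := Eucl d),
        (isBasis_countableBasis (Eucl d)).borel_eq_generateFrom]
      refine MeasurableSpace.generateFrom_le fun s hs => ?_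
      have hs' : s = ⋃ n : ℕ, testSet ({⟨s, hs⟩}, n) := by
        simp only [testSet, Finset.mem_singleton, iInter_iInter_eq_left]
        rw [← iUnion_inter, hcover, univ_inter]
      rw [hs']
      exact .iUnion fun n => MeasurableSpace.measurableSet_generateFrom (mem_range_self _)
    · rintro _ ⟨k, rfl⟩
      exact (isOpen_testSet k).measurableSet
  · rintro _ ⟨k, rfl⟩ _ ⟨l, rfl⟩ -
    classical
    refine ⟨(k.1 ∪ l.1, min k.2 l.2), ?_⟩
    ext x
    simp only [testSet, mem_inter_iff, mem_ball_zero_iff, mem_iInter, Finset.mem_union,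
      Nat.cast_min, lt_min_iff]
    grind
  · simp [testSet, hcover]
  · rintro _ ⟨k, rfl⟩
    exact h k

/-- Continuous functions increasing to the indicator of a test set. -/
def testFun (k : Finset (countableBasis (Eucl d)) × ℕ) (m : ℕ) (x : Eucl d) : ℝ≥0∞ :=
  min 1 (m * Metric.infEDist x (testSet k)ᶜ)

theorem continuous_testFun (k : Finset (countableBasis (Eucl d)) × ℕ) (m : ℕ) :
    Continuous (testFun k m) :=
  continuous_const.min
    ((ENNReal.continuous_const_mul (ENNReal.natCast_ne_top m)).comp Metric.continuous_infEDist)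

theorem testFun_le_indicator (k : Finset (countableBasis (Eucl d)) × ℕ) (m : ℕ) (x : Eucl d) :
    testFun k m x ≤ (testSet k).indicator 1 x := by
  by_cases hx : x ∈ testSet k
  · rw [indicator_of_mem hx]; exact min_le_left _ _
  · rw [testFun, Metric.infEDist_zero_of_mem hx]; simp

theorem iSup_testFun (k : Finset (countableBasis (Eucl d)) × ℕ) (x : Eucl d) :
    ⨆ m, testFun k m x = (testSet k).indicator 1 x := by
  refine le_antisymm (iSup_le fun m => testFun_le_indicator k m x) ?_
  by_cases hx : x ∈ testSet k
  · rw [indicator_of_mem hx]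
    have hpos : Metric.infEDist x (testSet k)ᶜ ≠ 0 := by
      rw [← pos_iff_ne_zero, Metric.infEDist_pos_iff_notMem_closure,
        (isOpen_testSet k).isClosed_compl.closure_eq]
      exact fun h => h hx
    obtain ⟨m, hm⟩ := ENNReal.exists_nat_mul_gt hpos ENNReal.one_ne_top
    exact le_iSup_of_le m (le_min le_rfl hm.le)
  · rw [indicator_of_notMem hx]; exact zero_le

theorem lintegral_testFun_ne_top {ν : Measure (Eucl d)}
    (hν : ∀ n : ℕ, ν (Metric.closedBall 0 n) ≠ ∞) (k : Finset (countableBasis (Eucl d)) × ℕ)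
    (m : ℕ) : ∫⁻ x, testFun k m x ∂ν ≠ ∞ := by
  refine ((lintegral_mono (testFun_le_indicator k m)).trans_lt ?_).ne
  rw [lintegral_indicator_one (isOpen_testSet k).measurableSet]
  exact (measure_testSet_ne_top hν k).lt_top

theorem ext_of_lintegral_testFun {ν ν' : Measure (Eucl d)}
    (hν : ∀ n : ℕ, ν (Metric.closedBall 0 n) ≠ ∞)
    (h : ∀ k m, ∫⁻ x, testFun k m x ∂ν = ∫⁻ x, testFun k m x ∂ν') : ν = ν' := by
  refine ext_of_testSet hν fun k => ?_
  have hmono : Monotone (testFun k) := fun m n hmn x =>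
    min_le_min_left _ (mul_le_mul_left (Nat.cast_le.2 hmn) _)
  have key : ∀ ρ : Measure (Eucl d), ρ (testSet k) = ⨆ m, ∫⁻ x, testFun k m x ∂ρ := fun ρ => by
    rw [← lintegral_iSup (fun m => (continuous_testFun k m).measurable) hmono,
      ← lintegral_indicator_one (isOpen_testSet k).measurableSet]
    exact lintegral_congr fun x => (iSup_testFun k x).symm
  simp only [key, h]

theorem continuous_lintegral_testFun {ν : Measure (Eucl d)}
    (hν : ∀ n : ℕ, ν (Metric.closedBall 0 n) ≠ ∞) (k : Finset (countableBasis (Eucl d)) × ℕ)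
    (m : ℕ) : Continuous fun z => ∫⁻ x, testFun k m (x - z) ∂ν := by
  refine continuous_iff_continuousAt.2 fun z₀ => ?_
  obtain ⟨n, hn⟩ := exists_nat_ge (k.2 + (‖z₀‖ + 1))
  refine tendsto_lintegral_filter_of_dominated_convergence
    ((Metric.closedBall 0 n).indicator 1) (.of_forall fun z => ?_) ?_ ?_ (.of_forall fun x => ?_)
  · exact ((continuous_testFun k m).comp (by fun_prop)).measurable
  · filter_upwards [Metric.ball_mem_nhds z₀ one_pos] with z hz
    refine .of_forall fun x => (testFun_le_indicator k m _).trans ?_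
    by_cases hx : x - z ∈ testSet k
    · have h1 : ‖x - z‖ < k.2 := mem_ball_zero_iff.1 hx.1
      have h2 : ‖z - z₀‖ < 1 := mem_ball_iff_norm.1 hz
      have h3 : x ∈ Metric.closedBall (0 : Eucl d) n := by
        rw [mem_closedBall_zero_iff]
        have h4 := norm_add_le (x - z) z
        have h5 := norm_add_le (z - z₀) z₀
        rw [sub_add_cancel] at h4 h5
        linarith
      rw [indicator_of_mem hx, indicator_of_mem h3]
      rfl
    · rw [indicator_of_notMem hx]; exact zero_le
  · rw [lintegral_indicator_one Metric.isClosed_closedBall.measurableSet]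
    exact hν n
  · exact ((continuous_testFun k m).comp (by fun_prop : Continuous fun z => x - z)).tendsto z₀

end TestFunctions

section SFinite

open ProbabilityTheory
open scoped ENNReal

variable {Y E : Type*} [MeasurableSpace Y] [MeasurableSpace E]

theorem isSFiniteKernel_of_measure_univ_ne_top (K : Kernel Y E) (hK : ∀ y, K y univ ≠ ∞) :
    IsSFiniteKernel K := by
  have hm : Measurable fun y => (K y univ)⁻¹ := (K.measurable_coe .univ).inv
  let K' : Kernel Y E := ⟨fun y => (K y univ)⁻¹ • K y, Measure.measurable_of_measurable_coe _
    fun s hs => hm.mul (K.measurable_coe hs)⟩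
  have hK' : IsFiniteKernel K' :=
    ⟨1, ENNReal.one_lt_top, fun y => ENNReal.inv_mul_le_one (K y univ)⟩
  have hmass : Measurable (Function.uncurry fun (y : Y) (_ : E) => K y univ) :=
    (K.measurable_coe .univ).comp measurable_fst
  have h : K = K'.withDensity fun y _ => K y univ := by
    ext1 y
    rw [Kernel.withDensity_apply _ hmass, withDensity_const]
    change K y = K y univ • ((K y univ)⁻¹ • K y)
    rcases eq_or_ne (K y univ) 0 with h0 | h0
    · rw [Measure.measure_univ_eq_zero.1 h0]; simp
    · rw [smul_smul, ENNReal.mul_inv_cancel h0 (hK y), one_smul]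
  rw [h]
  exact Kernel.isSFiniteKernel_withDensity_of_isFiniteKernel K' fun y _ => hK y

theorem isSFiniteKernel_of_iUnion_eq_univ (K : Kernel Y E) {S : ℕ → Set E}
    (hS : ∀ n, MeasurableSet (S n)) (hcover : ⋃ n, S n = univ) (hK : ∀ y n, K y (S n) ≠ ∞) :
    IsSFiniteKernel K := by
  have hm : ∀ n, MeasurableSet (disjointed S n) := fun n => MeasurableSet.disjointed hS n
  have h : K = Kernel.sum fun n => K.restrict (hm n) := by
    ext1 y
    simp only [Kernel.sum_apply, Kernel.restrict_apply]
    rw [← Measure.restrict_iUnion (disjoint_disjointed S) hm, iUnion_disjointed, hcover,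
      Measure.restrict_univ]
  rw [h]
  refine Kernel.isSFiniteKernel_sum (hκs := fun n =>
    isSFiniteKernel_of_measure_univ_ne_top _ fun y => ?_)
  rw [Kernel.restrict_apply, Measure.restrict_apply_univ]
  exact ((measure_mono (disjointed_subset S n)).trans_lt (hK y n).lt_top).ne

theorem measurableSet_forall_singleton_eq_zero [MeasurableEq E] (K : Kernel Y E)
    [IsSFiniteKernel K] : MeasurableSet {y | ∀ e, K y {e} = 0} := by
  have h1 := measurableSet_kernel_singleton_ne_zero K
  have h2 : {y | ∀ e, K y {e} = 0} = {y | K y {e | K y {e} ≠ 0} = 0} := by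
    ext y
    refine ⟨fun h => ?_, fun h e => ?_⟩
    · have h0 : {e | K y {e} ≠ 0} = ∅ := by ext e; simpa using h e
      simp only [mem_ofPred_eq, h0, measure_empty]
    · by_contra he
      exact he (measure_mono_null (singleton_subset_iff.2 he) h)
  rw [h2]
  exact K.measurable_kernel_prodMk_left h1 (measurableSet_singleton 0)

end SFinite

section Configurations

open ProbabilityTheory TopologicalSpace
open scoped ENNReal

/-- Both measures are finite on bounded sets. -/
def LocallyFinitePair {d : ℕ} (p : Measure (Eucl d) × Measure (Eucl d)) : Prop :=
  ∀ n : ℕ, p.1 (Metric.closedBall 0 n) ≠ ∞ ∧ p.2 (Metric.closedBall 0 n) ≠ ∞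

/-- Pairs of measures that are finite on bounded sets. -/
def ConfigSpace (d : ℕ) : Type :=
  {p : Measure (Eucl d) × Measure (Eucl d) // LocallyFinitePair p}

variable {d : ℕ}

namespace ConfigSpace

instance : MeasurableSpace (ConfigSpace d) := Subtype.instMeasurableSpace

/-- The two random measures on the space of configurations. -/
def proj (i : Bool) : Kernel (ConfigSpace d) (Eucl d) where
  toFun c := cond i c.1.1 c.1.2
  measurable' := by
    cases i
    · exact measurable_snd.comp measurable_subtype_coe
    · exact measurable_fst.comp measurable_subtype_coe

theorem proj_closedBall_ne_top (i : Bool) (c : ConfigSpace d) (n : ℕ) :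
    proj i c (Metric.closedBall 0 n) ≠ ∞ := by
  cases i
  · exact (c.2 n).2
  · exact (c.2 n).1

instance (i : Bool) : IsSFiniteKernel (proj (d := d) i) :=
  isSFiniteKernel_of_iUnion_eq_univ _ (fun _ => Metric.isClosed_closedBall.measurableSet)
    (Metric.iUnion_closedBall_nat (0 : Eucl d)) fun c n => proj_closedBall_ne_top i c n

theorem ext_proj {c c' : ConfigSpace d} (h : ∀ i, proj i c = proj i c') : c = c' :=
  Subtype.ext (Prod.ext (h true) (h false))

theorem measurable_of_measurable_proj {Y : Type*} [MeasurableSpace Y] {f : Y → ConfigSpace d}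
    (h : ∀ i B, MeasurableSet B → Measurable fun y => proj i (f y) B) : Measurable f := by
  refine Measurable.subtype_mk (p := LocallyFinitePair) (f := fun y => (f y).1) ?_
  exact (Measure.measurable_of_measurable_coe _ fun B hB => h true B hB).prodMk
    (Measure.measurable_of_measurable_coe _ fun B hB => h false B hB)

theorem map_sub_closedBall_ne_top {ν : Measure (Eucl d)}
    (hν : ∀ n : ℕ, ν (Metric.closedBall 0 n) ≠ ∞) (x : Eucl d) (n : ℕ) :
    ν.map (fun y => y - x) (Metric.closedBall 0 n) ≠ ∞ := by
  rw [Measure.map_apply (by fun_prop) Metric.isClosed_closedBall.measurableSet]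
  obtain ⟨m, hm⟩ := exists_nat_ge ((n : ℝ) + ‖x‖)
  refine ((measure_mono fun y hy => ?_).trans_lt (hν m).lt_top).ne
  rw [mem_preimage, mem_closedBall_zero_iff] at hy
  rw [mem_closedBall_zero_iff]
  have := norm_add_le (y - x) x
  rw [sub_add_cancel] at this
  linarith

/-- The translation flow on the space of configurations. -/
def shift (x : Eucl d) (c : ConfigSpace d) : ConfigSpace d :=
  ⟨(c.1.1.map fun y => y - x, c.1.2.map fun y => y - x), fun n =>
    ⟨map_sub_closedBall_ne_top (fun m => (c.2 m).1) x n,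
      map_sub_closedBall_ne_top (fun m => (c.2 m).2) x n⟩⟩

theorem isEquivariant_proj (i : Bool) : IsEquivariant shift (proj (d := d) i) := by
  intro c x
  cases i <;> rfl

theorem measurable_shift : Measurable fun p : Eucl d × ConfigSpace d => shift p.1 p.2 := by
  refine measurable_of_measurable_proj fun i B hB => ?_
  have h1 : MeasurableSet {q : (Eucl d × ConfigSpace d) × Eucl d | q.2 - q.1.1 ∈ B} :=
    (by fun_prop : Measurable fun q : (Eucl d × ConfigSpace d) × Eucl d => q.2 - q.1.1) hB
  let K : Kernel (Eucl d × ConfigSpace d) (Eucl d) := (proj i).comap Prod.snd measurable_snd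
  have h2 : (fun p : Eucl d × ConfigSpace d => proj i (shift p.1 p.2) B) =
      fun p => K p (Prod.mk p ⁻¹' {q | q.2 - q.1.1 ∈ B}) := by
    ext1 p
    rw [isEquivariant_proj, Measure.map_apply (by fun_prop) hB]
    rfl
  rw [h2]
  exact K.measurable_kernel_prodMk_left h1

theorem shift_zero (c : ConfigSpace d) : shift 0 c = c :=
  ext_proj fun i => by simp [isEquivariant_proj i c 0]

theorem shift_shift (x y : Eucl d) (c : ConfigSpace d) : shift y (shift x c) = shift (x + y) c :=
  ext_proj fun i => by
    rw [isEquivariant_proj, isEquivariant_proj, isEquivariant_proj,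
      Measure.map_map (by fun_prop) (by fun_prop)]
    congr 1
    ext1 z
    simp [sub_sub]

/-- Real coordinates determining a configuration. -/
def coords (c : ConfigSpace d)
    (j : (Finset (countableBasis (Eucl d)) × ℕ) × ℕ × Bool) : ℝ :=
  (∫⁻ x, testFun j.1 j.2.1 x ∂(proj j.2.2 c)).toReal

theorem coords_injective : Function.Injective (coords (d := d)) := by
  intro c c' h
  refine ext_proj fun i => ext_of_lintegral_testFun (proj_closedBall_ne_top i c) fun k m => ?_
  exact (ENNReal.toReal_eq_toReal_iff' (lintegral_testFun_ne_top (proj_closedBall_ne_top i c) k m)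
    (lintegral_testFun_ne_top (proj_closedBall_ne_top i c') k m)).1 (congrFun h (k, m, i))

theorem measurable_coords : Measurable (coords (d := d)) :=
  measurable_pi_lambda _ fun j => ((Measure.measurable_lintegral
    (continuous_testFun j.1 j.2.1).measurable).comp (proj j.2.2).measurable).ennreal_toReal

theorem continuous_coords_shift (c : ConfigSpace d) : Continuous fun x => coords (shift x c) := by
  refine continuous_pi fun j => ?_
  have h := continuous_lintegral_testFun (proj_closedBall_ne_top j.2.2 c) j.1 j.2.1
  have h1 : (fun x => coords (shift x c) j)
      = fun x => (∫⁻ y, testFun j.1 j.2.1 (y - x) ∂(proj j.2.2 c)).toReal := by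
    ext1 x
    rw [coords, isEquivariant_proj,
      lintegral_map (continuous_testFun j.1 j.2.1).measurable (by fun_prop)]
  have h2 : ∀ x, ∫⁻ y, testFun j.1 j.2.1 (y - x) ∂(proj j.2.2 c) ≠ ∞ := fun x => by
    have h3 := lintegral_testFun_ne_top (proj_closedBall_ne_top j.2.2 (shift x c)) j.1 j.2.1
    rwa [isEquivariant_proj,
      lintegral_map (continuous_testFun j.1 j.2.1).measurable (by fun_prop)] at h3
  rw [h1]
  exact continuous_iff_continuousAt.2 fun x =>
    (ENNReal.continuousAt_toReal (h2 x)).comp (f := fun x =>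
      ∫⁻ y, testFun j.1 j.2.1 (y - x) ∂(proj j.2.2 c)) h.continuousAt

theorem exists_metricSpace : ∃ _ : MetricSpace (ConfigSpace d),
    SecondCountableTopology (ConfigSpace d) ∧ OpensMeasurableSpace (ConfigSpace d) ∧
      ∀ c : ConfigSpace d, Continuous fun x => shift x c := by
  let _ : TopologicalSpace (ConfigSpace d) := .induced coords inferInstance
  have hind : Topology.IsInducing (coords (d := d)) := ⟨rfl⟩
  have hemb : Topology.IsEmbedding (coords (d := d)) := ⟨hind, coords_injective⟩
  have hmetr : MetrizableSpace (ConfigSpace d) := hemb.metrizableSpace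
  refine ⟨metrizableSpaceMetric _, hind.secondCountableTopology, ⟨?_⟩,
    fun c => hind.continuous_iff.2 (continuous_coords_shift c)⟩
  have h := borel_comap (f := coords (d := d)) (t := inferInstance)
  exact h.trans_le ((MeasurableSpace.comap_mono BorelSpace.measurable_eq.ge).trans
    (measurable_iff_comap_le.1 measurable_coords))

end ConfigSpace

end Configurations

section Transfer

open ProbabilityTheory
open scoped ENNReal

namespace ConfigSpace

variable {d : ℕ}

open Classical in
/-- A pair of measures as a configuration, with value zero if it is not locally finite. -/
def ofPair (p : Measure (Eucl d) × Measure (Eucl d)) : ConfigSpace d :=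
  if h : LocallyFinitePair p then ⟨p, h⟩ else ⟨0, fun _ => ⟨by simp, by simp⟩⟩

theorem ofPair_of_locallyFinite {p : Measure (Eucl d) × Measure (Eucl d)}
    (hp : LocallyFinitePair p) : ofPair p = ⟨p, hp⟩ := dif_pos hp

theorem ofPair_of_not_locallyFinite {p : Measure (Eucl d) × Measure (Eucl d)}
    (hp : ¬ LocallyFinitePair p) : ofPair p = ⟨0, fun _ => ⟨by simp, by simp⟩⟩ := dif_neg hp

theorem proj_ofPair {p : Measure (Eucl d) × Measure (Eucl d)} (hp : LocallyFinitePair p)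
    (i : Bool) : proj i (ofPair p) = cond i p.1 p.2 := by
  rw [ofPair_of_locallyFinite hp]; rfl

theorem proj_ofPair_of_not {p : Measure (Eucl d) × Measure (Eucl d)} (hp : ¬ LocallyFinitePair p)
    (i : Bool) : proj i (ofPair p) = 0 := by
  rw [ofPair_of_not_locallyFinite hp]; cases i <;> rfl

theorem measurableSet_locallyFinitePair :
    MeasurableSet {p : Measure (Eucl d) × Measure (Eucl d) | LocallyFinitePair p} := by
  have h : ∀ n : ℕ, Measurable fun ν : Measure (Eucl d) => ν (Metric.closedBall 0 n) :=
    fun n => Measure.measurable_coe Metric.isClosed_closedBall.measurableSet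
  have h1 : {p : Measure (Eucl d) × Measure (Eucl d) | LocallyFinitePair p} = ⋂ n : ℕ,
      {p | p.1 (Metric.closedBall 0 n) ∈ ({∞}ᶜ : Set ℝ≥0∞)} ∩
        {p | p.2 (Metric.closedBall 0 n) ∈ ({∞}ᶜ : Set ℝ≥0∞)} := by
    ext p
    simp [LocallyFinitePair]
  rw [h1]
  exact MeasurableSet.iInter fun n =>
    (((h n).comp measurable_fst) (measurableSet_singleton ∞).compl).inter
      (((h n).comp measurable_snd) (measurableSet_singleton ∞).compl)

theorem measurable_ofPair : Measurable (ofPair (d := d)) := by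
  classical
  refine measurable_of_measurable_proj fun i B hB => ?_
  have h : (fun p => proj i (ofPair (d := d) p) B) =
      fun p => if LocallyFinitePair p then (cond i p.1 p.2) B else 0 := by
    ext1 p
    by_cases hp : LocallyFinitePair p
    · rw [if_pos hp, proj_ofPair hp]
    · rw [if_neg hp, proj_ofPair_of_not hp, Measure.coe_zero, Pi.zero_apply]
  rw [h]
  refine Measurable.ite measurableSet_locallyFinitePair ?_ measurable_const
  cases i
  · exact (Measure.measurable_coe hB).comp measurable_snd
  · exact (Measure.measurable_coe hB).comp measurable_fst

theorem ofPair_map_sub (p : Measure (Eucl d) × Measure (Eucl d)) (x : Eucl d) :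
    ofPair (p.1.map fun y => y - x, p.2.map fun y => y - x) = shift x (ofPair p) := by
  have hmap : ∀ q : Measure (Eucl d) × Measure (Eucl d), LocallyFinitePair q → ∀ z,
      LocallyFinitePair (q.1.map fun y => y - z, q.2.map fun y => y - z) := fun q hq z n =>
    ⟨map_sub_closedBall_ne_top (fun m => (hq m).1) z n,
      map_sub_closedBall_ne_top (fun m => (hq m).2) z n⟩
  by_cases hp : LocallyFinitePair p
  · rw [ofPair_of_locallyFinite (hmap p hp x), ofPair_of_locallyFinite hp]; rfl
  · have hp' : ¬ LocallyFinitePair (p.1.map fun y => y - x, p.2.map fun y => y - x) := fun h => by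
      have h1 := hmap _ h (-x)
      have h2 : ∀ ν : Measure (Eucl d), (ν.map fun y => y - x).map (fun y => y - -x) = ν :=
        fun ν => by
          rw [Measure.map_map (by fun_prop) (by fun_prop)]
          have h3 : ((fun y => y - -x) ∘ fun y : Eucl d => y - x) = id := by ext1 y; simp
          rw [h3, Measure.map_id]
      rw [h2, h2] at h1
      exact hp h1
    rw [ofPair_of_not_locallyFinite hp', ofPair_of_not_locallyFinite hp]
    exact Subtype.ext (Prod.ext (Measure.map_zero _).symm (Measure.map_zero _).symm)

end ConfigSpace

end Transfer

/-- **Theorem (main).** If `ξ` and `η` are jointly stationary ergodic equivariant random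
measures with the same finite intensity and `ξ` a.s. does not charge small sets, then
there exists a factor allocation balancing `ξ` and `η`. -/
theorem main_existence_factor_allocation
    {d : ℕ} (hd : 1 ≤ d)
    (ℙ : Measure Ω) [IsProbabilityMeasure ℙ]
    (θ : Eucl d → Ω → Ω)
    (hθmeas : Measurable fun p : Eucl d × Ω => θ p.1 p.2)
    (hθ0 : ∀ ω, θ 0 ω = ω)
    (hθadd : ∀ (x y : Eucl d) (ω : Ω), θ y (θ x ω) = θ (x + y) ω)
    (hstat : ∀ x : Eucl d, MeasurePreserving (θ x) ℙ ℙ)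
    (herg : ∀ A : Set Ω, MeasurableSet A → (∀ x : Eucl d, θ x ⁻¹' A = A) →
      ℙ A = 0 ∨ ℙ A = 1)
    (ξ η : Ω → Measure (Eucl d))
    (hξm : ∀ B : Set (Eucl d), MeasurableSet B → Measurable fun ω => ξ ω B)
    (hηm : ∀ B : Set (Eucl d), MeasurableSet B → Measurable fun ω => η ω B)
    (hξloc : ∀ᵐ ω ∂ℙ, ∀ K : Set (Eucl d), IsCompact K → ξ ω K < ⊤)
    (hηloc : ∀ᵐ ω ∂ℙ, ∀ K : Set (Eucl d), IsCompact K → η ω K < ⊤)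
    (hξeq : ∀ (ω : Ω) (x : Eucl d), ξ (θ x ω) = Measure.map (fun y => y - x) (ξ ω))
    (hηeq : ∀ (ω : Ω) (x : Eucl d), η (θ x ω) = Measure.map (fun y => y - x) (η ω))
    (hfin : ∫⁻ ω, ξ ω (unitCube d) ∂ℙ < ⊤)
    (hint : ∫⁻ ω, ξ ω (unitCube d) ∂ℙ = ∫⁻ ω, η ω (unitCube d) ∂ℙ)
    (hsmall : ∀ᵐ ω ∂ℙ, DoesNotChargeSmallSets d (ξ ω)) :
    ∃ T : Ω → Eucl d → Eucl d,
      IsFactorAllocation θ ξ η T ∧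
      ∀ᵐ ω ∂ℙ, Measure.map (T ω) (ξ ω) = η ω := by
  have hξ := Measure.measurable_of_measurable_coe ξ hξm
  have hη := Measure.measurable_of_measurable_coe η hηm
  let Φ : Ω → ConfigSpace d := fun ω => ConfigSpace.ofPair (ξ ω, η ω)
  have hΦ : Measurable Φ := ConfigSpace.measurable_ofPair.comp (hξ.prodMk hη)
  have hΦshift : ∀ ω x, Φ (θ x ω) = ConfigSpace.shift x (Φ ω) := fun ω x => by
    simp only [Φ, hξeq, hηeq]
    exact ConfigSpace.ofPair_map_sub (ξ ω, η ω) x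
  have hΦproj : ∀ᵐ ω ∂ℙ,
      ConfigSpace.proj true (Φ ω) = ξ ω ∧ ConfigSpace.proj false (Φ ω) = η ω := by
    filter_upwards [hξloc, hηloc] with ω h1 h2
    have h : LocallyFinitePair (ξ ω, η ω) := fun n =>
      ⟨(h1 _ (isCompact_closedBall _ _)).ne, (h2 _ (isCompact_closedBall _ _)).ne⟩
    exact ⟨ConfigSpace.proj_ofPair h true, ConfigSpace.proj_ofPair h false⟩
  have hprob : IsProbabilityMeasure (ℙ.map Φ) := Measure.isProbabilityMeasure_map hΦ.aemeasurable
  have hflow : IsStationaryFlow ConfigSpace.shift (ℙ.map Φ) := by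
    have hm : ∀ x : Eucl d, Measurable (ConfigSpace.shift x) := fun x =>
      ConfigSpace.measurable_shift.comp measurable_prodMk_left
    refine ⟨ConfigSpace.measurable_shift, ConfigSpace.shift_zero, ConfigSpace.shift_shift,
      fun x => ⟨hm x, ?_⟩⟩
    have h : ConfigSpace.shift x ∘ Φ = Φ ∘ θ x := funext fun ω => (hΦshift ω x).symm
    rw [Measure.map_map (hm x) hΦ, h,
      ← Measure.map_map hΦ (hstat x).measurable, (hstat x).map_eq]
  have hergodic : ∀ A, MeasurableSet A → (∀ x, ConfigSpace.shift x ⁻¹' A = A) →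
      ℙ.map Φ A = 0 ∨ ℙ.map Φ A = 1 := fun A hA hinv => by
    rw [Measure.map_apply hΦ hA]
    refine herg _ (hΦ hA) fun x => ?_
    ext ω
    rw [mem_preimage, mem_preimage, mem_preimage, hΦshift, ← mem_preimage, hinv]
  have hint_proj : ∀ i, ∫⁻ c, ConfigSpace.proj i c (unitCube d) ∂(ℙ.map Φ)
      = ∫⁻ ω, ConfigSpace.proj i (Φ ω) (unitCube d) ∂ℙ := fun i =>
    lintegral_map ((ConfigSpace.proj i).measurable_coe measurableSet_unitCube) hΦ
  have hintξ : ∫⁻ c, ConfigSpace.proj true c (unitCube d) ∂(ℙ.map Φ)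
      = ∫⁻ ω, ξ ω (unitCube d) ∂ℙ := by
    rw [hint_proj]
    exact lintegral_congr_ae (hΦproj.mono fun ω h => by simp only [h.1])
  have hintη : ∫⁻ c, ConfigSpace.proj false c (unitCube d) ∂(ℙ.map Φ)
      = ∫⁻ ω, η ω (unitCube d) ∂ℙ := by
    rw [hint_proj]
    exact lintegral_congr_ae (hΦproj.mono fun ω h => by simp only [h.2])
  have hcoset : ∀ V : Submodule ℝ (Eucl d), V ≠ ⊤ → ∀ᵐ c ∂(ℙ.map Φ), ∀ e : Vᗮ,
      ConfigSpace.proj true c {x | Vᗮ.orthogonalProjectionOnto x = e} = 0 := fun V hV => by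
    have hm : Measurable (Vᗮ.orthogonalProjectionOnto : Eucl d → Vᗮ) := by fun_prop
    have h : ∀ c e, (ConfigSpace.proj true).map (Vᗮ.orthogonalProjectionOnto : Eucl d → Vᗮ) c {e}
        = ConfigSpace.proj true c {x | Vᗮ.orthogonalProjectionOnto x = e} := fun c e =>
      ProbabilityTheory.Kernel.map_apply' _ hm _ (measurableSet_singleton e)
    have hset := measurableSet_forall_singleton_eq_zero
      ((ConfigSpace.proj true).map (Vᗮ.orthogonalProjectionOnto : Eucl d → Vᗮ))
    simp only [h] at hset
    rw [ae_map_iff hΦ.aemeasurable hset]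
    filter_upwards [hΦproj, hsmall] with ω h1 h2 e
    rw [h1.1]
    exact h2.measure_coset hV e
  obtain ⟨_, _, _, hcont⟩ := ConfigSpace.exists_metricSpace (d := d)
  obtain ⟨τ, hτ, hmap⟩ := exists_shift_map_eq hflow hergodic hcont
    (ConfigSpace.isEquivariant_proj true) (ConfigSpace.isEquivariant_proj false)
    (.of_forall fun c n => ConfigSpace.proj_closedBall_ne_top false c n)
    (hintξ.trans_lt hfin).ne (hintξ.trans (hint.trans hintη.symm)) hcoset
  have hT : ∀ {m : MeasurableSpace Ω}, Measurable ξ → Measurable η →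
      Measurable (Function.uncurry fun ω x => x + τ (ConfigSpace.shift x (Φ ω))) :=
    fun h1 h2 => measurable_snd.add (hτ.comp (ConfigSpace.measurable_shift.comp
      (measurable_snd.prodMk ((ConfigSpace.measurable_ofPair.comp (h1.prodMk h2)).comp
        measurable_fst))))
  refine ⟨fun ω x => x + τ (ConfigSpace.shift x (Φ ω)), ⟨hT hξ hη, fun ω x y => ?_, ?_⟩, ?_⟩
  · simp only [hΦshift, ConfigSpace.shift_shift, add_comm x y]
    abel
  · exact hT (m := sigmaGen ξ η) (measurable_iff_comap_le.2 le_sup_left)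
      (measurable_iff_comap_le.2 le_sup_right)
  · filter_upwards [ae_of_ae_map hΦ.aemeasurable hmap, hΦproj] with ω h1 h2
    rwa [h2.1, h2.2] at h1
end
end

section
/- Let d ≥ 1. Let μ and ν be finite Borel measures on ℝ^d with compact support such that μ(ℝ^d) ≥ ν(ℝ^d), μ does not charge small sets, and μ and ν are mutually singular. Let ϑ : [0,∞) → [0,∞) be continuous, strictly concave and strictly increasing, and set c(x,y) = ϑ(|x−y|). Then the minimization problem inf over all semicouplings q of μ and ν of ∫ c(x,y) q(dx,dy) has a unique optimizer q*, and q* = (id, T)_# (1_B · μ) for some Borel set B ⊆ ℝ^d and some Borel measurable map T : ℝ^d → ℝ^d. -/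
open MeasureTheory Filter Set

noncomputable section

/-- `q` is a semicoupling of `μ` and `ν`: its first marginal is `≤ μ` and its second
marginal equals `ν`. -/
def IsSemicoupling {d : ℕ} (μ ν : Measure (Eucl d)) (q : Measure (Eucl d × Eucl d)) :
    Prop :=
  Measure.map Prod.fst q ≤ μ ∧ Measure.map Prod.snd q = ν

/-- In the direction orthogonal to `w`, Euclidean space looks like `ℝ^(d-1)`. -/
theorem exists_orthogonal_coordinates {d : ℕ} {w : Eucl d} (hw : w ≠ 0) :
    ∃ P : Eucl d →ₗ[ℝ] Eucl (d - 1),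
      ∀ h, ‖h‖ ^ 2 = ‖P h‖ ^ 2 + (inner ℝ w h / ‖w‖) ^ 2 := by
  have hd : d ≠ 0 := by
    rintro rfl
    exact hw (Subsingleton.elim _ _)
  have : Fact (Module.finrank ℝ (Eucl d) = (d - 1) + 1) :=
    ⟨by rw [finrank_euclideanSpace_fin]; omega⟩
  let e := (OrthonormalBasis.fromOrthogonalSpanSingleton (𝕜 := ℝ) (d - 1) hw).repr
  let S : Submodule ℝ (Eucl d) := Submodule.span ℝ {w}
  refine ⟨e.toLinearEquiv.toLinearMap ∘ₗ (Sᗮ.orthogonalProjectionOnto).toLinearMap, fun h ↦ ?_⟩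
  have h1 : ‖S.orthogonalProjectionOnto h‖ ^ 2 = (inner ℝ w h / ‖w‖) ^ 2 := by
    have hw' : ‖w‖ ≠ 0 := norm_ne_zero_iff.mpr hw
    have : ‖S.starProjection h‖ = |inner ℝ w h / ‖w‖| := by
      rw [Submodule.starProjection_singleton, norm_smul, abs_div, abs_of_nonneg (norm_nonneg w),
        Real.norm_eq_abs, abs_div]
      simp only [RCLike.ofReal_real_eq_id, id_eq, abs_pow, abs_norm]
      field_simp
    rw [← sq_abs (_ / _), ← this]
    rfl
  have h2 : ‖e (Sᗮ.orthogonalProjectionOnto h)‖ = ‖Sᗮ.orthogonalProjectionOnto h‖ :=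
    e.norm_map _
  have := Submodule.norm_sq_eq_add_norm_sq_projection h S
  rw [this, h1, ← h2, add_comm]
  rfl

/-- A set satisfying a cone condition transverse to `w` is contained in a Lipschitz graph. -/
theorem measure_zero_of_cone {d : ℕ} {μ : Measure (Eucl d)} (hμ : DoesNotChargeSmallSets d μ)
    {w : Eucl d} (hw : w ≠ 0) {A : Set (Eucl d)}
    (hA : ∀ x ∈ A, ∀ y ∈ A, inner ℝ w (y - x) ≤ ‖w‖ / 2 * ‖y - x‖) : μ A = 0 := by
  obtain ⟨P, hP⟩ := exists_orthogonal_coordinates hw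
  have hw' : 0 < ‖w‖ := norm_pos_iff.mpr hw
  have hbound : ∀ x ∈ A, ∀ y ∈ A, ‖y - x‖ ≤ 2 * ‖P y - P x‖ := by
    intro x hx y hy
    have h1 : |inner ℝ w (y - x) / ‖w‖| ≤ ‖y - x‖ / 2 := by
      rw [abs_le, div_le_iff₀ hw', le_div_iff₀ hw']
      have h1 := hA x hx y hy
      have h2 := hA y hy x hx
      rw [← neg_sub y x, inner_neg_right, norm_neg] at h2
      constructor <;> linarith
    have h2 := hP (y - x)
    rw [← sq_abs (_ / _), map_sub] at h2
    have h3 : |inner ℝ w (y - x) / ‖w‖| ^ 2 ≤ (‖y - x‖ / 2) ^ 2 := by gcongr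
    refine (sq_le_sq₀ (norm_nonneg _) (by positivity)).mp ?_
    nlinarith [sq_nonneg ‖P y - P x‖]
  have hinv : ∀ x ∈ A, Function.invFunOn P A (P x) = x := by
    intro x hx
    have h1 : P x ∈ P '' A := mem_image_of_mem P hx
    have h2 := hbound _ hx _ (Function.invFunOn_mem h1)
    rw [Function.invFunOn_eq h1, sub_self, norm_zero, mul_zero] at h2
    exact sub_eq_zero.mp (norm_le_zero_iff.mp h2)
  have hlip : LipschitzOnWith 2 (Function.invFunOn P A) (P '' A) := by
    refine LipschitzOnWith.of_dist_le_mul ?_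
    rintro _ ⟨x, hx, rfl⟩ _ ⟨y, hy, rfl⟩
    rw [hinv x hx, hinv y hy, dist_eq_norm, dist_eq_norm]
    exact hbound y hy x hx
  obtain ⟨g, hg, hgA⟩ := hlip.extend_finite_dimension
  refine measure_mono_null (t := range g) (fun x hx ↦ ⟨P x, ?_⟩) (hμ g _ hg)
  rw [← hgA (mem_image_of_mem P hx), hinv x hx]

/-- The unit vector pointing from `y` to `x` scaled by `s`; the gradient at `x` of
`s * ‖x - y‖`. -/
def scaledDirection {d : ℕ} (x y : Eucl d) (s : ℝ) : Eucl d := (s * ‖x - y‖⁻¹) • (x - y)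

theorem norm_sub_le_norm_add_inner {d : ℕ} {x x' y : Eucl d} {s : ℝ} (hs : 0 ≤ s) :
    s * (‖x' - y‖ - ‖x - y‖) ≤ inner ℝ (scaledDirection x' y s) (x' - x) := by
  rcases eq_or_ne x' y with rfl | hne
  · simp only [sub_self, norm_zero, scaledDirection, smul_zero, inner_zero_left]
    nlinarith [norm_nonneg (x - x')]
  have h : 0 < ‖x' - y‖ := norm_pos_iff.mpr (sub_ne_zero.mpr hne)
  rw [scaledDirection, real_inner_smul_left, mul_assoc]
  refine mul_le_mul_of_nonneg_left ?_ hs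
  rw [inv_mul_eq_div, le_div_iff₀ h]
  have h1 : x' - x = (x' - y) - (x - y) := by abel
  rw [h1, inner_sub_right, real_inner_self_eq_norm_sq]
  nlinarith [real_inner_le_norm (x' - y) (x - y)]

/-- If at the points of a set two radial linearizations with distinct gradients cross, then the
set is negligible for every measure that does not charge small sets. -/
theorem measure_zero_of_crossing {d : ℕ} {μ : Measure (Eucl d)}
    (hμ : DoesNotChargeSmallSets d μ) {D : Set (Eucl d × (Eucl d × ℝ) × (Eucl d × ℝ))}
    (hne : ∀ m ∈ D, m.1 ≠ m.2.1.1 ∧ m.1 ≠ m.2.2.1)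
    (hs : ∀ m ∈ D, 0 ≤ m.2.1.2 ∧ 0 ≤ m.2.2.2)
    (hgrad : ∀ m ∈ D, scaledDirection m.1 m.2.1.1 m.2.1.2 ≠ scaledDirection m.1 m.2.2.1 m.2.2.2)
    (hcross : ∀ m ∈ D, ∀ m' ∈ D,
      m'.2.2.2 * (‖m'.1 - m'.2.2.1‖ - ‖m.1 - m'.2.2.1‖) ≤
        m.2.1.2 * (‖m'.1 - m.2.1.1‖ - ‖m.1 - m.2.1.1‖)) :
    μ (Prod.fst '' D) = 0 := by
  have hloc : ∀ m ∈ D, ∃ U ∈ nhds m, μ (Prod.fst '' (U ∩ D)) = 0 := by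
    intro m hm
    let F : (Eucl d × (Eucl d × ℝ) × (Eucl d × ℝ)) × (Eucl d × (Eucl d × ℝ) × (Eucl d × ℝ)) →
      Eucl d := fun p ↦ scaledDirection p.1.1 p.2.2.2.1 p.2.2.2.2 -
        scaledDirection p.2.1 p.1.2.1.1 p.1.2.1.2
    obtain ⟨hn1, hn2⟩ := hne m hm
    have hF : ContinuousAt F (m, m) := by
      have h1 : ‖m.1 - m.2.1.1‖ ≠ 0 := norm_ne_zero_iff.mpr (sub_ne_zero.mpr hn1)
      have h2 : ‖m.1 - m.2.2.1‖ ≠ 0 := norm_ne_zero_iff.mpr (sub_ne_zero.mpr hn2)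
      simp only [F, scaledDirection]
      fun_prop (disch := assumption)
    have hw : F (m, m) ≠ 0 := sub_ne_zero.mpr (hgrad m hm).symm
    have hε : 0 < ‖F (m, m)‖ / 2 := half_pos (norm_pos_iff.mpr hw)
    have hev := hF (Metric.ball_mem_nhds _ hε)
    rw [mem_map, nhds_prod_eq, mem_prod_same_iff] at hev
    obtain ⟨U, hU, hUF⟩ := hev
    refine ⟨U, hU, measure_zero_of_cone hμ hw ?_⟩
    rintro _ ⟨a, ⟨haU, haD⟩, rfl⟩ _ ⟨b, ⟨hbU, hbD⟩, rfl⟩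
    have h1 : ‖F (a, b) - F (m, m)‖ < ‖F (m, m)‖ / 2 := by
      simpa [dist_eq_norm] using hUF (mk_mem_prod haU hbU)
    have h2 : inner ℝ (F (a, b)) (b.1 - a.1) ≤ 0 := by
      have h3 := norm_sub_le_norm_add_inner (x := a.1) (x' := b.1) (y := a.2.1.1) (hs a haD).1
      have h4 := norm_sub_le_norm_add_inner (x := b.1) (x' := a.1) (y := b.2.2.1) (hs b hbD).2
      have h5 := hcross a haD b hbD
      rw [← neg_sub b.1 a.1, inner_neg_right] at h4
      simp only [F, inner_sub_left]
      linarith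
    have h6 := real_inner_le_norm (F (m, m) - F (a, b)) (b.1 - a.1)
    rw [inner_sub_left, norm_sub_rev] at h6
    have h7 := mul_le_mul_of_nonneg_right h1.le (norm_nonneg (b.1 - a.1))
    linarith
  choose! U hU hU0 using hloc
  obtain ⟨t, htD, htc, hcov⟩ := TopologicalSpace.countable_cover_nhdsWithin
    fun m hm ↦ mem_nhdsWithin_of_mem_nhds (t := D) (hU m hm)
  refine measure_mono_null (t := ⋃ m ∈ t, Prod.fst '' (U m ∩ D)) ?_
    ((measure_biUnion_null_iff htc).mpr fun m hm ↦ hU0 m (htD hm))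
  rintro _ ⟨m, hm, rfl⟩
  obtain ⟨i, hi, hmi⟩ := mem_iUnion₂.mp (hcov hm)
  exact mem_iUnion₂.mpr ⟨i, hi, m, ⟨hmi, hm⟩, rfl⟩

/-- `s` is the slope of a line through `(r, ϑ r)` lying above the graph of `ϑ` on `[0, ∞)`. -/
def IsSupergradientAt (ϑ : ℝ → ℝ) (r s : ℝ) : Prop := ∀ t, 0 ≤ t → ϑ t ≤ ϑ r + s * (t - r)

theorem exists_isSupergradientAt {ϑ : ℝ → ℝ} (hϑ : ConcaveOn ℝ (Ici 0) ϑ) {r : ℝ} (hr : 0 < r) :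
    ∃ s, IsSupergradientAt ϑ r s := by
  have hri : r ∈ interior (Ici (0 : ℝ)) := by rwa [interior_Ici]
  have hg : ConvexOn ℝ (Ici 0) (-ϑ) := hϑ.neg
  refine ⟨-derivWithin (-ϑ) (Ioi r) r, fun t ht ↦ ?_⟩
  rcases lt_trichotomy t r with h | rfl | h
  · have h1 := hg.leftDeriv_le_rightDeriv_of_mem_interior hri
    have h2 := hg.slope_le_leftDeriv_of_mem_interior ht hri h
    rw [slope_def_field, div_le_iff₀ (sub_pos.mpr h)] at h2
    simp only [Pi.neg_apply] at h2
    nlinarith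
  · simp
  · have h2 := hg.rightDeriv_le_slope_of_mem_interior hri ht h
    rw [slope_def_field, le_div_iff₀ (sub_pos.mpr h)] at h2
    simp only [Pi.neg_apply] at h2
    linarith

theorem IsSupergradientAt.pos {ϑ : ℝ → ℝ} (hϑ : StrictMonoOn ϑ (Ici 0)) {r s : ℝ} (hr : 0 ≤ r)
    (h : IsSupergradientAt ϑ r s) : 0 < s := by
  have h1 : ϑ r < ϑ (r + 1) := hϑ hr (mem_Ici.mpr (by linarith)) (by linarith)
  have h2 := h (r + 1) (by linarith)
  linarith

theorem IsSupergradientAt.eq_of_eq {ϑ : ℝ → ℝ} (hϑ : StrictConcaveOn ℝ (Ici 0) ϑ) {r r' s : ℝ}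
    (hr : 0 ≤ r) (hr' : 0 ≤ r') (h : IsSupergradientAt ϑ r s) (h' : IsSupergradientAt ϑ r' s) :
    r = r' := by
  by_contra hne
  have h1 := hϑ.2 hr hr' hne one_half_pos one_half_pos (add_halves 1)
  simp only [smul_eq_mul] at h1
  have h2 := h r' hr'
  have h3 := h' r hr
  have h4 := h (1 / 2 * r + 1 / 2 * r') (by positivity)
  linarith

theorem norm_scaledDirection {d : ℕ} {x y : Eucl d} {s : ℝ} (hxy : x ≠ y) (hs : 0 ≤ s) :
    ‖scaledDirection x y s‖ = s := by
  have h : ‖x - y‖ ≠ 0 := norm_ne_zero_iff.mpr (sub_ne_zero.mpr hxy)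
  rw [scaledDirection, norm_smul, norm_mul, norm_inv, norm_norm, Real.norm_of_nonneg hs, mul_assoc,
    inv_mul_cancel₀ h, mul_one]

theorem scaledDirection_injective {d : ℕ} {ϑ : ℝ → ℝ} (hconc : StrictConcaveOn ℝ (Ici 0) ϑ)
    (hmono : StrictMonoOn ϑ (Ici 0)) {x y z : Eucl d} {s t : ℝ} (hxy : x ≠ y) (hxz : x ≠ z)
    (hs : IsSupergradientAt ϑ ‖x - y‖ s) (ht : IsSupergradientAt ϑ ‖x - z‖ t)
    (h : scaledDirection x y s = scaledDirection x z t) : y = z := by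
  have hs0 := hs.pos hmono (norm_nonneg _)
  have ht0 := ht.pos hmono (norm_nonneg _)
  have hst : s = t := by
    rw [← norm_scaledDirection hxy hs0.le, h, norm_scaledDirection hxz ht0.le]
  subst hst
  have hr := hs.eq_of_eq hconc (norm_nonneg _) (norm_nonneg _) ht
  rw [scaledDirection, scaledDirection, ← hr] at h
  have h0 : 0 < ‖x - y‖ := norm_pos_iff.mpr (sub_ne_zero.mpr hxy)
  have := smul_right_injective (Eucl d) (by positivity : s * ‖x - y‖⁻¹ ≠ 0) h
  exact sub_right_injective this
/-- `q` minimizes `∫ c dq` among all semicouplings of `μ` and `ν`. -/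
def IsOptimalSemicoupling {d : ℕ} (c : Eucl d × Eucl d → ℝ) (μ ν : Measure (Eucl d))
    (q : Measure (Eucl d × Eucl d)) : Prop :=
  IsSemicoupling μ ν q ∧ ∀ q', IsSemicoupling μ ν q' →
    ∫⁻ p, ENNReal.ofReal (c p) ∂q ≤ ∫⁻ p, ENNReal.ofReal (c p) ∂q'

theorem IsSemicoupling.measure_univ {d : ℕ} {μ ν : Measure (Eucl d)}
    {q : Measure (Eucl d × Eucl d)} (hq : IsSemicoupling μ ν q) : q univ = ν univ := by
  rw [← hq.2, Measure.map_apply measurable_snd .univ, preimage_univ]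

theorem IsSemicoupling.isFiniteMeasure {d : ℕ} {μ ν : Measure (Eucl d)} [IsFiniteMeasure ν]
    {q : Measure (Eucl d × Eucl d)} (hq : IsSemicoupling μ ν q) : IsFiniteMeasure q :=
  ⟨hq.measure_univ ▸ measure_lt_top ν univ⟩

/-- Replacing a part `α` of an optimal semicoupling by an admissible `β` does not decrease the
cost. -/
theorem IsOptimalSemicoupling.lintegral_le_of_exchange {d : ℕ} {c : Eucl d × Eucl d → ℝ}
    {μ ν ρ : Measure (Eucl d)} {q α β : Measure (Eucl d × Eucl d)}
    (hq : IsOptimalSemicoupling c μ ν q) (hfin : ∫⁻ p, ENNReal.ofReal (c p) ∂q ≠ ⊤)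
    [IsFiniteMeasure α] (hρ : q.map Prod.fst + ρ = μ) (hα : α ≤ q)
    (hfst : β.map Prod.fst ≤ α.map Prod.fst + ρ) (hsnd : β.map Prod.snd = α.map Prod.snd) :
    ∫⁻ p, ENNReal.ofReal (c p) ∂α ≤ ∫⁻ p, ENNReal.ofReal (c p) ∂β := by
  have hr : q - α + α = q := Measure.sub_add_cancel_of_le hα
  have hsemi : IsSemicoupling μ ν (q - α + β) := by
    constructor
    · rw [Measure.map_add _ _ measurable_fst]
      calc (q - α).map Prod.fst + β.map Prod.fst
          ≤ (q - α).map Prod.fst + (α.map Prod.fst + ρ) := by gcongr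
        _ = μ := by rw [← add_assoc, ← Measure.map_add _ _ measurable_fst, hr, hρ]
    · rw [Measure.map_add _ _ measurable_snd, hsnd, ← Measure.map_add _ _ measurable_snd, hr]
      exact hq.1.2
  have h := hq.2 _ hsemi
  have hr' : ∫⁻ p, ENNReal.ofReal (c p) ∂(q - α) ≠ ⊤ :=
    ne_top_of_le_ne_top hfin (lintegral_mono' Measure.sub_le le_rfl)
  rw [← hr, lintegral_add_measure, Measure.sub_add_cancel_of_le hα, lintegral_add_measure] at h
  exact (ENNReal.add_le_add_iff_left hr').mp h

theorem lintegral_ofReal_le_of_ae_le {X : Type*} [MeasurableSpace X] {m : Measure X} {f : X → ℝ}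
    {b : ℝ} (h : ∀ᵐ p ∂m, f p ≤ b) :
    ∫⁻ p, ENNReal.ofReal (f p) ∂m ≤ ENNReal.ofReal b * m univ := by
  rw [← lintegral_const]
  exact lintegral_mono_ae (h.mono fun p hp ↦ ENNReal.ofReal_le_ofReal hp)

theorem le_lintegral_ofReal_of_ae_le {X : Type*} [MeasurableSpace X] {m : Measure X} {f : X → ℝ}
    {a : ℝ} (h : ∀ᵐ p ∂m, a ≤ f p) :
    ENNReal.ofReal a * m univ ≤ ∫⁻ p, ENNReal.ofReal (f p) ∂m := by
  rw [← lintegral_const]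
  exact lintegral_mono_ae (h.mono fun p hp ↦ ENNReal.ofReal_le_ofReal hp)

theorem ae_map_fst_restrict_prod {X Y : Type*} [MeasurableSpace X] [MeasurableSpace Y]
    (q : Measure (X × Y)) {U : Set X} {V : Set Y} (hU : MeasurableSet U) (hV : MeasurableSet V) :
    ∀ᵐ x ∂(q.restrict (U ×ˢ V)).map Prod.fst, x ∈ U := by
  refine (ae_map_iff (p := fun x ↦ x ∈ U) measurable_fst.aemeasurable hU).mpr ?_
  exact (ae_restrict_mem (hU.prod hV)).mono fun p hp ↦ hp.1

theorem ae_map_snd_restrict_prod {X Y : Type*} [MeasurableSpace X] [MeasurableSpace Y]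
    (q : Measure (X × Y)) {U : Set X} {V : Set Y} (hU : MeasurableSet U) (hV : MeasurableSet V) :
    ∀ᵐ y ∂(q.restrict (U ×ˢ V)).map Prod.snd, y ∈ V := by
  refine (ae_map_iff (p := fun y ↦ y ∈ V) measurable_snd.aemeasurable hV).mpr ?_
  exact (ae_restrict_mem (hU.prod hV)).mono fun p hp ↦ hp.2

theorem ae_prod_mem_prod {X Y : Type*} [MeasurableSpace X] [MeasurableSpace Y]
    {m : Measure X} {n : Measure Y} [SFinite n] {U : Set X} {V : Set Y}
    (hm : ∀ᵐ x ∂m, x ∈ U) (hn : ∀ᵐ y ∂n, y ∈ V) : ∀ᵐ p ∂m.prod n, p ∈ U ×ˢ V := by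
  filter_upwards [Measure.quasiMeasurePreserving_fst.ae hm,
    Measure.quasiMeasurePreserving_snd.ae hn] with p h1 h2 using ⟨h1, h2⟩

theorem exists_ball_abs_sub_lt {X Y : Type*} [PseudoMetricSpace X] [PseudoMetricSpace Y]
    {c : X × Y → ℝ} (hc : Continuous c) (x : X) (y : Y) {ε : ℝ} (hε : 0 < ε) :
    ∃ δ > 0, ∀ a b, dist a x < δ → dist b y < δ → |c (a, b) - c (x, y)| < ε := by
  obtain ⟨δ, hδ, h⟩ := Metric.continuous_iff.mp hc (x, y) ε hε
  exact ⟨δ, hδ, fun a b ha hb ↦ h (a, b) (max_lt ha hb)⟩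

/-- The support of an optimal semicoupling is monotone for the cost `c`. -/
theorem IsOptimalSemicoupling.add_le_add_of_mem_support {d : ℕ} {c : Eucl d × Eucl d → ℝ}
    (hc : Continuous c) {μ ν : Measure (Eucl d)} [IsFiniteMeasure μ]
    {q : Measure (Eucl d × Eucl d)} [IsFiniteMeasure q]
    (hq : IsOptimalSemicoupling c μ ν q) (hfin : ∫⁻ p, ENNReal.ofReal (c p) ∂q ≠ ⊤)
    (hc0 : ∀ p, 0 ≤ c p) {x y x' y' : Eucl d} (h : (x, y) ∈ q.support)
    (h' : (x', y') ∈ q.support) : c (x, y) + c (x', y') ≤ c (x, y') + c (x', y) := by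
  refine le_of_forall_pos_le_add fun η hη ↦ ?_
  obtain ⟨ε, hε, rfl⟩ : ∃ ε > 0, 4 * ε = η := ⟨η / 4, by positivity, by ring⟩
  obtain ⟨δ₁, hδ₁, hb₁⟩ := exists_ball_abs_sub_lt hc x y hε
  obtain ⟨δ₂, hδ₂, hb₂⟩ := exists_ball_abs_sub_lt hc x' y' hε
  obtain ⟨δ₃, hδ₃, hb₃⟩ := exists_ball_abs_sub_lt hc x y' hε
  obtain ⟨δ₄, hδ₄, hb₄⟩ := exists_ball_abs_sub_lt hc x' y hε
  obtain ⟨δ, hδ, hlt⟩ : ∃ δ > 0, δ ≤ δ₁ ∧ δ ≤ δ₂ ∧ δ ≤ δ₃ ∧ δ ≤ δ₄ :=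
    ⟨min (min δ₁ δ₂) (min δ₃ δ₄), by positivity, by simp, by simp, by simp, by simp⟩
  have hball : ∀ z : Eucl d, MeasurableSet (Metric.ball z δ) := fun z ↦ measurableSet_ball
  set q₁ := q.restrict (Metric.ball x δ ×ˢ Metric.ball y δ) with hq₁
  set q₂ := q.restrict (Metric.ball x' δ ×ˢ Metric.ball y' δ) with hq₂
  have hm₁ : q₁ univ ≠ 0 := by
    rw [hq₁, Measure.restrict_apply_univ]
    exact ((Measure.mem_support_iff_forall _).mp h _
      (prod_mem_nhds (Metric.ball_mem_nhds _ hδ) (Metric.ball_mem_nhds _ hδ))).ne'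
  have hm₂ : q₂ univ ≠ 0 := by
    rw [hq₂, Measure.restrict_apply_univ]
    exact ((Measure.mem_support_iff_forall _).mp h' _
      (prod_mem_nhds (Metric.ball_mem_nhds _ hδ) (Metric.ball_mem_nhds _ hδ))).ne'
  have hf₁ : q₁ univ ≠ ⊤ := measure_ne_top _ _
  have hf₂ : q₂ univ ≠ ⊤ := measure_ne_top _ _
  set k := (q₁ univ + q₂ univ)⁻¹ with hk
  have hk0 : k ≠ 0 := ENNReal.inv_ne_zero.mpr (ENNReal.add_ne_top.mpr ⟨hf₁, hf₂⟩)
  have hktop : k ≠ ⊤ := ENNReal.inv_ne_top.mpr (by simp [hm₁])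
  have hk1 : k * (q₂ univ + q₁ univ) = 1 := by
    rw [add_comm, hk]
    exact ENNReal.inv_mul_cancel (by simp [hm₁]) (ENNReal.add_ne_top.mpr ⟨hf₁, hf₂⟩)
  set α := k • (q₂ univ • q₁ + q₁ univ • q₂) with hα
  set β := k • ((q₁.map Prod.fst).prod (q₂.map Prod.snd) +
    (q₂.map Prod.fst).prod (q₁.map Prod.snd)) with hβ
  have hαq : α ≤ q := by
    calc α ≤ k • (q₂ univ • q + q₁ univ • q) := by
          rw [hα]
          gcongr <;> exact Measure.restrict_le_self
      _ = q := by rw [← add_smul, smul_smul, hk1, one_smul]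
  have : IsFiniteMeasure α := isFiniteMeasure_of_le q hαq
  have hu₁ : q₁.map Prod.fst univ = q₁ univ := by
    rw [Measure.map_apply measurable_fst .univ, preimage_univ]
  have hu₂ : q₂.map Prod.fst univ = q₂ univ := by
    rw [Measure.map_apply measurable_fst .univ, preimage_univ]
  have hv₁ : q₁.map Prod.snd univ = q₁ univ := by
    rw [Measure.map_apply measurable_snd .univ, preimage_univ]
  have hv₂ : q₂.map Prod.snd univ = q₂ univ := by
    rw [Measure.map_apply measurable_snd .univ, preimage_univ]
  have hfst : β.map Prod.fst = α.map Prod.fst := by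
    simp only [hα, hβ, Measure.map_smul, Measure.map_add _ _ measurable_fst,
      Measure.map_fst_prod, hv₁, hv₂]
  have hsnd : β.map Prod.snd = α.map Prod.snd := by
    simp only [hα, hβ, Measure.map_smul, Measure.map_add _ _ measurable_snd,
      Measure.map_snd_prod, hu₁, hu₂]
    rw [add_comm]
  have hle := hq.lintegral_le_of_exchange hfin (ρ := μ - q.map Prod.fst) (α := α) (β := β)
    (by rw [add_comm]; exact Measure.sub_add_cancel_of_le hq.1.1) hαq
    (hfst.trans_le (Measure.le_add_right le_rfl)) hsnd
  simp only [hα, hβ, lintegral_smul_measure, lintegral_add_measure, smul_eq_mul] at hle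
  rw [ENNReal.mul_le_mul_iff_right hk0 hktop] at hle
  have hA₁ := le_lintegral_ofReal_of_ae_le (m := q₁) (f := c) (a := c (x, y) - ε) <|
    (ae_restrict_mem ((hball x).prod (hball y))).mono fun p hp ↦ by
      have := hb₁ p.1 p.2 (hp.1.trans_le hlt.1) (hp.2.trans_le hlt.1)
      linarith [(abs_lt.mp this).1]
  have hA₂ := le_lintegral_ofReal_of_ae_le (m := q₂) (f := c) (a := c (x', y') - ε) <|
    (ae_restrict_mem ((hball x').prod (hball y'))).mono fun p hp ↦ by
      have := hb₂ p.1 p.2 (hp.1.trans_le hlt.2.1) (hp.2.trans_le hlt.2.1)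
      linarith [(abs_lt.mp this).1]
  have hB₁ := lintegral_ofReal_le_of_ae_le (f := c) (b := c (x, y') + ε) <|
    (ae_prod_mem_prod (ae_map_fst_restrict_prod q (hball x) (hball y))
      (ae_map_snd_restrict_prod q (hball x') (hball y'))).mono fun p hp ↦ by
      have := hb₃ p.1 p.2 (hp.1.trans_le hlt.2.2.1) (hp.2.trans_le hlt.2.2.1)
      linarith [(abs_lt.mp this).2]
  have hB₂ := lintegral_ofReal_le_of_ae_le (f := c) (b := c (x', y) + ε) <|
    (ae_prod_mem_prod (ae_map_fst_restrict_prod q (hball x') (hball y'))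
      (ae_map_snd_restrict_prod q (hball x) (hball y))).mono fun p hp ↦ by
      have := hb₄ p.1 p.2 (hp.1.trans_le hlt.2.2.2) (hp.2.trans_le hlt.2.2.2)
      linarith [(abs_lt.mp this).2]
  rw [← univ_prod_univ, Measure.prod_prod, hu₁, hv₂] at hB₁
  rw [← univ_prod_univ, Measure.prod_prod, hu₂, hv₁] at hB₂
  have key : (q₁ univ * q₂ univ) * ENNReal.ofReal (c (x, y) + c (x', y') - 2 * ε) ≤
      (q₁ univ * q₂ univ) * ENNReal.ofReal (c (x, y') + c (x', y) + 2 * ε) := by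
    calc (q₁ univ * q₂ univ) * ENNReal.ofReal (c (x, y) + c (x', y') - 2 * ε)
        ≤ (q₁ univ * q₂ univ) *
          (ENNReal.ofReal (c (x, y) - ε) + ENNReal.ofReal (c (x', y') - ε)) := by
          gcongr
          refine le_trans (le_of_eq ?_) ENNReal.ofReal_add_le
          ring_nf
      _ = q₂ univ * (ENNReal.ofReal (c (x, y) - ε) * q₁ univ) +
          q₁ univ * (ENNReal.ofReal (c (x', y') - ε) * q₂ univ) := by ring
      _ ≤ _ := add_le_add (mul_le_mul_right hA₁ _) (mul_le_mul_right hA₂ _)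
      _ ≤ _ := hle
      _ ≤ _ := add_le_add hB₁ hB₂
      _ = (q₁ univ * q₂ univ) *
          (ENNReal.ofReal (c (x, y') + ε) + ENNReal.ofReal (c (x', y) + ε)) := by ring
      _ = _ := by
          rw [← ENNReal.ofReal_add (by linarith [hc0 (x, y')]) (by linarith [hc0 (x', y)])]
          ring_nf
  rw [ENNReal.mul_le_mul_iff_right (mul_ne_zero hm₁ hm₂) (ENNReal.mul_ne_top hf₁ hf₂),
    ENNReal.ofReal_le_ofReal_iff (by linarith [hc0 (x, y'), hc0 (x', y)])] at key
  linarith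

/-- The unused part of `μ` cannot be transported more cheaply than an optimal semicoupling. -/
theorem IsOptimalSemicoupling.le_of_mem_support_of_mem_support {d : ℕ} {c : Eucl d × Eucl d → ℝ}
    (hc : Continuous c) {μ ν : Measure (Eucl d)} [IsFiniteMeasure μ]
    {q : Measure (Eucl d × Eucl d)} [IsFiniteMeasure q]
    (hq : IsOptimalSemicoupling c μ ν q) (hfin : ∫⁻ p, ENNReal.ofReal (c p) ∂q ≠ ⊤)
    (hc0 : ∀ p, 0 ≤ c p) {x y x' : Eucl d} (h : (x, y) ∈ q.support)
    (h' : x' ∈ (μ - q.map Prod.fst).support) : c (x, y) ≤ c (x', y) := by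
  refine le_of_forall_pos_le_add fun η hη ↦ ?_
  obtain ⟨ε, hε, rfl⟩ : ∃ ε > 0, 2 * ε = η := ⟨η / 2, by positivity, by ring⟩
  obtain ⟨δ₁, hδ₁, hb₁⟩ := exists_ball_abs_sub_lt hc x y hε
  obtain ⟨δ₂, hδ₂, hb₂⟩ := exists_ball_abs_sub_lt hc x' y hε
  obtain ⟨δ, hδ, hlt⟩ : ∃ δ > 0, δ ≤ δ₁ ∧ δ ≤ δ₂ := ⟨min δ₁ δ₂, by positivity, by simp, by simp⟩
  have hball : ∀ z : Eucl d, MeasurableSet (Metric.ball z δ) := fun z ↦ measurableSet_ball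
  set ρ := μ - q.map Prod.fst with hρ
  have : IsFiniteMeasure ρ := isFiniteMeasure_of_le μ Measure.sub_le
  set q₁ := q.restrict (Metric.ball x δ ×ˢ Metric.ball y δ) with hq₁
  set ρ₁ := ρ.restrict (Metric.ball x' δ) with hρ₁
  have hm₁ : q₁ univ ≠ 0 := by
    rw [hq₁, Measure.restrict_apply_univ]
    exact ((Measure.mem_support_iff_forall _).mp h _
      (prod_mem_nhds (Metric.ball_mem_nhds _ hδ) (Metric.ball_mem_nhds _ hδ))).ne'
  have hm₂ : ρ₁ univ ≠ 0 := by
    rw [hρ₁, Measure.restrict_apply_univ]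
    exact ((Measure.mem_support_iff_forall _).mp h' _ (Metric.ball_mem_nhds _ hδ)).ne'
  have hf₁ : q₁ univ ≠ ⊤ := measure_ne_top _ _
  have hf₂ : ρ₁ univ ≠ ⊤ := measure_ne_top _ _
  set k := (q₁ univ + ρ₁ univ)⁻¹ with hk
  have hk0 : k ≠ 0 := ENNReal.inv_ne_zero.mpr (ENNReal.add_ne_top.mpr ⟨hf₁, hf₂⟩)
  have hktop : k ≠ ⊤ := ENNReal.inv_ne_top.mpr (by simp [hm₁])
  have hk1 : k * (q₁ univ + ρ₁ univ) = 1 :=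
    ENNReal.inv_mul_cancel (by simp [hm₁]) (ENNReal.add_ne_top.mpr ⟨hf₁, hf₂⟩)
  have hkq : k * q₁ univ ≤ 1 := (mul_le_mul_right le_self_add k).trans_eq hk1
  have hkρ : k * ρ₁ univ ≤ 1 := (mul_le_mul_right le_add_self k).trans_eq hk1
  set α := k • ρ₁ univ • q₁ with hα
  set β := k • ρ₁.prod (q₁.map Prod.snd) with hβ
  have hαq : α ≤ q := by
    calc α ≤ (1 : ENNReal) • q := by
          rw [hα, smul_smul]
          gcongr
          exact Measure.restrict_le_self
      _ = q := one_smul _ _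
  have : IsFiniteMeasure α := isFiniteMeasure_of_le q hαq
  have hv₁ : q₁.map Prod.snd univ = q₁ univ := by
    rw [Measure.map_apply measurable_snd .univ, preimage_univ]
  have hfst : β.map Prod.fst ≤ ρ := by
    calc β.map Prod.fst = (k * q₁ univ) • ρ₁ := by
          rw [hβ, Measure.map_smul, Measure.map_fst_prod, hv₁, smul_smul]
      _ ≤ (1 : ENNReal) • ρ := by
          gcongr
          exact Measure.restrict_le_self
      _ = ρ := one_smul _ _
  have hsnd : β.map Prod.snd = α.map Prod.snd := by
    simp only [hα, hβ, Measure.map_smul, Measure.map_snd_prod]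
  have hle := hq.lintegral_le_of_exchange hfin (ρ := ρ) (α := α) (β := β)
    (by rw [add_comm]; exact Measure.sub_add_cancel_of_le hq.1.1) hαq
    (hfst.trans (Measure.le_add_left le_rfl)) hsnd
  simp only [hα, hβ, lintegral_smul_measure, smul_eq_mul] at hle
  rw [ENNReal.mul_le_mul_iff_right hk0 hktop] at hle
  have hA := le_lintegral_ofReal_of_ae_le (m := q₁) (f := c) (a := c (x, y) - ε) <|
    (ae_restrict_mem ((hball x).prod (hball y))).mono fun p hp ↦ by
      have := hb₁ p.1 p.2 (hp.1.trans_le hlt.1) (hp.2.trans_le hlt.1)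
      linarith [(abs_lt.mp this).1]
  have hB := lintegral_ofReal_le_of_ae_le (f := c) (b := c (x', y) + ε) <|
    (ae_prod_mem_prod (ae_restrict_mem (μ := ρ) (hball x'))
      (ae_map_snd_restrict_prod q (hball x) (hball y))).mono fun p hp ↦ by
      have := hb₂ p.1 p.2 (hp.1.trans_le hlt.2) (hp.2.trans_le hlt.2)
      linarith [(abs_lt.mp this).2]
  rw [← univ_prod_univ, Measure.prod_prod, hv₁] at hB
  have key : (ρ₁ univ * q₁ univ) * ENNReal.ofReal (c (x, y) - ε) ≤
      (ρ₁ univ * q₁ univ) * ENNReal.ofReal (c (x', y) + ε) := by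
    calc (ρ₁ univ * q₁ univ) * ENNReal.ofReal (c (x, y) - ε)
        = ρ₁ univ * (ENNReal.ofReal (c (x, y) - ε) * q₁ univ) := by ring
      _ ≤ _ := mul_le_mul_right hA _
      _ ≤ _ := hle
      _ ≤ _ := hB
      _ = _ := mul_comm _ _
  rw [ENNReal.mul_le_mul_iff_right (mul_ne_zero hm₂ hm₁) (ENNReal.mul_ne_top hf₂ hf₁),
    ENNReal.ofReal_le_ofReal_iff (by linarith [hc0 (x', y)])] at key
  linarith
theorem IsSemicoupling.ae_mem_prod {d : ℕ} {μ ν : Measure (Eucl d)}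
    {q : Measure (Eucl d × Eucl d)} (hq : IsSemicoupling μ ν q) {K L : Set (Eucl d)}
    (hKm : MeasurableSet K) (hLm : MeasurableSet L) (hK : μ Kᶜ = 0) (hL : ν Lᶜ = 0) :
    ∀ᵐ p ∂q, p ∈ K ×ˢ L := by
  have h1 : ∀ᵐ p ∂q, p.1 ∈ K := by
    refine (ae_map_iff (p := fun x ↦ x ∈ K) measurable_fst.aemeasurable hKm).mp ?_
    exact Measure.absolutelyContinuous_of_le hq.1 hK
  have h2 : ∀ᵐ p ∂q, p.2 ∈ L := by
    refine (ae_map_iff (p := fun y ↦ y ∈ L) measurable_snd.aemeasurable hLm).mp ?_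
    rw [hq.2]
    exact hL
  filter_upwards [h1, h2] with p hp1 hp2 using ⟨hp1, hp2⟩

section Radial

variable {d : ℕ} {μ : Measure (Eucl d)} {ϑ : ℝ → ℝ} {Γ : Set (Eucl d × Eucl d)}

/-- A set monotone for the cost `ϑ(|x-y|)` and disjoint from the diagonal has at most one point
above `μ`-almost every `x`. -/
theorem measure_zero_of_monotone_set (hsmall : DoesNotChargeSmallSets d μ)
    (hconc : StrictConcaveOn ℝ (Ici 0) ϑ) (hmono : StrictMonoOn ϑ (Ici 0))
    (hdiag : ∀ p ∈ Γ, p.1 ≠ p.2)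
    (hΓ : ∀ p ∈ Γ, ∀ p' ∈ Γ, ϑ ‖p.1 - p.2‖ + ϑ ‖p'.1 - p'.2‖ ≤
      ϑ ‖p.1 - p'.2‖ + ϑ ‖p'.1 - p.2‖) :
    μ {x | ∃ y z, (x, y) ∈ Γ ∧ (x, z) ∈ Γ ∧ y ≠ z} = 0 := by
  let D : Set (Eucl d × (Eucl d × ℝ) × (Eucl d × ℝ)) :=
    {m | (m.1, m.2.1.1) ∈ Γ ∧ (m.1, m.2.2.1) ∈ Γ ∧ m.2.1.1 ≠ m.2.2.1 ∧
      IsSupergradientAt ϑ ‖m.1 - m.2.1.1‖ m.2.1.2 ∧ IsSupergradientAt ϑ ‖m.1 - m.2.2.1‖ m.2.2.2}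
  refine measure_mono_null (t := Prod.fst '' D) ?_ (measure_zero_of_crossing hsmall ?_ ?_ ?_ ?_)
  · rintro x ⟨y, z, hy, hz, hyz⟩
    obtain ⟨s, hs⟩ := exists_isSupergradientAt hconc.concaveOn
      (norm_pos_iff.mpr (sub_ne_zero.mpr (hdiag _ hy)))
    obtain ⟨t, ht⟩ := exists_isSupergradientAt hconc.concaveOn
      (norm_pos_iff.mpr (sub_ne_zero.mpr (hdiag _ hz)))
    exact ⟨(x, (y, s), (z, t)), ⟨hy, hz, hyz, hs, ht⟩, rfl⟩
  · exact fun m hm ↦ ⟨hdiag _ hm.1, hdiag _ hm.2.1⟩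
  · exact fun m hm ↦ ⟨(hm.2.2.2.1.pos hmono (norm_nonneg _)).le,
      (hm.2.2.2.2.pos hmono (norm_nonneg _)).le⟩
  · exact fun m hm h ↦ hm.2.2.1 (scaledDirection_injective hconc hmono (hdiag _ hm.1)
      (hdiag _ hm.2.1) hm.2.2.2.1 hm.2.2.2.2 h)
  · intro m hm m' hm'
    have h1 := hΓ _ hm.1 _ hm'.2.1
    have h2 := hm.2.2.2.1 ‖m'.1 - m.2.1.1‖ (norm_nonneg _)
    have h3 := hm'.2.2.2.2 ‖m.1 - m'.2.2.1‖ (norm_nonneg _)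
    simp only at h1
    linarith

/-- `μ`-almost no point of `G` is used by `Γ` if no point of `G` is a strictly cheaper source
for a target of `Γ`. -/
theorem measure_zero_of_cheapest (hsmall : DoesNotChargeSmallSets d μ)
    (hmono : StrictMonoOn ϑ (Ici 0))
    (hdiag : ∀ p ∈ Γ, p.1 ≠ p.2) {G : Set (Eucl d)}
    (hΓ : ∀ p ∈ Γ, ∀ x' ∈ G, ϑ ‖p.1 - p.2‖ ≤ ϑ ‖x' - p.2‖) :
    μ {x | x ∈ G ∧ ∃ y, (x, y) ∈ Γ} = 0 := by
  let D : Set (Eucl d × (Eucl d × ℝ) × (Eucl d × ℝ)) :=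
    {m | (m.1, m.2.1.1) ∈ Γ ∧ m.1 ∈ G ∧ m.2.1.2 = 1 ∧ m.2.2 = (m.2.1.1, 0)}
  refine measure_mono_null (t := Prod.fst '' D) ?_ (measure_zero_of_crossing hsmall ?_ ?_ ?_ ?_)
  · rintro x ⟨hx, y, hy⟩
    exact ⟨(x, (y, 1), (y, 0)), ⟨hy, hx, rfl, rfl⟩, rfl⟩
  · intro m hm
    rw [hm.2.2.2]
    exact ⟨hdiag _ hm.1, hdiag _ hm.1⟩
  · intro m hm
    rw [hm.2.2.2, hm.2.2.1]
    simp
  · intro m hm h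
    have h1 := congrArg norm h
    rw [hm.2.2.2, hm.2.2.1, norm_scaledDirection (hdiag _ hm.1) zero_le_one,
      norm_scaledDirection (hdiag _ hm.1) le_rfl] at h1
    exact one_ne_zero h1
  · intro m hm m' hm'
    rw [hm'.2.2.2, hm.2.2.1, zero_mul, one_mul, sub_nonneg]
    exact (hmono.le_iff_le (norm_nonneg _) (norm_nonneg _)).mp (hΓ _ hm.1 _ hm'.2.1)

end Radial

/-- A measure concentrated on a Borel set that is a graph over its first projection is
concentrated on the graph of a Borel map with Borel domain. -/
theorem exists_measurable_graph {X Y : Type*} [MeasurableSpace X] [StandardBorelSpace X]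
    [MeasurableSpace Y] [StandardBorelSpace Y] [Nonempty Y] {Γ : Set (X × Y)}
    (hΓ : MeasurableSet Γ) (hinj : InjOn Prod.fst Γ) :
    MeasurableSet (Prod.fst '' Γ) ∧ ∃ T : X → Y, Measurable T ∧ ∀ p ∈ Γ, p.2 = T p.1 := by
  have := hΓ.standardBorel
  have hemb : MeasurableEmbedding (fun p : Γ ↦ p.1.1) :=
    (measurable_fst.comp measurable_subtype_coe).measurableEmbedding hinj.injective
  obtain ⟨T, hT, hTeq⟩ := hemb.exists_measurable_extend
    (measurable_snd.comp (measurable_subtype_coe (p := (· ∈ Γ)))) fun _ ↦ inferInstance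
  exact ⟨hΓ.image_of_measurable_injOn measurable_fst hinj, T, hT,
    fun p hp ↦ (congrFun hTeq ⟨p, hp⟩).symm⟩

/-- Every optimal semicoupling for `ϑ(|x-y|)` is concentrated on the graph of a map and its first
marginal is the restriction of `μ` to a set. -/
theorem IsOptimalSemicoupling.exists_graph {d : ℕ} {μ ν : Measure (Eucl d)} [IsFiniteMeasure μ]
    {q : Measure (Eucl d × Eucl d)} [IsFiniteMeasure q] {ϑ : ℝ → ℝ}
    (hsmall : DoesNotChargeSmallSets d μ) (hsing : μ ⟂ₘ ν)
    (hc : Continuous fun p : Eucl d × Eucl d ↦ ϑ ‖p.1 - p.2‖)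
    (hconc : StrictConcaveOn ℝ (Ici 0) ϑ) (hmono : StrictMonoOn ϑ (Ici 0))
    (hnonneg : ∀ x, 0 ≤ x → 0 ≤ ϑ x)
    (hq : IsOptimalSemicoupling (fun p ↦ ϑ ‖p.1 - p.2‖) μ ν q)
    (hfin : ∫⁻ p, ENNReal.ofReal (ϑ ‖p.1 - p.2‖) ∂q ≠ ⊤) :
    ∃ (B : Set (Eucl d)) (T : Eucl d → Eucl d), MeasurableSet B ∧ Measurable T ∧
      q.map Prod.fst = μ.restrict B ∧ ∀ᵐ p ∂q, p.2 = T p.1 := by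
  have hc0 : ∀ p : Eucl d × Eucl d, 0 ≤ ϑ ‖p.1 - p.2‖ := fun p ↦ hnonneg _ (norm_nonneg _)
  obtain ⟨S, hS, hμS, hνS⟩ := hsing
  set ρ := μ - q.map Prod.fst with hρ
  have hρμ : q.map Prod.fst + ρ = μ := by
    rw [add_comm]
    exact Measure.sub_add_cancel_of_le hq.1.1
  let Γ := q.support ∩ Sᶜ ×ˢ S
  have hΓm : MeasurableSet Γ :=
    Measure.isClosed_support.measurableSet.inter (hS.compl.prod hS)
  have hdiag : ∀ p ∈ Γ, p.1 ≠ p.2 := fun p hp h ↦ hp.2.1 (h ▸ hp.2.2)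
  have hN₁ := measure_zero_of_monotone_set hsmall hconc hmono hdiag fun p hp p' hp' ↦
    hq.add_le_add_of_mem_support hc hfin hc0 hp.1 hp'.1
  have hN₂ := measure_zero_of_cheapest hsmall hmono hdiag (G := ρ.support)
    fun p hp x' hx' ↦ hq.le_of_mem_support_of_mem_support hc hfin hc0 hp.1 hx'
  set N := toMeasurable μ ({x | ∃ y z, (x, y) ∈ Γ ∧ (x, z) ∈ Γ ∧ y ≠ z} ∪
    {x | x ∈ ρ.support ∧ ∃ y, (x, y) ∈ Γ}) with hN
  have hNm : MeasurableSet N := measurableSet_toMeasurable _ _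
  have hN0 : μ Nᶜᶜ = 0 := by
    rw [compl_compl, hN, measure_toMeasurable]
    exact measure_union_null hN₁ hN₂
  let Γ' := Γ ∩ Nᶜ ×ˢ univ
  have hΓ'm : MeasurableSet Γ' := hΓm.inter (hNm.compl.prod .univ)
  have hΓ'inj : InjOn Prod.fst Γ' := by
    rintro ⟨x, y⟩ hp ⟨x', z⟩ hp' (rfl : x = x')
    by_contra hne
    exact hp.2.1 (subset_toMeasurable _ _ (Or.inl ⟨y, z, hp.1, hp'.1, fun h ↦ hne (by rw [h])⟩))
  obtain ⟨hB, T, hT, hTΓ⟩ := exists_measurable_graph hΓ'm hΓ'inj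
  have hqΓ : ∀ᵐ p ∂q, p ∈ Γ' := by
    filter_upwards [Measure.support_mem_ae (μ := q),
      hq.1.ae_mem_prod hS.compl hS (by rwa [compl_compl]) hνS,
      hq.1.ae_mem_prod hNm.compl .univ hN0 (by simp)] with p h1 h2 h3 using ⟨⟨h1, h2⟩, h3⟩
  refine ⟨Prod.fst '' Γ', T, hB, hT, ?_, hqΓ.mono hTΓ⟩
  have hρB : ρ.restrict (Prod.fst '' Γ') = 0 := by
    rw [Measure.restrict_eq_zero]
    refine measure_mono_null ?_ (Measure.measure_compl_support (μ := ρ))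
    rintro _ ⟨p, hp, rfl⟩ hpρ
    exact hp.2.1 (subset_toMeasurable _ _ (Or.inr ⟨hpρ, p.2, hp.1⟩))
  rw [← hρμ, Measure.restrict_add, hρB, add_zero, Measure.restrict_eq_self_of_ae_mem]
  exact (ae_map_iff (p := fun x ↦ x ∈ Prod.fst '' Γ') measurable_fst.aemeasurable hB).mpr
    (hqΓ.mono fun p hp ↦ ⟨p, hp, rfl⟩)

theorem eq_map_of_ae_graph {X Y : Type*} [MeasurableSpace X] [MeasurableSpace Y]
    {q : Measure (X × Y)} {T : X → Y} (hT : Measurable T) (h : ∀ᵐ p ∂q, p.2 = T p.1) :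
    q = (q.map Prod.fst).map fun x ↦ (x, T x) := by
  rw [Measure.map_map (by fun_prop) measurable_fst]
  conv_lhs => rw [← Measure.map_id (μ := q)]
  exact Measure.map_congr (h.mono fun p hp ↦ Prod.ext rfl hp)

/-- Two measures concentrated on graphs coincide once their average is concentrated on a
graph and saturates the upper bound on their first marginals. -/
theorem eq_of_average_graph {X Y : Type*} [MeasurableSpace X] [MeasurableSpace Y]
    {μ : Measure X} [IsFiniteMeasure μ] {q₁ q₂ : Measure (X × Y)} {B : Set X} {T : X → Y}
    (hB : MeasurableSet B) (hT : Measurable T)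
    (h₁ : q₁.map Prod.fst ≤ μ) (h₂ : q₂.map Prod.fst ≤ μ)
    (hfst : q₁.map Prod.fst + q₂.map Prod.fst = μ.restrict B + μ.restrict B)
    (hgraph : ∀ᵐ p ∂(q₁ + q₂), p.2 = T p.1) : q₁ = q₂ := by
  rw [ae_add_measure_iff] at hgraph
  have hle : ∀ m n : Measure X, m ≤ μ → m + n = μ.restrict B + μ.restrict B →
      m ≤ μ.restrict B := by
    intro m n hm hmn
    have h0 : m Bᶜ = 0 := by
      have : (m + n) Bᶜ = 0 := by simp [hmn, Measure.restrict_apply hB.compl]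
      exact (add_eq_zero.mp this).1
    rw [← Measure.restrict_eq_self_of_ae_mem (μ := m) (s := B) h0]
    exact Measure.restrict_mono_measure hm B
  have hle₁ := hle _ _ h₁ hfst
  have hle₂ := hle _ _ h₂ (by rwa [add_comm])
  have : IsFiniteMeasure (q₁.map Prod.fst) := isFiniteMeasure_of_le _ hle₁
  have heq : ∀ s, q₁.map Prod.fst s = q₂.map Prod.fst s := by
    intro s
    have h := congrArg (fun m : Measure X ↦ m s) hfst
    simp only [Measure.add_apply] at h
    have hf : μ.restrict B s ≠ ⊤ := measure_ne_top _ _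
    have ha := hle₁ s
    have hb := hle₂ s
    have ha' := ne_top_of_le_ne_top hf ha
    have hb' := ne_top_of_le_ne_top hf hb
    lift μ.restrict B s to NNReal using hf with t
    lift q₁.map Prod.fst s to NNReal using ha' with u
    lift q₂.map Prod.fst s to NNReal using hb' with v
    norm_cast at *
    have := NNReal.coe_inj.mpr h
    push_cast at this
    have := NNReal.coe_le_coe.mpr ha
    have := NNReal.coe_le_coe.mpr hb
    ext
    linarith
  rw [eq_map_of_ae_graph hT hgraph.1, eq_map_of_ae_graph hT hgraph.2,
    Measure.ext fun s _ ↦ heq s]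

theorem IsSemicoupling.average {d : ℕ} {μ ν : Measure (Eucl d)} {q₁ q₂ : Measure (Eucl d × Eucl d)}
    (h₁ : IsSemicoupling μ ν q₁) (h₂ : IsSemicoupling μ ν q₂) :
    IsSemicoupling μ ν ((2 : ENNReal)⁻¹ • (q₁ + q₂)) := by
  have h2 : ∀ m : Measure (Eucl d), (2 : ENNReal)⁻¹ • (m + m) = m := fun m ↦ by
    rw [← two_smul ENNReal m, smul_smul, ENNReal.inv_mul_cancel (by simp) (by simp), one_smul]
  constructor
  · rw [Measure.map_smul, Measure.map_add _ _ measurable_fst]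
    calc _ ≤ (2 : ENNReal)⁻¹ • (μ + μ) := by
          gcongr
          exacts [h₁.1, h₂.1]
      _ = μ := h2 μ
  · rw [Measure.map_smul, Measure.map_add _ _ measurable_snd, h₁.2, h₂.2, h2]

theorem IsOptimalSemicoupling.average {d : ℕ} {c : Eucl d × Eucl d → ℝ} {μ ν : Measure (Eucl d)}
    {q₁ q₂ : Measure (Eucl d × Eucl d)}
    (h₁ : IsOptimalSemicoupling c μ ν q₁) (h₂ : IsOptimalSemicoupling c μ ν q₂) :
    IsOptimalSemicoupling c μ ν ((2 : ENNReal)⁻¹ • (q₁ + q₂)) := by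
  refine ⟨h₁.1.average h₂.1, fun q' hq' ↦ ?_⟩
  rw [lintegral_smul_measure, lintegral_add_measure, smul_eq_mul, ENNReal.inv_mul_le_iff
    (by simp) (by simp), two_mul]
  exact add_le_add (h₁.2 q' hq') (h₂.2 q' hq')

theorem exists_isSemicoupling {d : ℕ} {μ ν : Measure (Eucl d)} [IsFiniteMeasure μ]
    [IsFiniteMeasure ν] (hmass : ν univ ≤ μ univ) : ∃ q, IsSemicoupling μ ν q := by
  refine ⟨(μ univ)⁻¹ • μ.prod ν, ?_, ?_⟩
  · rw [Measure.map_smul, Measure.map_fst_prod, smul_smul]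
    refine Measure.le_iff'.mpr fun s ↦ ?_
    rw [Measure.smul_apply, smul_eq_mul, mul_comm (μ univ)⁻¹, ← div_eq_mul_inv]
    exact mul_le_of_le_one_left' (ENNReal.div_le_of_le_mul (by rwa [one_mul]))
  · rw [Measure.map_smul, Measure.map_snd_prod, smul_smul]
    rcases eq_or_ne (μ univ) 0 with h | h
    · rw [h, nonpos_iff_eq_zero, Measure.measure_univ_eq_zero] at hmass
      simp [hmass]
    · rw [ENNReal.inv_mul_cancel h (measure_ne_top _ _), one_smul]

/-- Finite Borel measures are ordered by their integrals of bounded continuous functions. -/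
theorem measure_le_of_forall_lintegral_le {X : Type*} [MetricSpace X] [MeasurableSpace X]
    [BorelSpace X] {m μ : Measure X} [IsFiniteMeasure m] [IsFiniteMeasure μ]
    (h : ∀ f : BoundedContinuousFunction X NNReal, ∫⁻ x, f x ∂m ≤ ∫⁻ x, f x ∂μ) : m ≤ μ := by
  refine Measure.le_iff.mpr fun s hs ↦ ?_
  rw [hs.measure_eq_iSup_isClosed_of_ne_top (measure_ne_top m s)]
  refine iSup_le fun F ↦ iSup_le fun hFs ↦ iSup_le fun hF ↦ ?_
  exact (le_of_tendsto_of_tendsto' (HasOuterApproxClosed.tendsto_lintegral_apprSeq hF m)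
    (HasOuterApproxClosed.tendsto_lintegral_apprSeq hF μ) fun n ↦ h _).trans (measure_mono hFs)

/-- The semicouplings of `μ` and `ν` form a weakly closed set of finite measures. -/
theorem isClosed_setOf_isSemicoupling {d : ℕ} (μ ν : FiniteMeasure (Eucl d)) :
    IsClosed {q : FiniteMeasure (Eucl d × Eucl d) |
      IsSemicoupling (μ : Measure (Eucl d)) ν (q : Measure _)} := by
  have heq : {q : FiniteMeasure (Eucl d × Eucl d) |
      IsSemicoupling (μ : Measure (Eucl d)) ν (q : Measure _)} =
      (⋂ f : BoundedContinuousFunction (Eucl d) NNReal,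
        {q | (q.map Prod.fst).testAgainstNN f ≤ μ.testAgainstNN f}) ∩
      {q | q.map Prod.snd = ν} := by
    ext q
    refine and_congr ?_ (Subtype.ext_iff (a1 := q.map Prod.snd) (a2 := ν)).symm
    simp only [mem_iInter, mem_ofPred_eq, ← ENNReal.coe_le_coe, FiniteMeasure.testAgainstNN_coe_eq]
    exact ⟨fun h f ↦ lintegral_mono' h le_rfl,
      fun h ↦ measure_le_of_forall_lintegral_le h⟩
  rw [heq]
  refine (isClosed_iInter fun f ↦ isClosed_le ?_ continuous_const).inter
    (isClosed_eq (FiniteMeasure.continuous_map continuous_snd) continuous_const)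
  exact (FiniteMeasure.continuous_testAgainstNN_eval f).comp
    (FiniteMeasure.continuous_map continuous_fst)

theorem exists_forall_isSemicoupling_ae_le {d : ℕ} {c : Eucl d × Eucl d → ℝ} (hc : Continuous c)
    {μ ν : Measure (Eucl d)} {K L : Set (Eucl d)} (hK : IsCompact K) (hL : IsCompact L)
    (hμK : μ Kᶜ = 0) (hνL : ν Lᶜ = 0) :
    ∃ M : ℝ, ∀ q, IsSemicoupling μ ν q → ∀ᵐ p ∂q, c p ≤ M := by
  obtain ⟨M, hM⟩ := (hK.prod hL).bddAbove_image hc.continuousOn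
  exact ⟨M, fun q hq ↦ (hq.ae_mem_prod hK.measurableSet hL.measurableSet hμK hνL).mono
    fun p hp ↦ hM (mem_image_of_mem c hp)⟩

theorem exists_isOptimalSemicoupling {d : ℕ} {c : Eucl d × Eucl d → ℝ} (hc : Continuous c)
    {μ ν : Measure (Eucl d)} [IsFiniteMeasure μ] [IsFiniteMeasure ν] {K L : Set (Eucl d)}
    (hK : IsCompact K) (hL : IsCompact L) (hμK : μ Kᶜ = 0) (hνL : ν Lᶜ = 0)
    (hmass : ν univ ≤ μ univ) : ∃ q, IsOptimalSemicoupling c μ ν q := by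
  obtain ⟨M, hM⟩ := exists_forall_isSemicoupling_ae_le hc hK hL hμK hνL
  let f : BoundedContinuousFunction (Eucl d × Eucl d) NNReal :=
    BoundedContinuousFunction.mkOfBound
      ⟨fun p ↦ min (c p).toNNReal M.toNNReal, by fun_prop⟩ M.toNNReal fun p p' ↦ by
        rw [NNReal.dist_eq, abs_sub_le_iff]
        have h1 : (min (c p).toNNReal M.toNNReal : NNReal) ≤ M.toNNReal := min_le_right _ _
        have h2 : (min (c p').toNNReal M.toNNReal : NNReal) ≤ M.toNNReal := min_le_right _ _
        have h3 : (0 : ℝ) ≤ (min (c p).toNNReal M.toNNReal : NNReal) := NNReal.coe_nonneg _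
        have h4 : (0 : ℝ) ≤ (min (c p').toNNReal M.toNNReal : NNReal) := NNReal.coe_nonneg _
        rw [← NNReal.coe_le_coe] at h1 h2
        exact ⟨by simp only [ContinuousMap.coe_mk]; linarith,
          by simp only [ContinuousMap.coe_mk]; linarith⟩
  have hf : ∀ q : FiniteMeasure (Eucl d × Eucl d), IsSemicoupling μ ν (q : Measure _) →
      (q.testAgainstNN f : ENNReal) = ∫⁻ p, ENNReal.ofReal (c p) ∂(q : Measure _) := by
    intro q hq
    rw [FiniteMeasure.testAgainstNN_coe_eq]
    refine lintegral_congr_ae ((hM q hq).mono fun p hp ↦ ?_)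
    exact congrArg ENNReal.ofNNReal (min_eq_left (Real.toNNReal_le_toNNReal hp))
  have hcompact := (isCompact_setOfPred_finiteMeasure_le_of_isCompact (ν univ).toNNReal
    (hK.prod hL)).inter_right (isClosed_setOf_isSemicoupling ⟨μ, inferInstance⟩ ⟨ν, inferInstance⟩)
  have hmem : ∀ q : FiniteMeasure (Eucl d × Eucl d), IsSemicoupling μ ν (q : Measure _) →
      q ∈ {q : FiniteMeasure (Eucl d × Eucl d) |
        q.mass ≤ (ν univ).toNNReal ∧ q (K ×ˢ L)ᶜ = 0} ∩ {q | IsSemicoupling μ ν (q : Measure _)} :=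
    fun q hq ↦ ⟨⟨(congrArg ENNReal.toNNReal hq.measure_univ).le,
      (FiniteMeasure.null_iff_toMeasure_null _ _).mpr
        (hq.ae_mem_prod hK.measurableSet hL.measurableSet hμK hνL)⟩, hq⟩
  obtain ⟨q₀, hq₀⟩ := exists_isSemicoupling hmass
  obtain ⟨q, hq, hmin⟩ := hcompact.exists_isMinOn ⟨⟨q₀, hq₀.isFiniteMeasure⟩, hmem _ hq₀⟩
    (FiniteMeasure.continuous_testAgainstNN_eval f).continuousOn
  refine ⟨q, hq.2, fun q' hq' ↦ ?_⟩
  have hle := hmin (hmem ⟨q', hq'.isFiniteMeasure⟩ hq')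
  have hle' := ENNReal.coe_le_coe.mpr hle
  rwa [hf q hq.2, hf ⟨q', hq'.isFiniteMeasure⟩ hq'] at hle'

/-- **Lemma (uniqueness of optimal semicouplings).** For mutually singular, compactly
supported finite measures with `μ(ℝ^d) ≥ ν(ℝ^d)` and `μ` not charging small sets, and a
strictly concave strictly increasing cost `ϑ(|x-y|)`, the optimal semicoupling is unique
and is induced by a map on a set `B`. -/
theorem unique_optimal_semicoupling
    {d : ℕ} (hd : 1 ≤ d)
    (μ ν : Measure (Eucl d)) [IsFiniteMeasure μ] [IsFiniteMeasure ν]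
    (hμsupp : ∃ K : Set (Eucl d), IsCompact K ∧ μ Kᶜ = 0)
    (hνsupp : ∃ K : Set (Eucl d), IsCompact K ∧ ν Kᶜ = 0)
    (hmass : ν Set.univ ≤ μ Set.univ)
    (hsmall : DoesNotChargeSmallSets d μ)
    (hsing : Measure.MutuallySingular μ ν)
    (ϑ : ℝ → ℝ)
    (hϑc : ContinuousOn ϑ (Set.Ici 0))
    (hϑconc : StrictConcaveOn ℝ (Set.Ici 0) ϑ)
    (hϑmono : StrictMonoOn ϑ (Set.Ici 0))
    (hϑnonneg : ∀ x : ℝ, 0 ≤ x → 0 ≤ ϑ x) :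
    ∃ q : Measure (Eucl d × Eucl d),
      IsSemicoupling μ ν q ∧
      (∀ q' : Measure (Eucl d × Eucl d), IsSemicoupling μ ν q' →
        (∫⁻ p, ENNReal.ofReal (ϑ ‖p.1 - p.2‖) ∂q) ≤
          ∫⁻ p, ENNReal.ofReal (ϑ ‖p.1 - p.2‖) ∂q') ∧
      (∀ q' : Measure (Eucl d × Eucl d), IsSemicoupling μ ν q' →
        (∀ q'' : Measure (Eucl d × Eucl d), IsSemicoupling μ ν q'' →
          (∫⁻ p, ENNReal.ofReal (ϑ ‖p.1 - p.2‖) ∂q') ≤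
            ∫⁻ p, ENNReal.ofReal (ϑ ‖p.1 - p.2‖) ∂q'') →
        q' = q) ∧
      ∃ (B : Set (Eucl d)) (T : Eucl d → Eucl d),
        MeasurableSet B ∧ Measurable T ∧
        q = Measure.map (fun x => (x, T x)) (μ.restrict B) := by
  obtain ⟨K, hK, hμK⟩ := hμsupp
  obtain ⟨L, hL, hνL⟩ := hνsupp
  have hc : Continuous fun p : Eucl d × Eucl d ↦ ϑ ‖p.1 - p.2‖ :=
    hϑc.comp_continuous (by fun_prop) fun _ ↦ norm_nonneg _
  have hfin : ∀ q, IsSemicoupling μ ν q → ∫⁻ p, ENNReal.ofReal (ϑ ‖p.1 - p.2‖) ∂q ≠ ⊤ := by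
    obtain ⟨M, hM⟩ := exists_forall_isSemicoupling_ae_le hc hK hL hμK hνL
    intro q hq
    have := hq.isFiniteMeasure
    exact ne_top_of_le_ne_top (ENNReal.mul_ne_top ENNReal.ofReal_ne_top (measure_ne_top q _))
      (lintegral_ofReal_le_of_ae_le (hM q hq))
  obtain ⟨q, hq⟩ := exists_isOptimalSemicoupling hc hK hL hμK hνL hmass
  have := hq.1.isFiniteMeasure
  refine ⟨q, hq.1, hq.2, fun q' hq' hmin ↦ ?_, ?_⟩
  · have := hq'.isFiniteMeasure
    have havg := IsOptimalSemicoupling.average ⟨hq', hmin⟩ hq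
    have := havg.1.isFiniteMeasure
    obtain ⟨B, T, hB, hT, hfst, hgraph⟩ :=
      havg.exists_graph hsmall hsing hc hϑconc hϑmono hϑnonneg (hfin _ havg.1)
    refine eq_of_average_graph hB hT hq'.1 hq.1.1 ?_
      ((Measure.ae_ennreal_smul_measure_iff (by simp)).mp hgraph)
    rw [Measure.map_smul, Measure.map_add _ _ measurable_fst] at hfst
    rw [← two_smul ENNReal (μ.restrict B), ← hfst, smul_smul,
      ENNReal.mul_inv_cancel (by simp) (by simp), one_smul]
  · obtain ⟨B, T, hB, hT, hfst, hgraph⟩ :=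
      hq.exists_graph hsmall hsing hc hϑconc hϑmono hϑnonneg (hfin _ hq.1)
    exact ⟨B, T, hB, hT, hfst ▸ eq_map_of_ae_graph hT hgraph⟩
end
end

section
/- Let f : [0,∞) → [0,∞) be Lebesgue integrable. Then there exists a function ϑ : [0,∞) → [0,∞) which is continuous, concave, strictly increasing, infinitely differentiable on (0,∞), satisfies ϑ(0) = 0 and lim_{x→∞} ϑ(x) = ∞, and such that ∫_0^∞ f(x) ϑ(x) dx < ∞. -/
open MeasureTheory Filter Set

/-- A series of integrable functions whose `L¹` norms are summable has an integrable sum. -/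
theorem integrable_tsum_of_summable_integral_norm {α ι E : Type*} [MeasurableSpace α]
    {μ : Measure α} [Countable ι] [NormedAddCommGroup E] {F : ι → α → E}
    (hmeas : AEStronglyMeasurable (fun a => ∑' i, F i a) μ)
    (hF_int : ∀ i, Integrable (F i) μ) (hF_sum : Summable fun i => ∫ a, ‖F i a‖ ∂μ) :
    Integrable (fun a => ∑' i, F i a) μ := by
  refine ⟨hmeas, ?_⟩
  calc ∫⁻ a, ‖∑' i, F i a‖ₑ ∂μ ≤ ∫⁻ a, ∑' i, ‖F i a‖ₑ ∂μ :=
        lintegral_mono fun a => enorm_tsum_le_tsum_enorm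
    _ = ∑' i, ∫⁻ a, ‖F i a‖ₑ ∂μ := lintegral_tsum fun i => (hF_int i).1.enorm
    _ = ∑' i, ENNReal.ofReal (∫ a, ‖F i a‖ ∂μ) := by
        simp_rw [ofReal_integral_norm_eq_lintegral_enorm (hF_int _)]
    _ < ⊤ := hF_sum.tsum_ofReal_lt_top

theorem Complex.norm_one_sub_exp_le (z : ℂ) :
    ‖1 - Complex.exp z‖ ≤ ‖z‖ * Real.exp ‖z‖ := by
  rw [norm_sub_rev]
  simpa using Complex.norm_exp_sub_sum_le_norm_mul_exp z 1

theorem strictMono_one_sub_exp_neg_mul {c : ℝ} (hc : 0 < c) :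
    StrictMono fun x : ℝ => 1 - Real.exp (-(c * x)) := by
  intro x y hxy
  have := mul_lt_mul_of_pos_left hxy hc
  simpa using this

theorem one_sub_exp_neg_mul_nonneg {c x : ℝ} (hc : 0 ≤ c) (hx : 0 ≤ x) :
    0 ≤ 1 - Real.exp (-(c * x)) := by
  simpa using mul_nonneg hc hx

theorem norm_one_sub_exp_neg_mul_le_one {c x : ℝ} (hc : 0 ≤ c) (hx : 0 ≤ x) :
    ‖1 - Real.exp (-(c * x))‖ ≤ 1 := by
  rw [Real.norm_of_nonneg (one_sub_exp_neg_mul_nonneg hc hx)]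
  linarith [Real.exp_pos (-(c * x))]

theorem concaveOn_one_sub_exp_neg_mul (c : ℝ) :
    ConcaveOn ℝ univ fun x : ℝ => 1 - Real.exp (-(c * x)) := by
  refine ⟨convex_univ, fun x _ y _ a b ha hb hab => ?_⟩
  have h := convexOn_exp.2 (mem_univ (-(c * x))) (mem_univ (-(c * y))) ha hb hab
  simp only [smul_eq_mul] at h ⊢
  have e : -(c * (a * x + b * y)) = a * -(c * x) + b * -(c * y) := by ring
  rw [e]
  linarith

theorem tendsto_one_sub_exp_neg_mul {c : ℝ} (hc : 0 < c) :
    Tendsto (fun x : ℝ => 1 - Real.exp (-(c * x))) atTop (nhds 1) := by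
  have h : Tendsto (fun x : ℝ => Real.exp (-(c * x))) atTop (nhds 0) :=
    Real.tendsto_exp_neg_atTop_nhds_zero.comp (tendsto_id.const_mul_atTop hc)
  simpa using h.const_sub 1

theorem integrableOn_mul_one_sub_exp_neg_mul
    {f : ℝ → ℝ} (hf : IntegrableOn f (Ici 0)) {c : ℝ} (hc : 0 ≤ c) :
    IntegrableOn (fun x => f x * (1 - Real.exp (-(c * x)))) (Ici 0) := by
  refine hf.mul_bdd (c := 1) (by fun_prop) ?_
  filter_upwards [ae_restrict_mem measurableSet_Ici] with x hx
  exact norm_one_sub_exp_neg_mul_le_one hc hx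

theorem tendsto_integral_norm_mul_one_sub_exp_neg_mul
    {f : ℝ → ℝ} (hf : IntegrableOn f (Ici 0)) :
    Tendsto (fun c : ℝ => ∫ x in Ici 0, ‖f x * (1 - Real.exp (-(c * x)))‖)
      (nhdsWithin 0 (Ioi 0)) (nhds 0) := by
  have key := tendsto_integral_filter_of_dominated_convergence
    (μ := volume.restrict (Ici (0 : ℝ))) (l := nhdsWithin (0 : ℝ) (Ioi 0))
    (F := fun c x => ‖f x * (1 - Real.exp (-(c * x)))‖) (f := fun _ => (0 : ℝ))
    (fun x => ‖f x‖) ?_ ?_ hf.norm ?_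
  · simpa using key
  · filter_upwards [self_mem_nhdsWithin] with c hc
    exact (integrableOn_mul_one_sub_exp_neg_mul hf (le_of_lt hc)).1.norm
  · filter_upwards [self_mem_nhdsWithin] with c hc
    filter_upwards [ae_restrict_mem measurableSet_Ici] with x hx
    rw [norm_norm, norm_mul]
    exact mul_le_of_le_one_right (norm_nonneg _)
      (norm_one_sub_exp_neg_mul_le_one (le_of_lt hc) hx)
  · refine Eventually.of_forall fun x => ?_
    have h : Continuous fun c : ℝ => ‖f x * (1 - Real.exp (-(c * x)))‖ := by fun_prop
    simpa using (h.tendsto 0).mono_left nhdsWithin_le_nhds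

theorem differentiable_tsum_one_sub_exp_neg_mul
    {c : ℕ → ℝ} (hc : ∀ k, 0 < c k) (hs : Summable c) :
    Differentiable ℂ fun z : ℂ => ∑' k, (1 - Complex.exp (-(c k * z))) := by
  intro z
  set R := ‖z‖ + 1
  set C := ∑' k, c k
  have hd : DifferentiableOn ℂ (fun z : ℂ => ∑' k, (1 - Complex.exp (-(c k * z))))
      (Metric.ball 0 R) := by
    refine Complex.differentiableOn_tsum_of_summable_norm
      (u := fun k => c k * (R * Real.exp (C * R))) (hs.mul_right _)
      (fun k => by fun_prop) Metric.isOpen_ball fun k w hw => ?_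
    have hw' : ‖w‖ ≤ R := (mem_ball_zero_iff.1 hw).le
    have hn : ‖-((c k : ℂ) * w)‖ = c k * ‖w‖ := by
      simp [abs_of_pos (hc k)]
    have hcC : c k ≤ C := hs.le_tsum k fun j _ => (hc j).le
    have hc0 := (hc k).le
    have hC0 : 0 ≤ C := hc0.trans hcC
    calc ‖1 - Complex.exp (-(c k * w))‖ ≤ c k * ‖w‖ * Real.exp (c k * ‖w‖) := by
          simpa only [hn] using Complex.norm_one_sub_exp_le (-((c k : ℂ) * w))
      _ ≤ c k * R * Real.exp (C * R) := by gcongr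
      _ = c k * (R * Real.exp (C * R)) := by ring
  exact hd.differentiableAt (Metric.isOpen_ball.mem_nhds (by simp [R]))

theorem summable_one_sub_exp_neg_mul
    {c : ℕ → ℝ} (hc : ∀ k, 0 < c k) (hs : Summable c) {x : ℝ} (hx : 0 ≤ x) :
    Summable fun k => 1 - Real.exp (-(c k * x)) := by
  refine .of_nonneg_of_le (fun k => one_sub_exp_neg_mul_nonneg (hc k).le hx) (fun k => ?_)
    (hs.mul_right x)
  linarith [Real.one_sub_le_exp_neg (c k * x)]

theorem contDiff_tsum_one_sub_exp_neg_mul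
    {c : ℕ → ℝ} (hc : ∀ k, 0 < c k) (hs : Summable c) {n : WithTop ℕ∞} :
    ContDiff ℝ n fun x : ℝ => ∑' k, (1 - Real.exp (-(c k * x))) := by
  have h : (fun x : ℝ => ∑' k, (1 - Real.exp (-(c k * x)))) =
      fun x : ℝ => (∑' k, (1 - Complex.exp (-(c k * (x : ℂ))))).re := by
    funext x
    rw [← Complex.ofReal_re (∑' k, (1 - Real.exp (-(c k * x))))]
    push_cast
    rfl
  rw [h]
  exact (differentiable_tsum_one_sub_exp_neg_mul hc hs).contDiff.real_of_complex

theorem concaveOn_tsum_one_sub_exp_neg_mul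
    {c : ℕ → ℝ} (hc : ∀ k, 0 < c k) (hs : Summable c) :
    ConcaveOn ℝ (Ici 0) fun x : ℝ => ∑' k, (1 - Real.exp (-(c k * x))) := by
  refine ⟨convex_Ici 0, fun x hx y hy a b ha hb hab => ?_⟩
  have sx := (summable_one_sub_exp_neg_mul hc hs hx).mul_left a
  have sy := (summable_one_sub_exp_neg_mul hc hs hy).mul_left b
  have sxy := summable_one_sub_exp_neg_mul hc hs (convex_Ici (0 : ℝ) hx hy ha hb hab)
  simp only [smul_eq_mul] at sxy ⊢
  rw [← tsum_mul_left, ← tsum_mul_left, ← sx.tsum_add sy]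
  exact (sx.add sy).tsum_le_tsum
    (fun k => (concaveOn_one_sub_exp_neg_mul (c k)).2 (mem_univ x) (mem_univ y) ha hb hab) sxy

theorem strictMonoOn_tsum_one_sub_exp_neg_mul
    {c : ℕ → ℝ} (hc : ∀ k, 0 < c k) (hs : Summable c) :
    StrictMonoOn (fun x : ℝ => ∑' k, (1 - Real.exp (-(c k * x)))) (Ici 0) :=
  fun _ hx _ hy hxy => Summable.tsum_lt_tsum (i := 0)
    (fun k => (strictMono_one_sub_exp_neg_mul (hc k)).monotone hxy.le)
    (strictMono_one_sub_exp_neg_mul (hc 0) hxy)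
    (summable_one_sub_exp_neg_mul hc hs hx) (summable_one_sub_exp_neg_mul hc hs hy)

theorem tendsto_tsum_one_sub_exp_neg_mul_atTop
    {c : ℕ → ℝ} (hc : ∀ k, 0 < c k) (hs : Summable c) :
    Tendsto (fun x : ℝ => ∑' k, (1 - Real.exp (-(c k * x)))) atTop atTop := by
  refine tendsto_atTop.2 fun M => ?_
  obtain ⟨N, hN⟩ := exists_nat_gt M
  have h : Tendsto (fun x : ℝ => ∑ k ∈ Finset.range N, (1 - Real.exp (-(c k * x)))) atTop
      (nhds (N : ℝ)) := by
    simpa using tendsto_finsetSum (Finset.range N)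
      fun k _ => tendsto_one_sub_exp_neg_mul (hc k)
  filter_upwards [h.eventually (lt_mem_nhds hN), eventually_ge_atTop 0] with x hx hx0
  exact hx.le.trans ((summable_one_sub_exp_neg_mul hc hs hx0).sum_le_tsum _
    fun k _ => one_sub_exp_neg_mul_nonneg (hc k).le hx0)

/-- **Lemma (de la Vallée Poussin type).** For every Lebesgue integrable
`f : [0,∞) → [0,∞)` there is a continuous, concave, strictly increasing function
`ϑ : [0,∞) → [0,∞)`, smooth on `(0,∞)`, with `ϑ 0 = 0` and `ϑ → ∞`, such that
`∫_0^∞ f x * ϑ x dx < ∞`. -/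
theorem de_la_Vallee_Poussin_concave
    (f : ℝ → ℝ)
    (hfnonneg : ∀ x : ℝ, 0 ≤ x → 0 ≤ f x)
    (hfint : IntegrableOn f (Set.Ici 0)) :
    ∃ ϑ : ℝ → ℝ,
      ContinuousOn ϑ (Set.Ici 0) ∧
      ConcaveOn ℝ (Set.Ici 0) ϑ ∧
      StrictMonoOn ϑ (Set.Ici 0) ∧
      ContDiffOn ℝ (⊤ : ℕ∞) ϑ (Set.Ioi 0) ∧
      ϑ 0 = 0 ∧
      (∀ x : ℝ, 0 ≤ x → 0 ≤ ϑ x) ∧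
      Tendsto ϑ atTop atTop ∧
      IntegrableOn (fun x => f x * ϑ x) (Set.Ici 0) := by
  have hex (k : ℕ) : ∃ c : ℝ, 0 < c ∧ c < (1 / 2) ^ k ∧
      ∫ x in Ici 0, ‖f x * (1 - Real.exp (-(c * x)))‖ < (1 / 2) ^ k := by
    have hk : (0 : ℝ) < (1 / 2) ^ k := by positivity
    obtain ⟨c, hc, hck, hint⟩ := (eventually_mem_nhdsWithin.and
      ((eventually_nhdsWithin_of_eventually_nhds (gt_mem_nhds hk)).and
        ((tendsto_integral_norm_mul_one_sub_exp_neg_mul hfint).eventually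
          (gt_mem_nhds hk)))).exists
    exact ⟨c, hc, hck, hint⟩
  choose c hc hck hint using hex
  have hs : Summable c :=
    summable_geometric_two.of_nonneg_of_le (fun k => (hc k).le) fun k => (hck k).le
  have hcont : Continuous fun x : ℝ => ∑' k, (1 - Real.exp (-(c k * x))) :=
    (contDiff_tsum_one_sub_exp_neg_mul (n := 0) hc hs).continuous
  refine ⟨fun x => ∑' k, (1 - Real.exp (-(c k * x))), hcont.continuousOn,
    concaveOn_tsum_one_sub_exp_neg_mul hc hs, strictMonoOn_tsum_one_sub_exp_neg_mul hc hs,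
    (contDiff_tsum_one_sub_exp_neg_mul hc hs).contDiffOn, by simp,
    fun x hx => tsum_nonneg fun k => one_sub_exp_neg_mul_nonneg (hc k).le hx,
    tendsto_tsum_one_sub_exp_neg_mul_atTop hc hs, ?_⟩
  have hmeas := hfint.1.mul hcont.aestronglyMeasurable
  simp only [← tsum_mul_left, Pi.mul_def] at hmeas ⊢
  exact integrable_tsum_of_summable_integral_norm hmeas
    (fun k => integrableOn_mul_one_sub_exp_neg_mul hfint (hc k).le)
    (summable_geometric_two.of_nonneg_of_le
      (fun k => integral_nonneg fun x => norm_nonneg _) fun k => (hint k).le)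
end
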